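/- arXiv:1110.5894 — 2 statements merged into one kernel-verified Lean document; each statement's English description precedes it below -/
import Mathlib

section
/- Assume Ψ : (0,∞) → [0,∞) is strictly increasing, twice continuously differentiable with Ψ'(ζ) > 0 for all ζ > 0, ∫₀^∞ 1/(1+Ψ(ζ)) dζ < ∞, Ψ(ζ) → 0 as ζ → 0⁺, and Ψ(ζ) → ∞ as ζ → ∞. Then for all ξ₁, ξ₂ > 0, the function λ ↦ (K_λ L_λ(ξ₁) − K_λ(ξ₁)) · (K_λ L_λ(ξ₂) − K_λ(ξ₂)) / (1 + K_λ²) is integrable on (0,∞) and ∫₀^∞ (K_λ L_λ(ξ₁) − K_λ(ξ₁)) · (K_λ L_λ(ξ₂) − K_λ(ξ₂)) / (1 + K_λ²) dλ = (π/2) · ξ₁ξ₂/(ξ₁+ξ₂). -/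
open MeasureTheory Filter Topology Set

/-- Regularity and growth assumptions on the symbol `Ψ`, with derivatives `Ψ'` and `Ψ''`. -/
structure RegularSymbol (Ψ Ψ' Ψ'' : ℝ → ℝ) : Prop where
  mono : StrictMonoOn Ψ (Ioi 0)
  pos : ∀ ζ ∈ Ioi (0:ℝ), 0 < Ψ ζ
  hasDerivAt : ∀ ζ ∈ Ioi (0:ℝ), HasDerivAt Ψ (Ψ' ζ) ζ
  hasDerivAt_deriv : ∀ ζ ∈ Ioi (0:ℝ), HasDerivAt Ψ' (Ψ'' ζ) ζ
  continuousOn_deriv2 : ContinuousOn Ψ'' (Ioi 0)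
  deriv_pos : ∀ ζ ∈ Ioi (0:ℝ), 0 < Ψ' ζ
  integrableOn : IntegrableOn (fun ζ => 1 / (1 + Ψ ζ)) (Ioi 0)
  tendsto_zero : Tendsto Ψ (𝓝[>] 0) (𝓝 0)
  tendsto_atTop : Tendsto Ψ atTop atTop

/-- Continuously differentiable bounded functions on the half-line. -/
structure BoundedC1 (f f' : ℝ → ℝ) (B : ℝ) : Prop where
  hasDerivAt : ∀ ζ ∈ Ioi (0:ℝ), HasDerivAt f (f' ζ) ζ
  continuousOn_deriv : ContinuousOn f' (Ioi 0)
  abs_le : ∀ ζ ∈ Ioi (0:ℝ), |f ζ| ≤ B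

/-- The Cauchy-type transform `z ↦ ∫₀^∞ f(ζ) / (Ψ(ζ) - z) dζ`. -/
noncomputable def resolventIntegral (Ψ f : ℝ → ℝ) (z : ℂ) : ℂ :=
  ∫ ζ in Ioi (0:ℝ), (f ζ : ℂ) / ((Ψ ζ : ℂ) - z)

/-- The Schur complement of the constant function in the resolvent form of multiplication
by `Ψ`. -/
noncomputable def schurComplement (Ψ f : ℝ → ℝ) (z : ℂ) : ℂ :=
  resolventIntegral Ψ (fun ζ => f ζ ^ 2) z -
    resolventIntegral Ψ f z ^ 2 / resolventIntegral Ψ (fun _ => 1) z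

section Polar

open Complex

lemma re_rotated_sub_conj_exp (t : ℝ) (w : ℂ) :
    (-I * exp (I * (w.im / 2 : ℝ)) * ((t : ℂ) - (starRingEnd ℂ) (exp w))).re =
      (t + Real.exp w.re) * Real.sin (w.im / 2) := by
  have h1 : (starRingEnd ℂ) (exp w) = exp (w.re - I * w.im) := by
    rw [← exp_conj]; congr 1
    apply Complex.ext <;> simp
  rw [h1]
  have h2 : -I * exp (I * (w.im / 2 : ℝ)) * ((t : ℂ) - exp (w.re - I * w.im)) =
      -I * t * exp ((w.im / 2 : ℝ) * I) + I * (exp (w.re : ℂ)) * exp ((-(w.im / 2) : ℝ) * I) := by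
    have : exp (w.re - I * w.im) = exp (w.re : ℂ) * exp (- (I * w.im)) := by
      rw [← exp_add]; ring_nf
    rw [this, mul_sub]
    have h3 : exp (I * (w.im / 2 : ℝ)) * exp (-(I * w.im)) = exp ((-(w.im / 2) : ℝ) * I) := by
      rw [← exp_add]; congr 1; push_cast; ring
    rw [← h3, mul_comm ((w.im / 2 : ℝ) : ℂ) I]; ring
  rw [h2, ← ofReal_exp, exp_mul_I, exp_mul_I, ← ofReal_cos, ← ofReal_sin, ← ofReal_cos,
    ← ofReal_sin, Real.cos_neg, Real.sin_neg]
  generalize Real.cos (w.im / 2) = c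
  generalize Real.sin (w.im / 2) = s
  generalize Real.exp w.re = r
  simp
  ring

lemma norm_rotation (w : ℂ) : ‖-I * exp (I * (w.im / 2 : ℝ))‖ = 1 := by
  rw [norm_mul, norm_neg, norm_I, mul_comm I, norm_exp_ofReal_mul_I, one_mul]

lemma sin_half_pos {w : ℂ} (h0 : 0 < w.im) (h1 : w.im < 2 * Real.pi) :
    0 < Real.sin (w.im / 2) :=
  Real.sin_pos_of_pos_of_lt_pi (by linarith) (by linarith)

lemma mul_sin_half_le_norm_sub_exp (t : ℝ) (w : ℂ) :
    (t + Real.exp w.re) * Real.sin (w.im / 2) ≤ ‖(t : ℂ) - exp w‖ := by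
  rw [← re_rotated_sub_conj_exp]
  refine (re_le_norm _).trans ?_
  rw [norm_mul, norm_rotation, one_mul, ← Complex.norm_conj]
  simp

lemma abs_sub_exp_re_le {t : ℝ} (ht : 0 ≤ t) (w : ℂ) :
    |t - Real.exp w.re| ≤ ‖(t : ℂ) - exp w‖ := by
  have := abs_norm_sub_norm_le (t : ℂ) (exp w)
  rwa [norm_exp, norm_real, Real.norm_of_nonneg ht] at this

lemma exists_mul_one_add_le_norm_sub_exp {w : ℂ} (h0 : 0 < w.im) (h1 : w.im < 2 * Real.pi) :
    ∃ δ > 0, ∀ t : ℝ, 0 ≤ t → δ * (1 + t) ≤ ‖(t : ℂ) - exp w‖ := by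
  have hs := sin_half_pos h0 h1
  have hr := Real.exp_pos w.re
  refine ⟨min 1 (Real.exp w.re) * Real.sin (w.im / 2), by positivity, fun t ht => ?_⟩
  refine le_trans ?_ (mul_sin_half_le_norm_sub_exp t w)
  have h2 := min_le_left 1 (Real.exp w.re)
  have h3 := min_le_right 1 (Real.exp w.re)
  have : min 1 (Real.exp w.re) * (1 + t) ≤ t + Real.exp w.re := by nlinarith
  nlinarith

end Polar

namespace RegularSymbol

variable {Ψ Ψ' Ψ'' f f' : ℝ → ℝ} {B : ℝ}

lemma continuousOn (hΨ : RegularSymbol Ψ Ψ' Ψ'') : ContinuousOn Ψ (Ioi 0) :=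
  fun ζ hζ => (hΨ.hasDerivAt ζ hζ).continuousAt.continuousWithinAt

lemma _root_.BoundedC1.continuousOn (hf : BoundedC1 f f' B) : ContinuousOn f (Ioi 0) :=
  fun ζ hζ => (hf.hasDerivAt ζ hζ).continuousAt.continuousWithinAt

lemma _root_.BoundedC1.sq (hf : BoundedC1 f f' B) :
    BoundedC1 (fun ζ => f ζ ^ 2) (fun ζ => 2 * f ζ * f' ζ) (B ^ 2) where
  hasDerivAt ζ hζ := by simpa using (hf.hasDerivAt ζ hζ).fun_pow 2
  continuousOn_deriv := (continuousOn_const.mul hf.continuousOn).mul hf.continuousOn_deriv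
  abs_le ζ hζ := by
    rw [abs_pow]; exact pow_le_pow_left₀ (abs_nonneg _) (hf.abs_le ζ hζ) 2

lemma _root_.BoundedC1.one : BoundedC1 (fun _ => 1) (fun _ => 0) 1 where
  hasDerivAt ζ _ := hasDerivAt_const ζ 1
  continuousOn_deriv := continuousOn_const
  abs_le ζ _ := by simp

lemma _root_.BoundedC1.bound_nonneg (hf : BoundedC1 f f' B) : 0 ≤ B :=
  (abs_nonneg _).trans (hf.abs_le 1 (mem_Ioi.2 one_pos))

lemma exists_apply_eq (hΨ : RegularSymbol Ψ Ψ' Ψ'') {y : ℝ} (hy : 0 < y) :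
    ∃ ζ ∈ Ioi (0:ℝ), Ψ ζ = y := by
  obtain ⟨a, ha, ha0⟩ : ∃ a, Ψ a < y ∧ a ∈ Ioi (0:ℝ) :=
    ((hΨ.tendsto_zero.eventually (gt_mem_nhds hy)).and self_mem_nhdsWithin).exists
  obtain ⟨b, hb, hab⟩ : ∃ b, y < Ψ b ∧ a ≤ b :=
    ((hΨ.tendsto_atTop.eventually (eventually_gt_atTop y)).and (eventually_ge_atTop a)).exists
  obtain ⟨c, hc, hcy⟩ := intermediate_value_Icc hab
    (hΨ.continuousOn.mono fun x hx => lt_of_lt_of_le ha0 hx.1) ⟨ha.le, hb.le⟩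
  exact ⟨c, lt_of_lt_of_le ha0 hc.1, hcy⟩

lemma integrableOn_of_norm_le (hΨ : RegularSymbol Ψ Ψ' Ψ'') {E : Type*} [NormedAddCommGroup E]
    {g : ℝ → E} (hg : AEStronglyMeasurable g (volume.restrict (Ioi 0))) (C : ℝ)
    (h : ∀ ζ ∈ Ioi (0:ℝ), ‖g ζ‖ ≤ C * (1 / (1 + Ψ ζ))) : IntegrableOn g (Ioi 0) :=
  (hΨ.integrableOn.const_mul C).mono' hg ((ae_restrict_iff' measurableSet_Ioi).2 (.of_forall h))

lemma aestronglyMeasurable_div_sub (hΨ : RegularSymbol Ψ Ψ' Ψ'')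
    {g : ℝ → ℂ} (hg : AEStronglyMeasurable g (volume.restrict (Ioi 0))) (z : ℂ) :
    AEStronglyMeasurable (fun ζ => g ζ / ((Ψ ζ : ℂ) - z)) (volume.restrict (Ioi 0)) := by
  have h1 : AEStronglyMeasurable Ψ (volume.restrict (Ioi 0)) :=
    hΨ.continuousOn.aestronglyMeasurable measurableSet_Ioi
  have h2 : AEMeasurable (fun ζ => (Ψ ζ : ℂ)) (volume.restrict (Ioi 0)) :=
    Complex.measurable_ofReal.comp_aemeasurable h1.aemeasurable
  exact (hg.aemeasurable.div (h2.sub_const z)).aestronglyMeasurable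

lemma _root_.BoundedC1.aestronglyMeasurable (hf : BoundedC1 f f' B) :
    AEStronglyMeasurable f (volume.restrict (Ioi 0)) :=
  hf.continuousOn.aestronglyMeasurable measurableSet_Ioi

lemma _root_.BoundedC1.aestronglyMeasurable_ofReal (hf : BoundedC1 f f' B) :
    AEStronglyMeasurable (fun ζ => (f ζ : ℂ)) (volume.restrict (Ioi 0)) :=
  (Complex.measurable_ofReal.comp_aemeasurable
    hf.aestronglyMeasurable.aemeasurable).aestronglyMeasurable

lemma norm_div_le {δ t : ℝ} (hδ : 0 < δ) (ht : 0 ≤ t) {z u : ℂ}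
    (h : δ * (1 + t) ≤ ‖(t : ℂ) - z‖) (hu : ‖u‖ ≤ B) :
    ‖u / ((t : ℂ) - z)‖ ≤ B / δ * (1 / (1 + t)) := by
  rw [norm_div, div_mul_div_comm, mul_one]
  exact div_le_div₀ ((norm_nonneg _).trans hu) hu (by positivity) h

lemma integrableOn_div_sub (hΨ : RegularSymbol Ψ Ψ' Ψ'') (hf : BoundedC1 f f' B) {z : ℂ} {δ : ℝ}
    (hδ : 0 < δ) (h : ∀ t : ℝ, 0 ≤ t → δ * (1 + t) ≤ ‖(t : ℂ) - z‖) :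
    IntegrableOn (fun ζ => (f ζ : ℂ) / ((Ψ ζ : ℂ) - z)) (Ioi 0) :=
  hΨ.integrableOn_of_norm_le (hΨ.aestronglyMeasurable_div_sub hf.aestronglyMeasurable_ofReal z)
    (B / δ) fun ζ hζ => norm_div_le hδ (hΨ.pos ζ hζ).le (h _ (hΨ.pos ζ hζ).le)
      (by simpa using hf.abs_le ζ hζ)

lemma integrableOn_div_sub_exp (hΨ : RegularSymbol Ψ Ψ' Ψ'') (hf : BoundedC1 f f' B) {w : ℂ}
    (h0 : 0 < w.im) (h1 : w.im < 2 * Real.pi) :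
    IntegrableOn (fun ζ => (f ζ : ℂ) / ((Ψ ζ : ℂ) - Complex.exp w)) (Ioi 0) := by
  obtain ⟨δ, hδ, h⟩ := exists_mul_one_add_le_norm_sub_exp h0 h1
  exact hΨ.integrableOn_div_sub hf hδ h

lemma differentiableAt_resolventIntegral (hΨ : RegularSymbol Ψ Ψ' Ψ'') (hf : BoundedC1 f f' B)
    {z : ℂ} {δ : ℝ} (hδ : 0 < δ) (h : ∀ t : ℝ, 0 ≤ t → δ * (1 + t) ≤ ‖(t : ℂ) - z‖) :
    DifferentiableAt ℂ (resolventIntegral Ψ f) z := by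
  have hball : ∀ u ∈ Metric.ball z (δ / 2), ∀ t : ℝ, 0 ≤ t →
      δ / 2 * (1 + t) ≤ ‖(t : ℂ) - u‖ := by
    intro u hu t ht
    have h1 := h t ht
    have h2 : ‖u - z‖ < δ / 2 := by simpa [dist_eq_norm] using hu
    have h3 : ‖(t : ℂ) - z‖ ≤ ‖(t : ℂ) - u‖ + ‖u - z‖ := by
      simpa using norm_add_le ((t : ℂ) - u) (u - z)
    nlinarith
  refine (hasDerivAt_integral_of_dominated_loc_of_deriv_le
    (μ := volume.restrict (Ioi (0:ℝ)))
    (F := fun u ζ => (f ζ : ℂ) / ((Ψ ζ : ℂ) - u))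
    (F' := fun u ζ => (f ζ : ℂ) / ((Ψ ζ : ℂ) - u) / ((Ψ ζ : ℂ) - u))
    (bound := fun ζ => B / (δ / 2) / (δ / 2) * (1 / (1 + Ψ ζ)))
    (Metric.ball_mem_nhds z (half_pos hδ)) ?_ ?_ ?_ ?_ ?_ ?_).2.differentiableAt
  · exact .of_forall fun u => hΨ.aestronglyMeasurable_div_sub hf.aestronglyMeasurable_ofReal u
  · exact hΨ.integrableOn_div_sub hf hδ h
  · exact hΨ.aestronglyMeasurable_div_sub
      (hΨ.aestronglyMeasurable_div_sub hf.aestronglyMeasurable_ofReal z) z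
  · refine (ae_restrict_iff' measurableSet_Ioi).2 (.of_forall fun ζ hζ u hu => ?_)
    have hp := (hΨ.pos ζ hζ).le
    have hb := hball u hu _ hp
    refine norm_div_le (half_pos hδ) hp hb ?_
    refine (norm_div_le (half_pos hδ) hp hb (by simpa using hf.abs_le ζ hζ)).trans ?_
    have h4 : 1 / (1 + Ψ ζ) ≤ 1 := by
      rw [div_le_one (by positivity)]; linarith
    have h5 : 0 ≤ B / (δ / 2) := div_nonneg hf.bound_nonneg (by positivity)
    nlinarith
  · exact hΨ.integrableOn.const_mul _
  · refine (ae_restrict_iff' measurableSet_Ioi).2 (.of_forall fun ζ hζ u hu => ?_)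
    have hp := (hΨ.pos ζ hζ).le
    have hb := hball u hu _ hp
    have hne : (Ψ ζ : ℂ) - u ≠ 0 := by
      rw [← norm_pos_iff]; exact lt_of_lt_of_le (by positivity) hb
    have h6 : HasDerivAt (fun u : ℂ => (Ψ ζ : ℂ) - u) (-1) u := by
      simpa using (hasDerivAt_id u).const_sub (Ψ ζ : ℂ)
    have h7 := (hasDerivAt_const u (f ζ : ℂ)).fun_div h6 hne
    refine h7.congr_deriv ?_
    rw [div_div, ← sq]
    ring

end RegularSymbol

namespace RegularSymbol

variable {Ψ Ψ' Ψ'' f f' : ℝ → ℝ} {B : ℝ}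

lemma integrableOn_div_add_exp (hΨ : RegularSymbol Ψ Ψ' Ψ'') (hf : BoundedC1 f f' B) (x : ℝ) :
    IntegrableOn (fun ζ => f ζ / (Ψ ζ + Real.exp x)) (Ioi 0) := by
  have h := hΨ.integrableOn_div_sub_exp hf (w := x + Real.pi * Complex.I)
    (by simp [Real.pi_pos]) (by simp [Real.pi_pos])
  have h2 : IntegrableOn (fun ζ => (((f ζ / (Ψ ζ + Real.exp x) : ℝ)) : ℂ)) (Ioi 0) := by
    refine h.congr_fun (fun ζ _ => ?_) measurableSet_Ioi
    simp [Complex.exp_add]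
  exact h2.re

/-- Lower bound for the transform of the constant function. -/
lemma sin_half_mul_le_norm_resolventIntegral_one (hΨ : RegularSymbol Ψ Ψ' Ψ'') {w : ℂ}
    (h0 : 0 < w.im) (h1 : w.im < 2 * Real.pi) :
    Real.sin (w.im / 2) * ∫ ζ in Ioi (0:ℝ),
        (Ψ ζ + Real.exp w.re) / ‖(Ψ ζ : ℂ) - Complex.exp w‖ ^ 2 ≤
      ‖resolventIntegral Ψ (fun _ => 1) (Complex.exp w)‖ := by
  set η := -Complex.I * Complex.exp (Complex.I * (w.im / 2 : ℝ)) with hη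
  have hint := hΨ.integrableOn_div_sub_exp BoundedC1.one h0 h1
  have h2 : (η * resolventIntegral Ψ (fun _ => 1) (Complex.exp w)).re =
      Real.sin (w.im / 2) * ∫ ζ in Ioi (0:ℝ),
        (Ψ ζ + Real.exp w.re) / ‖(Ψ ζ : ℂ) - Complex.exp w‖ ^ 2 := by
    rw [resolventIntegral, ← integral_const_mul, ← integral_const_mul]
    have := integral_re (𝕜 := ℂ) (hint.const_mul η)
    simp only [RCLike.re_to_complex] at this
    rw [← this]
    refine setIntegral_congr_fun measurableSet_Ioi fun ζ _ => ?_
    simp only [Complex.ofReal_one]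
    rw [one_div, Complex.inv_def, ← mul_assoc, Complex.re_mul_ofReal, Complex.normSq_eq_norm_sq,
      map_sub, Complex.conj_ofReal, hη, re_rotated_sub_conj_exp]
    ring
  rw [← h2]
  refine (Complex.re_le_norm _).trans ?_
  rw [norm_mul, hη, norm_rotation, one_mul]

lemma integrableOn_add_div_norm_sq (hΨ : RegularSymbol Ψ Ψ' Ψ'') {w : ℂ}
    (h0 : 0 < w.im) (h1 : w.im < 2 * Real.pi) :
    IntegrableOn (fun ζ => (Ψ ζ + Real.exp w.re) / ‖(Ψ ζ : ℂ) - Complex.exp w‖ ^ 2)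
      (Ioi 0) := by
  have hs := sin_half_pos h0 h1
  have hint := ((hΨ.integrableOn_div_sub_exp BoundedC1.one h0 h1).const_mul
    (-Complex.I * Complex.exp (Complex.I * (w.im / 2 : ℝ)))).re.const_mul
      (Real.sin (w.im / 2))⁻¹
  refine IntegrableOn.congr_fun hint (fun ζ _ => ?_) measurableSet_Ioi
  simp only [Complex.ofReal_one, RCLike.re_to_complex]
  rw [one_div, Complex.inv_def, ← mul_assoc, Complex.re_mul_ofReal, Complex.normSq_eq_norm_sq,
    map_sub, Complex.conj_ofReal, re_rotated_sub_conj_exp]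
  field_simp

lemma add_exp_pos (hΨ : RegularSymbol Ψ Ψ' Ψ'') {ζ : ℝ} (hζ : ζ ∈ Ioi (0:ℝ)) (x : ℝ) :
    0 < Ψ ζ + Real.exp x := add_pos (hΨ.pos ζ hζ) (Real.exp_pos x)

lemma sub_exp_ne_zero (hΨ : RegularSymbol Ψ Ψ' Ψ'') {ζ : ℝ} (hζ : ζ ∈ Ioi (0:ℝ)) {w : ℂ}
    (h0 : 0 < w.im) (h1 : w.im < 2 * Real.pi) : (Ψ ζ : ℂ) - Complex.exp w ≠ 0 := by
  rw [← norm_pos_iff]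
  exact lt_of_lt_of_le (mul_pos (hΨ.add_exp_pos hζ _) (sin_half_pos h0 h1))
    (mul_sin_half_le_norm_sub_exp _ w)

lemma inv_add_exp_le (hΨ : RegularSymbol Ψ Ψ' Ψ'') {ζ : ℝ} (hζ : ζ ∈ Ioi (0:ℝ)) {w : ℂ}
    (h0 : 0 < w.im) (h1 : w.im < 2 * Real.pi) :
    1 / (Ψ ζ + Real.exp w.re) ≤
      (Ψ ζ + Real.exp w.re) / ‖(Ψ ζ : ℂ) - Complex.exp w‖ ^ 2 := by
  have hp := hΨ.add_exp_pos hζ w.re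
  have hn := norm_pos_iff.2 (hΨ.sub_exp_ne_zero hζ h0 h1)
  have hle : ‖(Ψ ζ : ℂ) - Complex.exp w‖ ≤ Ψ ζ + Real.exp w.re := by
    have := norm_sub_le (Ψ ζ : ℂ) (Complex.exp w)
    rwa [Complex.norm_exp, Complex.norm_real, Real.norm_of_nonneg (hΨ.pos ζ hζ).le] at this
  rw [div_le_div_iff₀ hp (by positivity), one_mul, ← sq]
  gcongr

lemma sin_half_mul_integral_inv_le (hΨ : RegularSymbol Ψ Ψ' Ψ'') {w : ℂ}
    (h0 : 0 < w.im) (h1 : w.im < 2 * Real.pi) :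
    Real.sin (w.im / 2) * ∫ ζ in Ioi (0:ℝ), 1 / (Ψ ζ + Real.exp w.re) ≤
      ‖resolventIntegral Ψ (fun _ => 1) (Complex.exp w)‖ := by
  refine le_trans ?_ (hΨ.sin_half_mul_le_norm_resolventIntegral_one h0 h1)
  refine mul_le_mul_of_nonneg_left ?_ (sin_half_pos h0 h1).le
  exact setIntegral_mono_on (hΨ.integrableOn_div_add_exp BoundedC1.one _)
    (hΨ.integrableOn_add_div_norm_sq h0 h1) measurableSet_Ioi
    fun ζ hζ => hΨ.inv_add_exp_le hζ h0 h1

lemma resolventIntegral_one_ne_zero (hΨ : RegularSymbol Ψ Ψ' Ψ'') {w : ℂ}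
    (h0 : 0 < w.im) (h1 : w.im < 2 * Real.pi) :
    resolventIntegral Ψ (fun _ => 1) (Complex.exp w) ≠ 0 := by
  rw [← norm_pos_iff]
  refine lt_of_lt_of_le (mul_pos (sin_half_pos h0 h1) ?_)
    (hΨ.sin_half_mul_integral_inv_le h0 h1)
  rw [setIntegral_pos_iff_support_of_nonneg_ae]
  · have : Function.support (fun ζ => 1 / (Ψ ζ + Real.exp w.re)) ∩ Ioi 0 = Ioi 0 := by
      refine inter_eq_right.2 fun ζ hζ => ?_
      exact (one_div_pos.2 (hΨ.add_exp_pos hζ _)).ne'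
    rw [this]; simp
  · refine (ae_restrict_iff' measurableSet_Ioi).2 (.of_forall fun ζ hζ => ?_)
    exact (one_div_pos.2 (hΨ.add_exp_pos hζ _)).le
  · exact hΨ.integrableOn_div_add_exp BoundedC1.one _

/-- The basic estimate on the Schur complement away from the positive half-line. -/
lemma norm_schurComplement_mul_le (hΨ : RegularSymbol Ψ Ψ' Ψ'') (hf : BoundedC1 f f' B) {w : ℂ}
    (h0 : 0 < w.im) (h1 : w.im < 2 * Real.pi) :
    ‖schurComplement Ψ f (Complex.exp w)‖ * Real.sin (w.im / 2) ≤
      ∫ ζ in Ioi (0:ℝ), f ζ ^ 2 / (Ψ ζ + Real.exp w.re) := by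
  have hs := sin_half_pos h0 h1
  set s := Real.sin (w.im / 2) with hsdef
  set η := -Complex.I * Complex.exp (Complex.I * (w.im / 2 : ℝ)) with hη
  set z := Complex.exp w with hz
  set M := schurComplement Ψ f z with hM
  set G := resolventIntegral Ψ f z / resolventIntegral Ψ (fun _ => 1) z with hG
  have hF := hΨ.resolventIntegral_one_ne_zero h0 h1
  have i2 := hΨ.integrableOn_div_sub_exp hf.sq h0 h1
  have i1 := hΨ.integrableOn_div_sub_exp hf h0 h1
  have i0 := hΨ.integrableOn_div_sub_exp BoundedC1.one h0 h1
  have j1 : IntegrableOn (fun ζ => (f ζ : ℂ) * (f ζ - G) / ((Ψ ζ : ℂ) - z)) (Ioi 0) := by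
    refine (i2.sub (i1.const_mul G)).congr_fun (fun ζ _ => ?_) measurableSet_Ioi
    simp; ring
  have e1 : M = ∫ ζ in Ioi (0:ℝ), (f ζ : ℂ) * (f ζ - G) / ((Ψ ζ : ℂ) - z) := by
    have : ∫ ζ in Ioi (0:ℝ), (f ζ : ℂ) * (f ζ - G) / ((Ψ ζ : ℂ) - z) =
        ∫ ζ in Ioi (0:ℝ), (((f ζ ^ 2 : ℝ) : ℂ) / ((Ψ ζ : ℂ) - z) -
          G * ((f ζ : ℂ) / ((Ψ ζ : ℂ) - z))) := by
      congr 1; ext ζ; push_cast; ring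
    rw [this, integral_sub i2 (i1.const_mul G), integral_const_mul, hM, schurComplement, hG]
    simp only [resolventIntegral]
    ring
  have e2aux : ∀ ζ, ((‖(f ζ : ℂ) - G‖ ^ 2 : ℝ) : ℂ) / ((Ψ ζ : ℂ) - z) =
      (f ζ : ℂ) * (f ζ - G) / ((Ψ ζ : ℂ) - z) - (starRingEnd ℂ) G *
        ((f ζ : ℂ) / ((Ψ ζ : ℂ) - z) - G * (((1 : ℝ) : ℂ) / ((Ψ ζ : ℂ) - z))) := by
    intro ζ
    push_cast
    rw [← Complex.mul_conj', map_sub, Complex.conj_ofReal]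
    ring
  have j2 : IntegrableOn (fun ζ => ((‖(f ζ : ℂ) - G‖ ^ 2 : ℝ) : ℂ) / ((Ψ ζ : ℂ) - z))
      (Ioi 0) := by
    simp only [e2aux]
    exact j1.sub ((i1.sub (i0.const_mul G)).const_mul _)
  have e2 : M = ∫ ζ in Ioi (0:ℝ), ((‖(f ζ : ℂ) - G‖ ^ 2 : ℝ) : ℂ) / ((Ψ ζ : ℂ) - z) := by
    simp only [e2aux]
    have i01 : IntegrableOn (fun ζ => (f ζ : ℂ) / ((Ψ ζ : ℂ) - z) -
        G * (((1 : ℝ) : ℂ) / ((Ψ ζ : ℂ) - z))) (Ioi 0) := i1.sub (i0.const_mul G)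
    rw [integral_sub j1 (i01.const_mul _), integral_const_mul,
      integral_sub i1 (i0.const_mul G), integral_const_mul, ← e1]
    have : (∫ ζ in Ioi (0:ℝ), (f ζ : ℂ) / ((Ψ ζ : ℂ) - z)) -
        G * ∫ ζ in Ioi (0:ℝ), ((1 : ℝ) : ℂ) / ((Ψ ζ : ℂ) - z) = 0 := by
      have := div_mul_cancel₀ (resolventIntegral Ψ f z) hF
      rw [← hz, ← hG] at this
      simp only [resolventIntegral] at this
      rw [this, sub_self]
    rw [this]; ring
  have e3aux : ∀ ζ, (η * (((‖(f ζ : ℂ) - G‖ ^ 2 : ℝ) : ℂ) / ((Ψ ζ : ℂ) - z))).re =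
      ‖(f ζ : ℂ) - G‖ ^ 2 * ((Ψ ζ + Real.exp w.re) * s) / ‖(Ψ ζ : ℂ) - z‖ ^ 2 := by
    intro ζ
    rw [div_eq_mul_inv _ ((Ψ ζ : ℂ) - z), Complex.inv_def, mul_left_comm, ← mul_assoc η,
      Complex.re_ofReal_mul, Complex.re_mul_ofReal, Complex.normSq_eq_norm_sq,
      map_sub, Complex.conj_ofReal, hη, hz, re_rotated_sub_conj_exp]
    ring
  have j3 : IntegrableOn (fun ζ => ‖(f ζ : ℂ) - G‖ ^ 2 * ((Ψ ζ + Real.exp w.re) * s) /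
      ‖(Ψ ζ : ℂ) - z‖ ^ 2) (Ioi 0) := by
    simp only [← e3aux]; exact (j2.const_mul η).re
  have e3 : ∫ ζ in Ioi (0:ℝ), ‖(f ζ : ℂ) - G‖ ^ 2 * ((Ψ ζ + Real.exp w.re) * s) /
      ‖(Ψ ζ : ℂ) - z‖ ^ 2 ≤ ‖M‖ := by
    have h2 := integral_re (𝕜 := ℂ) (j2.const_mul η)
    simp only [RCLike.re_to_complex, e3aux] at h2
    rw [h2, integral_const_mul, ← e2]
    refine (Complex.re_le_norm _).trans ?_
    rw [norm_mul, hη, norm_rotation, one_mul]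
  have j4 := (hΨ.integrableOn_div_add_exp hf.sq w.re).const_mul s⁻¹
  have e4 : ‖M‖ ≤ ∫ ζ in Ioi (0:ℝ), (1 / 2 * (s⁻¹ * (f ζ ^ 2 / (Ψ ζ + Real.exp w.re))) +
      1 / 2 * (‖(f ζ : ℂ) - G‖ ^ 2 * ((Ψ ζ + Real.exp w.re) * s) / ‖(Ψ ζ : ℂ) - z‖ ^ 2)) := by
    rw [e1]
    refine norm_integral_le_of_norm_le ((j4.const_mul (1 / 2)).add (j3.const_mul (1 / 2))) ?_
    refine (ae_restrict_iff' measurableSet_Ioi).2 (.of_forall fun ζ hζ => ?_)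
    have hp := hΨ.add_exp_pos hζ w.re
    have hn := norm_pos_iff.2 (hΨ.sub_exp_ne_zero hζ h0 h1)
    rw [norm_div, norm_mul, Complex.norm_real, Real.norm_eq_abs, ← sq_abs (f ζ)]
    rw [← hz] at hn
    generalize ‖(Ψ ζ : ℂ) - z‖ = n at *
    generalize ‖(f ζ : ℂ) - G‖ = g at *
    generalize |f ζ| = a at *
    generalize Ψ ζ + Real.exp w.re = p at *
    have : 1 / 2 * (s⁻¹ * (a ^ 2 / p)) + 1 / 2 * (g ^ 2 * (p * s) / n ^ 2) - a * g / n =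
        1 / 2 * (a - g * (p * s) / n) ^ 2 / (p * s) := by
      field_simp; ring
    have : 0 ≤ 1 / 2 * (a - g * (p * s) / n) ^ 2 / (p * s) := by positivity
    linarith
  rw [integral_add (j4.const_mul (1 / 2)) (j3.const_mul (1 / 2)), integral_const_mul,
    integral_const_mul, integral_const_mul] at e4
  have e5 : ‖M‖ ≤ s⁻¹ * ∫ ζ in Ioi (0:ℝ), f ζ ^ 2 / (Ψ ζ + Real.exp w.re) := by linarith
  calc ‖M‖ * s ≤ (s⁻¹ * ∫ ζ in Ioi (0:ℝ), f ζ ^ 2 / (Ψ ζ + Real.exp w.re)) * s := by gcongr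
    _ = _ := by field_simp

lemma differentiableAt_schurComplement (hΨ : RegularSymbol Ψ Ψ' Ψ'') (hf : BoundedC1 f f' B)
    {w : ℂ} (h0 : 0 < w.im) (h1 : w.im < 2 * Real.pi) :
    DifferentiableAt ℂ (schurComplement Ψ f) (Complex.exp w) := by
  obtain ⟨δ, hδ, h⟩ := exists_mul_one_add_le_norm_sub_exp h0 h1
  exact (hΨ.differentiableAt_resolventIntegral hf.sq hδ h).sub
    (((hΨ.differentiableAt_resolventIntegral hf hδ h).pow 2).div
      (hΨ.differentiableAt_resolventIntegral BoundedC1.one hδ h)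
      (hΨ.resolventIntegral_one_ne_zero h0 h1))

/-- Uniform bound for square-integrable `f`. -/
lemma norm_exp_mul_schurComplement_mul_le (hΨ : RegularSymbol Ψ Ψ' Ψ'') (hf : BoundedC1 f f' B)
    (hf2 : IntegrableOn (fun ζ => f ζ ^ 2) (Ioi 0)) {w : ℂ}
    (h0 : 0 < w.im) (h1 : w.im < 2 * Real.pi) :
    ‖Complex.exp w * schurComplement Ψ f (Complex.exp w)‖ * Real.sin (w.im / 2) ≤
      ∫ ζ in Ioi (0:ℝ), f ζ ^ 2 := by
  rw [norm_mul, mul_assoc, Complex.norm_exp]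
  refine (mul_le_mul_of_nonneg_left (hΨ.norm_schurComplement_mul_le hf h0 h1)
    (Real.exp_pos _).le).trans ?_
  rw [← integral_const_mul]
  refine setIntegral_mono_on ((hΨ.integrableOn_div_add_exp hf.sq w.re).const_mul _) hf2
    measurableSet_Ioi fun ζ hζ => ?_
  have hp := hΨ.add_exp_pos hζ w.re
  have := hΨ.pos ζ hζ
  rw [mul_div_left_comm]
  refine mul_le_of_le_one_right (sq_nonneg _) ?_
  rw [div_le_one hp]; linarith

lemma tendsto_exp_mul_schurComplement_atBot (hΨ : RegularSymbol Ψ Ψ' Ψ'')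
    (hf : BoundedC1 f f' B) (hf2 : IntegrableOn (fun ζ => f ζ ^ 2) (Ioi 0)) {θ : ℝ}
    (h0 : 0 < θ) (h1 : θ < 2 * Real.pi) :
    Tendsto (fun x : ℝ => Complex.exp (x + θ * Complex.I) *
      schurComplement Ψ f (Complex.exp (x + θ * Complex.I))) atBot (𝓝 0) := by
  have hs : 0 < Real.sin (θ / 2) :=
    Real.sin_pos_of_pos_of_lt_pi (by linarith) (by linarith)
  have hlim : Tendsto (fun x : ℝ => ∫ ζ in Ioi (0:ℝ),
      Real.exp x * (f ζ ^ 2 / (Ψ ζ + Real.exp x))) atBot (𝓝 0) := by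
    suffices h : Tendsto (fun x : ℝ => ∫ ζ in Ioi (0:ℝ),
        Real.exp x * (f ζ ^ 2 / (Ψ ζ + Real.exp x))) atBot (𝓝 (∫ ζ in Ioi (0:ℝ), (0:ℝ))) by
      simpa only [integral_zero] using h
    refine tendsto_integral_filter_of_dominated_convergence (fun ζ => f ζ ^ 2) ?_ ?_ hf2 ?_
    · exact .of_forall fun x =>
        ((hΨ.integrableOn_div_add_exp hf.sq x).const_mul _).aestronglyMeasurable
    · refine .of_forall fun x => (ae_restrict_iff' measurableSet_Ioi).2 (.of_forall fun ζ hζ => ?_)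
      have hp := hΨ.add_exp_pos hζ x
      have hq := hΨ.pos ζ hζ
      rw [Real.norm_of_nonneg (by positivity), mul_div_left_comm]
      refine mul_le_of_le_one_right (sq_nonneg _) ?_
      rw [div_le_one hp]; linarith
    · refine (ae_restrict_iff' measurableSet_Ioi).2 (.of_forall fun ζ hζ => ?_)
      have hq := hΨ.pos ζ hζ
      have h := Real.tendsto_exp_atBot.mul
        ((tendsto_const_nhds (x := f ζ ^ 2)).div (Real.tendsto_exp_atBot.const_add (Ψ ζ))
          (by simpa using hq.ne'))
      simpa using h
  rw [tendsto_zero_iff_norm_tendsto_zero]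
  have hlim2 := hlim.const_mul (Real.sin (θ / 2))⁻¹
  rw [mul_zero] at hlim2
  refine squeeze_zero (fun _ => norm_nonneg _) (fun x => ?_) hlim2
  have h := hΨ.norm_schurComplement_mul_le hf (w := x + θ * Complex.I)
    (by simpa using h0) (by simpa using h1)
  have e1 : ((x:ℂ) + θ * Complex.I).im = θ := by simp
  have e2 : ((x:ℂ) + θ * Complex.I).re = x := by simp
  rw [e1, e2] at h
  rw [norm_mul, Complex.norm_exp, e2, integral_const_mul, le_inv_mul_iff₀ hs]
  nlinarith [Real.exp_pos x]

lemma tendsto_exp_mul_resolventIntegral_atTop (hΨ : RegularSymbol Ψ Ψ' Ψ'')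
    (hf : BoundedC1 f f' B) (hfi : IntegrableOn f (Ioi 0)) {θ : ℝ}
    (h0 : 0 < θ) (h1 : θ < 2 * Real.pi) :
    Tendsto (fun x : ℝ => Complex.exp (x + θ * Complex.I) *
      resolventIntegral Ψ f (Complex.exp (x + θ * Complex.I))) atTop
      (𝓝 (-((∫ ζ in Ioi (0:ℝ), f ζ : ℝ) : ℂ))) := by
  have hs : 0 < Real.sin (θ / 2) :=
    Real.sin_pos_of_pos_of_lt_pi (by linarith) (by linarith)
  have e1 : ∀ x : ℝ, ((x:ℂ) + θ * Complex.I).im = θ := by simp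
  have e2 : ∀ x : ℝ, ((x:ℂ) + θ * Complex.I).re = x := by simp
  have : (-((∫ ζ in Ioi (0:ℝ), f ζ : ℝ) : ℂ)) = ∫ ζ in Ioi (0:ℝ), (-(f ζ) : ℂ) := by
    rw [integral_neg, integral_complex_ofReal]
  rw [this]
  simp only [resolventIntegral, ← integral_const_mul]
  refine tendsto_integral_filter_of_dominated_convergence
    (fun ζ => (Real.sin (θ / 2))⁻¹ * |f ζ|) ?_ ?_ (hfi.abs.const_mul _) ?_
  · exact .of_forall fun x => ((hΨ.integrableOn_div_sub_exp hf (by rwa [e1])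
      (by rwa [e1])).const_mul _).aestronglyMeasurable
  · refine .of_forall fun x => (ae_restrict_iff' measurableSet_Ioi).2 (.of_forall fun ζ hζ => ?_)
    have hq := hΨ.pos ζ hζ
    have hb := mul_sin_half_le_norm_sub_exp (Ψ ζ) (x + θ * Complex.I)
    have hn := norm_pos_iff.2 (hΨ.sub_exp_ne_zero hζ (w := x + θ * Complex.I)
      (by rwa [e1]) (by rwa [e1]))
    rw [e1, e2] at hb
    rw [norm_mul, norm_div, Complex.norm_exp, e2, Complex.norm_real, Real.norm_eq_abs,
      inv_mul_eq_div, ← mul_div_assoc, div_le_div_iff₀ hn hs]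
    have h3 : Real.exp x * Real.sin (θ / 2) ≤ ‖(Ψ ζ : ℂ) - Complex.exp (x + θ * Complex.I)‖ := by
      nlinarith
    nlinarith [abs_nonneg (f ζ)]
  · refine (ae_restrict_iff' measurableSet_Ioi).2 (.of_forall fun ζ hζ => ?_)
    have h3 : Tendsto (fun x : ℝ => (f ζ : ℂ) /
        ((Ψ ζ : ℂ) * Complex.exp (-(x + θ * Complex.I)) - 1)) atTop (𝓝 ((f ζ : ℂ) / ((Ψ ζ : ℂ) * 0 - 1))) := by
      refine tendsto_const_nhds.div ((Tendsto.const_mul _ ?_).sub_const 1) (by simp)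
      rw [tendsto_zero_iff_norm_tendsto_zero]
      simp only [Complex.norm_exp, Complex.neg_re, e2]
      exact Real.tendsto_exp_neg_atTop_nhds_zero
    have h4 : ((f ζ : ℂ) / ((Ψ ζ : ℂ) * 0 - 1)) = -(f ζ) := by simp [div_neg]
    rw [h4] at h3
    refine h3.congr fun x => ?_
    rw [Complex.exp_neg]
    have h5 := Complex.exp_ne_zero (x + θ * Complex.I)
    have h6 := hΨ.sub_exp_ne_zero hζ (w := x + θ * Complex.I) (by rwa [e1]) (by rwa [e1])
    generalize Complex.exp (x + θ * Complex.I) = z at *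
    have h7 : (Ψ ζ : ℂ) * z⁻¹ - 1 = (Ψ ζ - z) / z := by field_simp
    rw [h7, div_div_eq_mul_div]
    ring

lemma tendsto_norm_exp_mul_resolventIntegral_one (hΨ : RegularSymbol Ψ Ψ' Ψ'') {θ : ℝ}
    (h0 : 0 < θ) (h1 : θ < 2 * Real.pi) :
    Tendsto (fun x : ℝ => ‖Complex.exp (x + θ * Complex.I) *
      resolventIntegral Ψ (fun _ => 1) (Complex.exp (x + θ * Complex.I))‖) atTop atTop := by
  have hs : 0 < Real.sin (θ / 2) :=
    Real.sin_pos_of_pos_of_lt_pi (by linarith) (by linarith)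
  have e1 : ∀ x : ℝ, ((x:ℂ) + θ * Complex.I).im = θ := by simp
  have e2 : ∀ x : ℝ, ((x:ℂ) + θ * Complex.I).re = x := by simp
  have key : ∀ b : ℝ, 0 < b → ∀ᶠ x : ℝ in atTop, Real.sin (θ / 2) * (b / 2) ≤
      ‖Complex.exp (x + θ * Complex.I) *
        resolventIntegral Ψ (fun _ => 1) (Complex.exp (x + θ * Complex.I))‖ := by
    intro b hb
    filter_upwards [Real.tendsto_exp_atTop.eventually (eventually_ge_atTop (Ψ b))] with x hx
    have h := hΨ.sin_half_mul_integral_inv_le (w := x + θ * Complex.I) (by rwa [e1]) (by rwa [e1])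
    rw [e1, e2] at h
    rw [norm_mul, Complex.norm_exp, e2]
    have hex := Real.exp_pos x
    have h2 : b / (2 * Real.exp x) ≤ ∫ ζ in Ioi (0:ℝ), 1 / (Ψ ζ + Real.exp x) := by
      calc b / (2 * Real.exp x) = ∫ ζ in Ioc (0:ℝ) b, 1 / (2 * Real.exp x) := by
            simp [hb.le]; ring
        _ ≤ ∫ ζ in Ioc (0:ℝ) b, 1 / (Ψ ζ + Real.exp x) := by
            refine setIntegral_mono_on (integrableOn_const (by simp))
              ((hΨ.integrableOn_div_add_exp BoundedC1.one x).mono_set Ioc_subset_Ioi_self)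
              measurableSet_Ioc fun ζ hζ => ?_
            have h3 := hΨ.mono.monotoneOn (mem_Ioi.2 hζ.1) (mem_Ioi.2 hb) hζ.2
            exact one_div_le_one_div_of_le (hΨ.add_exp_pos hζ.1 x) (by linarith)
        _ ≤ _ := by
            refine setIntegral_mono_set (hΨ.integrableOn_div_add_exp BoundedC1.one x) ?_
              Ioc_subset_Ioi_self.eventuallyLE
            refine (ae_restrict_iff' measurableSet_Ioi).2 (.of_forall fun ζ hζ => ?_)
            exact (one_div_pos.2 (hΨ.add_exp_pos hζ _)).le
    have h3 : Real.sin (θ / 2) * (b / (2 * Real.exp x)) ≤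
        ‖resolventIntegral Ψ (fun _ => 1) (Complex.exp (x + θ * Complex.I))‖ :=
      (mul_le_mul_of_nonneg_left h2 hs.le).trans h
    calc Real.sin (θ / 2) * (b / 2) =
          Real.exp x * (Real.sin (θ / 2) * (b / (2 * Real.exp x))) := by field_simp
      _ ≤ _ := mul_le_mul_of_nonneg_left h3 hex.le
  refine Filter.tendsto_atTop.2 fun C => ?_
  filter_upwards [key (2 * (|C| + 1) / Real.sin (θ / 2)) (by positivity)] with x hx
  have : Real.sin (θ / 2) * (2 * (|C| + 1) / Real.sin (θ / 2) / 2) = |C| + 1 := by field_simp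
  linarith [le_abs_self C]

lemma tendsto_exp_mul_schurComplement_atTop (hΨ : RegularSymbol Ψ Ψ' Ψ'')
    (hf : BoundedC1 f f' B) (hfi : IntegrableOn f (Ioi 0))
    (hf2 : IntegrableOn (fun ζ => f ζ ^ 2) (Ioi 0)) {θ : ℝ}
    (h0 : 0 < θ) (h1 : θ < 2 * Real.pi) :
    Tendsto (fun x : ℝ => Complex.exp (x + θ * Complex.I) *
      schurComplement Ψ f (Complex.exp (x + θ * Complex.I))) atTop
      (𝓝 (-((∫ ζ in Ioi (0:ℝ), f ζ ^ 2 : ℝ) : ℂ))) := by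
  have t2 := hΨ.tendsto_exp_mul_resolventIntegral_atTop hf.sq hf2 h0 h1
  have t1 := hΨ.tendsto_exp_mul_resolventIntegral_atTop hf hfi h0 h1
  have t0 := hΨ.tendsto_norm_exp_mul_resolventIntegral_one h0 h1
  have t0' := tendsto_inv₀_cobounded.comp (tendsto_norm_atTop_iff_cobounded.1 t0)
  have t := t2.sub ((t1.pow 2).mul t0')
  rw [mul_zero, sub_zero] at t
  refine t.congr fun x => ?_
  have h5 := Complex.exp_ne_zero (x + θ * Complex.I)
  have h6 := hΨ.resolventIntegral_one_ne_zero (w := x + θ * Complex.I)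
    (by simpa using h0) (by simpa using h1)
  simp only [schurComplement, Function.comp_apply]
  field_simp

end RegularSymbol

/-- The function `f` with the multiple of `Ψ'` on `[α, β]` removed that agrees with `f`
at `lam`. -/
noncomputable def singularRemainder (Ψ' f : ℝ → ℝ) (α β lam ζ : ℝ) : ℝ :=
  f ζ - (Icc α β).indicator (fun ζ => f lam / Ψ' lam * Ψ' ζ) ζ

namespace RegularSymbol

variable {Ψ Ψ' Ψ'' f f' : ℝ → ℝ} {B : ℝ}

lemma continuousOn_deriv (hΨ : RegularSymbol Ψ Ψ' Ψ'') : ContinuousOn Ψ' (Ioi 0) :=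
  fun ζ hζ => (hΨ.hasDerivAt_deriv ζ hζ).continuousAt.continuousWithinAt

lemma exists_abs_div_deriv_sub_le (hΨ : RegularSymbol Ψ Ψ' Ψ'') (hf : BoundedC1 f f' B)
    {α β : ℝ} (hα : 0 < α) :
    ∃ C, 0 ≤ C ∧ ∀ x ∈ Icc α β, ∀ y ∈ Icc α β,
      |f x / Ψ' x - f y / Ψ' y| ≤ C * |Ψ x - Ψ y| := by
  have hsub : Icc α β ⊆ Ioi 0 := fun x hx => lt_of_lt_of_le hα hx.1
  have hne : ∀ x ∈ Ioi (0:ℝ), Ψ' x ≠ 0 := fun x hx => (hΨ.deriv_pos x hx).ne'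
  have hder : ∀ x ∈ Ioi (0:ℝ), HasDerivAt (fun x => f x / Ψ' x)
      ((f' x * Ψ' x - f x * Ψ'' x) / Ψ' x ^ 2) x := fun x hx =>
    (hf.hasDerivAt x hx).fun_div (hΨ.hasDerivAt_deriv x hx) (hne x hx)
  have hcont : ContinuousOn (fun x => (f' x * Ψ' x - f x * Ψ'' x) / Ψ' x ^ 2 / Ψ' x) (Ioi 0) :=
    (((hf.continuousOn_deriv.mul hΨ.continuousOn_deriv).sub
      (hf.continuousOn.mul hΨ.continuousOn_deriv2)).div (hΨ.continuousOn_deriv.pow 2)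
      (fun x hx => pow_ne_zero 2 (hne x hx))).div hΨ.continuousOn_deriv hne
  obtain ⟨C, hC⟩ := isCompact_Icc.exists_bound_of_continuousOn (hcont.mono hsub)
  have main : ∀ x ∈ Icc α β, ∀ y ∈ Icc α β, x < y →
      |f x / Ψ' x - f y / Ψ' y| ≤ |C| * |Ψ x - Ψ y| := by
    intro x hx y hy hxy
    have hxy' : Icc x y ⊆ Icc α β := Icc_subset_Icc hx.1 hy.2
    obtain ⟨c, hc, hc'⟩ := exists_ratio_hasDerivAt_eq_ratio_slope (fun x => f x / Ψ' x)
      (fun x => (f' x * Ψ' x - f x * Ψ'' x) / Ψ' x ^ 2) hxy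
      (fun u hu => (hder u (hsub (hxy' hu))).continuousAt.continuousWithinAt)
      (fun u hu => hder u (hsub (hxy' (Ioo_subset_Icc_self hu)))) Ψ Ψ'
      (hΨ.continuousOn.mono (hxy'.trans hsub))
      (fun u hu => hΨ.hasDerivAt u (hsub (hxy' (Ioo_subset_Icc_self hu))))
    have hcJ := hxy' (Ioo_subset_Icc_self hc)
    have hcp := hne c (hsub hcJ)
    have h1 := hC c hcJ
    have h2 : f x / Ψ' x - f y / Ψ' y =
        (f' c * Ψ' c - f c * Ψ'' c) / Ψ' c ^ 2 / Ψ' c * (Ψ x - Ψ y) := by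
      rw [eq_comm, div_mul_eq_mul_div, div_eq_iff hcp]
      linear_combination -hc'
    rw [h2, abs_mul]
    exact mul_le_mul_of_nonneg_right (h1.trans (le_abs_self C)) (abs_nonneg _)
  refine ⟨|C|, abs_nonneg C, fun x hx y hy => ?_⟩
  rcases lt_trichotomy x y with h | h | h
  · exact main x hx y hy h
  · subst h; simp
  · rw [abs_sub_comm, abs_sub_comm (Ψ x)]; exact main y hy x hx h

lemma exists_abs_singularRemainder_le (hΨ : RegularSymbol Ψ Ψ' Ψ'') (hf : BoundedC1 f f' B)
    {α a b β : ℝ} (hα : 0 < α) (ha : α < a) (hab : a ≤ b) (hb : b < β) :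
    ∃ C, 0 ≤ C ∧ ∀ lam ∈ Icc a b, ∀ ζ ∈ Ioi (0:ℝ),
      |singularRemainder Ψ' f α β lam ζ| ≤ C * (1 / (1 + Ψ ζ)) * |Ψ ζ - Ψ lam| := by
  have hsub : Icc α β ⊆ Ioi 0 := fun x hx => lt_of_lt_of_le hα hx.1
  obtain ⟨C₁, hC₁, h1⟩ := hΨ.exists_abs_div_deriv_sub_le hf (β := β) hα
  obtain ⟨C₂, h2⟩ := isCompact_Icc.exists_bound_of_continuousOn
    (hΨ.continuousOn_deriv.mono hsub)
  have hC₂ : 0 ≤ C₂ := (norm_nonneg _).trans (h2 α ⟨le_rfl, by linarith⟩)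
  have hα0 : α ∈ Ioi (0:ℝ) := hα
  have ha0 : a ∈ Ioi (0:ℝ) := hα.trans ha
  have hb0 : b ∈ Ioi (0:ℝ) := (hα.trans ha).trans_le hab
  have hβ0 : β ∈ Ioi (0:ℝ) := lt_trans hb0 hb
  have d1 := hΨ.mono hα0 ha0 ha
  have d2 := hΨ.mono hb0 hβ0 hb
  have pα := hΨ.pos α hα0
  have pb := hΨ.pos b hb0
  have pβ := hΨ.pos β hβ0
  have hB := hf.bound_nonneg
  have q1 : 0 ≤ C₁ * C₂ * (1 + Ψ β) := by positivity
  have q2 : 0 ≤ B * (1 + Ψ α) / (Ψ a - Ψ α) := div_nonneg (by positivity) (by linarith)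
  have q3 : 0 ≤ B * (1 + Ψ β) / (Ψ β - Ψ b) := div_nonneg (by positivity) (by linarith)
  refine ⟨C₁ * C₂ * (1 + Ψ β) + B * (1 + Ψ α) / (Ψ a - Ψ α) + B * (1 + Ψ β) / (Ψ β - Ψ b),
    by positivity, fun lam hlam ζ hζ => ?_⟩
  have pζ := hΨ.pos ζ hζ
  have hlam0 : lam ∈ Ioi (0:ℝ) := lt_of_lt_of_le ha0 hlam.1
  have m1 := hΨ.mono.monotoneOn ha0 hlam0 hlam.1
  have m2 := hΨ.mono.monotoneOn hlam0 hb0 hlam.2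
  have pos1 : 0 < 1 / (1 + Ψ ζ) := by positivity
  have step : ∀ D, D ≤ C₁ * C₂ * (1 + Ψ β) + B * (1 + Ψ α) / (Ψ a - Ψ α) +
      B * (1 + Ψ β) / (Ψ β - Ψ b) →
      |singularRemainder Ψ' f α β lam ζ| ≤ D * (1 / (1 + Ψ ζ)) * |Ψ ζ - Ψ lam| →
      |singularRemainder Ψ' f α β lam ζ| ≤ (C₁ * C₂ * (1 + Ψ β) +
        B * (1 + Ψ α) / (Ψ a - Ψ α) + B * (1 + Ψ β) / (Ψ β - Ψ b)) *
        (1 / (1 + Ψ ζ)) * |Ψ ζ - Ψ lam| := fun D hD h => h.trans (by gcongr)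
  by_cases hJ : ζ ∈ Icc α β
  · refine step _ (le_add_of_le_of_nonneg (le_add_of_nonneg_right q2) q3) ?_
    have hl : lam ∈ Icc α β := ⟨by linarith [hlam.1], by linarith [hlam.2]⟩
    have hne := (hΨ.deriv_pos ζ hζ).ne'
    have m3 := hΨ.mono.monotoneOn hζ hβ0 hJ.2
    have e : singularRemainder Ψ' f α β lam ζ = (f ζ / Ψ' ζ - f lam / Ψ' lam) * Ψ' ζ := by
      rw [singularRemainder, indicator_of_mem hJ]; field_simp
    rw [e, abs_mul]
    calc |f ζ / Ψ' ζ - f lam / Ψ' lam| * |Ψ' ζ| ≤ C₁ * |Ψ ζ - Ψ lam| * C₂ :=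
          mul_le_mul (h1 ζ hJ lam hl) (h2 ζ hJ) (abs_nonneg _) (by positivity)
      _ = C₁ * C₂ * 1 * |Ψ ζ - Ψ lam| := by ring
      _ ≤ C₁ * C₂ * ((1 + Ψ β) * (1 / (1 + Ψ ζ))) * |Ψ ζ - Ψ lam| := by
          gcongr
          rw [mul_one_div, le_div_iff₀ (by positivity)]; linarith
      _ = _ := by ring
  · have e : singularRemainder Ψ' f α β lam ζ = f ζ := by
      rw [singularRemainder, indicator_of_notMem hJ, sub_zero]
    have hfB := hf.abs_le ζ hζ
    rw [mem_Icc, not_and_or, not_le, not_le] at hJ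
    rcases hJ with hJ | hJ
    · refine step _ ((le_add_of_nonneg_left q1).trans (le_add_of_nonneg_right q3)) ?_
      rw [e]
      have m3 := hΨ.mono hζ hα0 hJ
      refine hfB.trans ?_
      rw [abs_of_neg (by linarith), neg_sub, mul_one_div, div_div, div_mul_eq_mul_div,
        le_div_iff₀ (mul_pos (by linarith) (by linarith)), mul_assoc]
      refine mul_le_mul_of_nonneg_left ?_ hB
      rw [mul_comm]
      exact mul_le_mul (by linarith) (by linarith) (by linarith) (by linarith)
    · refine step _ (le_add_of_nonneg_left (add_nonneg q1 q2)) ?_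
      rw [e]
      have m3 := hΨ.mono hβ0 hζ hJ
      refine hfB.trans ?_
      rw [abs_of_pos (by linarith), mul_one_div, div_div, div_mul_eq_mul_div,
        le_div_iff₀ (mul_pos (by linarith) (by linarith)), mul_assoc]
      refine mul_le_mul_of_nonneg_left ?_ hB
      nlinarith

lemma integrableOn_singularPart (hΨ : RegularSymbol Ψ Ψ' Ψ'') {α β : ℝ} (hα : 0 < α)
    {w : ℂ} (h0 : 0 < w.im) (h1 : w.im < 2 * Real.pi) :
    IntegrableOn (fun ζ => (Ψ' ζ : ℂ) / ((Ψ ζ : ℂ) - Complex.exp w)) (Icc α β) := by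
  have hsub : Icc α β ⊆ Ioi 0 := fun x hx => lt_of_lt_of_le hα hx.1
  refine ContinuousOn.integrableOn_compact isCompact_Icc ?_
  refine ContinuousOn.div (Complex.continuous_ofReal.comp_continuousOn
    (hΨ.continuousOn_deriv.mono hsub)) ((Complex.continuous_ofReal.comp_continuousOn
    (hΨ.continuousOn.mono hsub)).sub continuousOn_const) fun ζ hζ => ?_
  exact hΨ.sub_exp_ne_zero (hsub hζ) h0 h1

lemma im_exp_pos {w : ℂ} (h0 : 0 < w.im) (h1 : w.im < Real.pi) : 0 < (Complex.exp w).im := by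
  rw [Complex.exp_im]
  exact mul_pos (Real.exp_pos _) (Real.sin_pos_of_pos_of_lt_pi h0 h1)

lemma integral_singularPart (hΨ : RegularSymbol Ψ Ψ' Ψ'') {α β : ℝ} (hα : 0 < α) (hαβ : α ≤ β)
    {w : ℂ} (h0 : 0 < w.im) (h1 : w.im < Real.pi) :
    ∫ ζ in Icc α β, (Ψ' ζ : ℂ) / ((Ψ ζ : ℂ) - Complex.exp w) =
      Complex.log (Complex.exp w - Ψ β) - Complex.log (Complex.exp w - Ψ α) := by
  have h1' : w.im < 2 * Real.pi := by linarith [Real.pi_pos]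
  rw [integral_Icc_eq_integral_Ioc, ← intervalIntegral.integral_of_le hαβ]
  refine intervalIntegral.integral_eq_sub_of_hasDerivAt
    (f := fun ζ => Complex.log (Complex.exp w - Ψ ζ)) (fun ζ hζ => ?_) ?_
  · rw [uIcc_of_le hαβ] at hζ
    have hd : HasDerivAt (fun ζ => Complex.exp w - (Ψ ζ : ℂ)) (-(Ψ' ζ : ℂ)) ζ :=
      ((hΨ.hasDerivAt ζ (lt_of_lt_of_le hα hζ.1)).ofReal_comp).const_sub _
    have := hd.clog_real (Or.inr (by simpa using (im_exp_pos h0 h1).ne'))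
    refine this.congr_deriv ?_
    rw [← neg_sub, div_neg, neg_div]; simp
  · rw [intervalIntegrable_iff_integrableOn_Icc_of_le hαβ]
    exact hΨ.integrableOn_singularPart hα h0 h1'

lemma ofReal_singularRemainder (Ψ' f : ℝ → ℝ) (α β lam ζ : ℝ) :
    (singularRemainder Ψ' f α β lam ζ : ℂ) =
      (f ζ : ℂ) - (Icc α β).indicator (fun ζ => ((f lam / Ψ' lam : ℝ) : ℂ) * (Ψ' ζ : ℂ)) ζ := by
  by_cases h : ζ ∈ Icc α β <;> simp [singularRemainder, h]

lemma resolventIntegral_eq (hΨ : RegularSymbol Ψ Ψ' Ψ'') (hf : BoundedC1 f f' B)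
    {α β lam : ℝ} (hα : 0 < α) (hαβ : α ≤ β) {w : ℂ} (h0 : 0 < w.im) (h1 : w.im < Real.pi) :
    IntegrableOn (fun ζ => (singularRemainder Ψ' f α β lam ζ : ℂ) / ((Ψ ζ : ℂ) - Complex.exp w))
      (Ioi 0) ∧
    resolventIntegral Ψ f (Complex.exp w) =
      (∫ ζ in Ioi (0:ℝ), (singularRemainder Ψ' f α β lam ζ : ℂ) / ((Ψ ζ : ℂ) - Complex.exp w)) +
      ((f lam / Ψ' lam : ℝ) : ℂ) *
        (Complex.log (Complex.exp w - Ψ β) - Complex.log (Complex.exp w - Ψ α)) := by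
  have h1' : w.im < 2 * Real.pi := by linarith [Real.pi_pos]
  have hsub : Icc α β ⊆ Ioi 0 := fun x hx => lt_of_lt_of_le hα hx.1
  have i1 := hΨ.integrableOn_div_sub_exp hf h0 h1'
  have i2 : IntegrableOn ((Icc α β).indicator fun ζ => ((f lam / Ψ' lam : ℝ) : ℂ) *
      ((Ψ' ζ : ℂ) / ((Ψ ζ : ℂ) - Complex.exp w))) (Ioi 0) :=
    ((integrable_indicator_iff measurableSet_Icc).2
      ((hΨ.integrableOn_singularPart hα h0 h1').const_mul _)).integrableOn
  have e : ∀ ζ, (singularRemainder Ψ' f α β lam ζ : ℂ) / ((Ψ ζ : ℂ) - Complex.exp w) =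
      (f ζ : ℂ) / ((Ψ ζ : ℂ) - Complex.exp w) - (Icc α β).indicator
        (fun ζ => ((f lam / Ψ' lam : ℝ) : ℂ) * ((Ψ' ζ : ℂ) / ((Ψ ζ : ℂ) - Complex.exp w))) ζ := by
    intro ζ
    rw [ofReal_singularRemainder]
    by_cases h : ζ ∈ Icc α β
    · simp only [indicator_of_mem h]; ring
    · simp only [indicator_of_notMem h]; ring
  simp only [e]
  refine ⟨i1.sub i2, ?_⟩
  rw [integral_sub i1 i2, setIntegral_indicator measurableSet_Icc, inter_eq_right.2 hsub,
    integral_const_mul, hΨ.integral_singularPart hα hαβ h0 h1, resolventIntegral]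
  ring

lemma norm_singularRemainder_div_le {C : ℝ} {α β lam ζ : ℝ} {w : ℂ}
    (hΨ : RegularSymbol Ψ Ψ' Ψ'') (hζ : ζ ∈ Ioi (0:ℝ)) (hw : Real.exp w.re = Ψ lam)
    (hC : 0 ≤ C) (h0 : 0 < w.im) (h1 : w.im < 2 * Real.pi)
    (h : |singularRemainder Ψ' f α β lam ζ| ≤ C * (1 / (1 + Ψ ζ)) * |Ψ ζ - Ψ lam|) :
    ‖(singularRemainder Ψ' f α β lam ζ : ℂ) / ((Ψ ζ : ℂ) - Complex.exp w)‖ ≤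
      C * (1 / (1 + Ψ ζ)) := by
  have hp := hΨ.pos ζ hζ
  rw [norm_div, Complex.norm_real, Real.norm_eq_abs,
    div_le_iff₀ (norm_pos_iff.2 (hΨ.sub_exp_ne_zero hζ h0 h1))]
  refine h.trans ?_
  have := abs_sub_exp_re_le hp.le w
  rw [hw] at this
  gcongr

lemma norm_log_le {u : ℂ} {δ D : ℝ} (hδ : 0 < δ) (h1 : δ ≤ ‖u‖) (h2 : ‖u‖ ≤ D) :
    ‖Complex.log u‖ ≤ |Real.log δ| + |Real.log D| + Real.pi := by
  refine (Complex.norm_le_abs_re_add_abs_im _).trans ?_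
  rw [Complex.log_re, Complex.log_im]
  refine add_le_add ?_ (Complex.abs_arg_le_pi u)
  have l1 := Real.log_le_log hδ h1
  have l2 := Real.log_le_log (hδ.trans_le h1) h2
  rw [abs_le]
  constructor
  · linarith [neg_abs_le (Real.log δ), abs_nonneg (Real.log D)]
  · linarith [le_abs_self (Real.log D), abs_nonneg (Real.log δ)]

lemma exists_preimage_Icc (hΨ : RegularSymbol Ψ Ψ' Ψ'') {x₀ x₁ : ℝ} (h : x₀ ≤ x₁) :
    ∃ a b, 0 < a ∧ a ≤ b ∧
      ∀ x ∈ Icc x₀ x₁, ∃ lam ∈ Icc a b, Ψ lam = Real.exp x := by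
  obtain ⟨a, ha, ha'⟩ := hΨ.exists_apply_eq (Real.exp_pos x₀)
  obtain ⟨b, hb, hb'⟩ := hΨ.exists_apply_eq (Real.exp_pos x₁)
  refine ⟨a, b, ha, ?_, fun x hx => ?_⟩
  · rw [← hΨ.mono.le_iff_le ha hb, ha', hb']; exact Real.exp_le_exp.2 h
  · obtain ⟨c, hc, hc'⟩ := hΨ.exists_apply_eq (Real.exp_pos x)
    refine ⟨c, ⟨?_, ?_⟩, hc'⟩
    · rw [← hΨ.mono.le_iff_le ha hc, ha', hc']; exact Real.exp_le_exp.2 hx.1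
    · rw [← hΨ.mono.le_iff_le hc hb, hb', hc']; exact Real.exp_le_exp.2 hx.2

lemma exists_norm_resolventIntegral_le (hΨ : RegularSymbol Ψ Ψ' Ψ'') (hf : BoundedC1 f f' B)
    {x₀ x₁ : ℝ} (h : x₀ ≤ x₁) :
    ∃ C, ∀ w : ℂ, w.re ∈ Icc x₀ x₁ → 0 < w.im → w.im < Real.pi →
      ‖resolventIntegral Ψ f (Complex.exp w)‖ ≤ C := by
  obtain ⟨a, b, ha, hab, hpre⟩ := hΨ.exists_preimage_Icc h
  obtain ⟨C, hC, hrem⟩ := hΨ.exists_abs_singularRemainder_le hf (half_pos ha) (half_lt_self ha)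
    hab (lt_add_one b)
  set α := a / 2
  set β := b + 1
  have hα0 : α ∈ Ioi (0:ℝ) := half_pos ha
  have ha0 : a ∈ Ioi (0:ℝ) := ha
  have hb0 : b ∈ Ioi (0:ℝ) := ha.trans_le hab
  have hβ0 : β ∈ Ioi (0:ℝ) := lt_trans hb0 (lt_add_one b)
  have d1 := hΨ.mono hα0 ha0 (half_lt_self ha)
  have d2 := hΨ.mono hb0 hβ0 (lt_add_one b)
  have pα := hΨ.pos α hα0
  obtain ⟨H, hH⟩ := isCompact_Icc.exists_bound_of_continuousOn
    (f := fun x => f x / Ψ' x) (s := Icc a b)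
    ((hf.continuousOn.div hΨ.continuousOn_deriv fun x hx => (hΨ.deriv_pos x hx).ne').mono
      fun x hx => lt_of_lt_of_le ha hx.1)
  set L₁ := |Real.log (Ψ β - Ψ b)| + |Real.log (2 * Ψ β)| + Real.pi
  set L₂ := |Real.log (Ψ a - Ψ α)| + |Real.log (2 * Ψ β)| + Real.pi
  refine ⟨C * (∫ ζ in Ioi (0:ℝ), 1 / (1 + Ψ ζ)) + H * (L₁ + L₂), fun w hw h0 h1 => ?_⟩
  obtain ⟨lam, hlam, hlamw⟩ := hpre _ hw
  have h1' : w.im < 2 * Real.pi := by linarith [Real.pi_pos]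
  have hlam0 : lam ∈ Ioi (0:ℝ) := lt_of_lt_of_le ha hlam.1
  have m1 := hΨ.mono.monotoneOn ha0 hlam0 hlam.1
  have m2 := hΨ.mono.monotoneOn hlam0 hb0 hlam.2
  rw [(hΨ.resolventIntegral_eq hf (lam := lam) (β := β) hα0
    (by simp only [α, β]; linarith) h0 h1).2]
  refine (norm_add_le _ _).trans (add_le_add ?_ ?_)
  · rw [← integral_const_mul]
    refine norm_integral_le_of_norm_le (hΨ.integrableOn.const_mul C) ?_
    refine (ae_restrict_iff' measurableSet_Ioi).2 (.of_forall fun ζ hζ => ?_)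
    exact norm_singularRemainder_div_le hΨ hζ hlamw.symm hC h0 h1' (hrem lam hlam ζ hζ)
  · rw [norm_mul, Complex.norm_real]
    have up : ∀ y ∈ Ioi (0:ℝ), Ψ y ≤ Ψ β → ‖Complex.exp w - Ψ y‖ ≤ 2 * Ψ β := by
      intro y hy hyβ
      refine (norm_sub_le _ _).trans ?_
      rw [Complex.norm_exp, Complex.norm_real, Real.norm_of_nonneg (hΨ.pos y hy).le, ← hlamw]
      linarith
    have low : ∀ y ∈ Ioi (0:ℝ), |Ψ y - Ψ lam| ≤ ‖Complex.exp w - Ψ y‖ := by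
      intro y hy
      rw [norm_sub_rev, hlamw]
      exact abs_sub_exp_re_le (hΨ.pos y hy).le w
    refine mul_le_mul (hH lam hlam) ((norm_sub_le _ _).trans (add_le_add ?_ ?_))
      (norm_nonneg _) ((norm_nonneg _).trans (hH lam hlam))
    · refine norm_log_le (by linarith) ?_ (up β hβ0 le_rfl)
      exact le_trans (by linarith [le_abs_self (Ψ β - Ψ lam)]) (low β hβ0)
    · refine norm_log_le (by linarith) ?_ (up α hα0 (by linarith))
      exact le_trans (by linarith [neg_abs_le (Ψ α - Ψ lam)]) (low α hα0)

lemma exists_le_norm_resolventIntegral_one (hΨ : RegularSymbol Ψ Ψ' Ψ'')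
    {x₀ x₁ : ℝ} (h : x₀ ≤ x₁) :
    ∃ c > 0, ∀ w : ℂ, w.re ∈ Icc x₀ x₁ → 0 < w.im → w.im ≤ 1 →
      c ≤ ‖resolventIntegral Ψ (fun _ => 1) (Complex.exp w)‖ := by
  obtain ⟨a, b, ha, hab, hpre⟩ := hΨ.exists_preimage_Icc h
  have hsub : Icc a (b + 1) ⊆ Ioi 0 := fun x hx => lt_of_lt_of_le ha hx.1
  obtain ⟨D, hD⟩ := isCompact_Icc.exists_bound_of_continuousOn
    (hΨ.continuousOn_deriv.mono hsub)
  have hD0 : 0 ≤ D := (norm_nonneg _).trans (hD a ⟨le_rfl, by linarith⟩)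
  refine ⟨Real.exp x₀ / (4 * (D + Real.exp x₁) ^ 2), by positivity, fun w hw h0 h1 => ?_⟩
  have hpi := Real.pi_gt_three
  have h1' : w.im < 2 * Real.pi := by linarith
  obtain ⟨lam, hlam, hlamw⟩ := hpre _ hw
  have hlam0 : (0:ℝ) < lam := lt_of_lt_of_le ha hlam.1
  have hex := Real.exp_pos w.re
  refine le_trans ?_ (hΨ.sin_half_mul_le_norm_resolventIntegral_one h0 h1')
  have hsin : w.im / 4 ≤ Real.sin (w.im / 2) := by
    have := Real.mul_le_sin (x := w.im / 2) (by linarith) (by linarith)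
    refine le_trans ?_ this
    rw [div_mul_div_comm, div_le_div_iff₀ (by norm_num) (by positivity)]
    nlinarith [Real.pi_lt_four]
  have hset : Ioc lam (lam + w.im) ⊆ Ioi (0:ℝ) := fun x hx => hlam0.trans hx.1
  have hnorm : ∀ ζ ∈ Ioc lam (lam + w.im),
      ‖(Ψ ζ : ℂ) - Complex.exp w‖ ≤ (D + Real.exp w.re) * w.im := by
    intro ζ hζ
    have e1 : |Ψ ζ - Ψ lam| ≤ D * w.im := by
      have := (convex_Icc a (b + 1)).norm_image_sub_le_of_norm_hasDerivWithin_le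
        (fun x hx => (hΨ.hasDerivAt x (hsub hx)).hasDerivWithinAt) hD
        (x := lam) (y := ζ) ⟨hlam.1, by linarith [hlam.2]⟩
        ⟨by linarith [hlam.1, hζ.1], by linarith [hlam.2, hζ.2]⟩
      rw [Real.norm_eq_abs, Real.norm_eq_abs, abs_of_pos (sub_pos.2 hζ.1)] at this
      refine this.trans (mul_le_mul_of_nonneg_left ?_ hD0)
      linarith [hζ.2]
    have e2 : Complex.exp w = (Real.exp w.re : ℂ) * Complex.exp (Complex.I * w.im) := by
      rw [Complex.ofReal_exp, ← Complex.exp_add, mul_comm, Complex.re_add_im]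
    have e3 : (Ψ ζ : ℂ) - Complex.exp w = ((Ψ ζ - Ψ lam : ℝ) : ℂ) -
        (Real.exp w.re : ℂ) * (Complex.exp (Complex.I * w.im) - 1) := by
      rw [e2, hlamw]; push_cast; ring
    rw [e3]
    refine (norm_sub_le _ _).trans ?_
    rw [norm_mul, Complex.norm_real, Complex.norm_real, Real.norm_of_nonneg hex.le, add_mul]
    refine add_le_add e1 (mul_le_mul_of_nonneg_left ?_ hex.le)
    have := Real.norm_exp_I_mul_ofReal_sub_one_le (x := w.im)
    rwa [Real.norm_of_nonneg h0.le] at this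
  have hint := hΨ.integrableOn_add_div_norm_sq h0 h1'
  have hlow : Real.exp w.re / ((D + Real.exp w.re) ^ 2 * w.im) ≤ ∫ ζ in Ioi (0:ℝ),
        (Ψ ζ + Real.exp w.re) / ‖(Ψ ζ : ℂ) - Complex.exp w‖ ^ 2 := by
    calc Real.exp w.re / ((D + Real.exp w.re) ^ 2 * w.im) =
          ∫ ζ in Ioc lam (lam + w.im), Real.exp w.re / ((D + Real.exp w.re) * w.im) ^ 2 := by
          rw [setIntegral_const]
          simp only [Measure.real, Real.volume_Ioc, add_sub_cancel_left, smul_eq_mul]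
          rw [ENNReal.toReal_ofReal h0.le]
          field_simp
      _ ≤ ∫ ζ in Ioc lam (lam + w.im),
          (Ψ ζ + Real.exp w.re) / ‖(Ψ ζ : ℂ) - Complex.exp w‖ ^ 2 := by
          refine setIntegral_mono_on (integrableOn_const (by simp)) (hint.mono_set hset)
            measurableSet_Ioc fun ζ hζ => ?_
          have hn := norm_pos_iff.2 (hΨ.sub_exp_ne_zero (hset hζ) h0 h1')
          have hp := hΨ.pos ζ (hset hζ)
          exact div_le_div₀ (by positivity) (by linarith) (by positivity)
            (pow_le_pow_left₀ hn.le (hnorm ζ hζ) 2)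
      _ ≤ _ := by
          refine setIntegral_mono_set hint ?_ hset.eventuallyLE
          refine (ae_restrict_iff' measurableSet_Ioi).2 (.of_forall fun ζ hζ => ?_)
          have := hΨ.add_exp_pos hζ w.re
          exact div_nonneg this.le (sq_nonneg _)
  have s1 : Real.exp x₀ ≤ Real.exp w.re := Real.exp_le_exp.2 hw.1
  have s2 : Real.exp w.re ≤ Real.exp x₁ := Real.exp_le_exp.2 hw.2
  calc Real.exp x₀ / (4 * (D + Real.exp x₁) ^ 2) ≤
        Real.exp w.re / (4 * (D + Real.exp w.re) ^ 2) := by gcongr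
    _ = w.im / 4 * (Real.exp w.re / ((D + Real.exp w.re) ^ 2 * w.im)) := by field_simp
    _ ≤ _ := mul_le_mul hsin hlow (by positivity) (by linarith)

lemma exists_norm_schurComplement_le (hΨ : RegularSymbol Ψ Ψ' Ψ'') (hf : BoundedC1 f f' B)
    {x₀ x₁ : ℝ} (h : x₀ ≤ x₁) :
    ∃ C, ∀ w : ℂ, w.re ∈ Icc x₀ x₁ → 0 < w.im → w.im ≤ 1 →
      ‖schurComplement Ψ f (Complex.exp w)‖ ≤ C := by
  obtain ⟨C₂, h2⟩ := hΨ.exists_norm_resolventIntegral_le hf.sq h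
  obtain ⟨C₁, h1⟩ := hΨ.exists_norm_resolventIntegral_le hf h
  obtain ⟨c, hc, h0⟩ := hΨ.exists_le_norm_resolventIntegral_one h
  refine ⟨C₂ + C₁ ^ 2 / c, fun w hw hw0 hw1 => ?_⟩
  have hw2 : w.im < Real.pi := by linarith [Real.pi_gt_three]
  refine (norm_sub_le _ _).trans (add_le_add (h2 w hw hw0 hw2) ?_)
  rw [norm_div, norm_pow]
  exact div_le_div₀ (sq_nonneg _) (pow_le_pow_left₀ (norm_nonneg _) (h1 w hw hw0 hw2) 2) hc
    (h0 w hw hw0 hw1)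

end RegularSymbol

namespace RegularSymbol

variable {Ψ Ψ' Ψ'' f f' : ℝ → ℝ} {B : ℝ}

lemma integral_deriv_div_sub (hΨ : RegularSymbol Ψ Ψ' Ψ'') {p q lam : ℝ} (hp : 0 < p)
    (hpq : p ≤ q) (hlam : lam ∈ Ioi (0:ℝ)) (hn : lam ∉ Icc p q) :
    IntegrableOn (fun ζ => Ψ' ζ / (Ψ ζ - Ψ lam)) (Icc p q) ∧
    ∫ ζ in Icc p q, Ψ' ζ / (Ψ ζ - Ψ lam) =
      Real.log (Ψ q - Ψ lam) - Real.log (Ψ p - Ψ lam) := by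
  have hsub : Icc p q ⊆ Ioi 0 := fun x hx => lt_of_lt_of_le hp hx.1
  have hne : ∀ ζ ∈ Icc p q, Ψ ζ - Ψ lam ≠ 0 := fun ζ hζ h =>
    hn (hΨ.mono.injOn (hsub hζ) hlam (sub_eq_zero.1 h) ▸ hζ)
  have hint : IntegrableOn (fun ζ => Ψ' ζ / (Ψ ζ - Ψ lam)) (Icc p q) :=
    ContinuousOn.integrableOn_compact isCompact_Icc ((hΨ.continuousOn_deriv.mono hsub).div
      ((hΨ.continuousOn.mono hsub).sub continuousOn_const) hne)
  refine ⟨hint, ?_⟩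
  rw [integral_Icc_eq_integral_Ioc, ← intervalIntegral.integral_of_le hpq]
  refine intervalIntegral.integral_eq_sub_of_hasDerivAt
    (f := fun ζ => Real.log (Ψ ζ - Ψ lam)) (fun ζ hζ => ?_) ?_
  · rw [uIcc_of_le hpq] at hζ
    exact ((hΨ.hasDerivAt ζ (hsub hζ)).sub_const _).log (hne ζ hζ)
  · rwa [intervalIntegrable_iff_integrableOn_Icc_of_le hpq]

lemma tendsto_log_sub_log (hΨ : RegularSymbol Ψ Ψ' Ψ'') {lam : ℝ} (hlam : lam ∈ Ioi (0:ℝ)) :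
    Tendsto (fun ε => Real.log (Ψ (lam - ε) - Ψ lam) - Real.log (Ψ (lam + ε) - Ψ lam))
      (𝓝[>] 0) (𝓝 0) := by
  have hd := hΨ.deriv_pos lam hlam
  have h1 := (hasDerivAt_iff_tendsto_slope_zero.1 (hΨ.hasDerivAt lam hlam)).log hd.ne'
  have hp : Tendsto (fun ε : ℝ => ε) (𝓝[>] 0) (𝓝[≠] 0) :=
    tendsto_id.mono_right (nhdsWithin_mono _ fun x hx => ne_of_gt hx)
  have hm : Tendsto (fun ε : ℝ => -ε) (𝓝[>] 0) (𝓝[≠] 0) := by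
    refine tendsto_nhdsWithin_iff.2 ⟨?_, ?_⟩
    · have : Tendsto (fun ε : ℝ => -ε) (𝓝 0) (𝓝 (-0)) := tendsto_id.neg
      rw [neg_zero] at this
      exact this.mono_left nhdsWithin_le_nhds
    · filter_upwards [self_mem_nhdsWithin] with ε hε
      simpa using ne_of_gt hε
  have h2 := (h1.comp hm).sub (h1.comp hp)
  rw [sub_self] at h2
  refine h2.congr' ?_
  have hsm : ∀ᶠ ε in 𝓝[>] (0:ℝ), ε < lam :=
    nhdsWithin_le_nhds (gt_mem_nhds hlam)
  filter_upwards [self_mem_nhdsWithin, hsm] with ε hε hε'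
  have hε0 : (0:ℝ) < ε := hε
  have e1 : Ψ (lam + ε) - Ψ lam ≠ 0 := (sub_pos.2 (hΨ.mono hlam
    (lt_trans hlam (lt_add_of_pos_right _ hε0) : (0:ℝ) < _) (lt_add_of_pos_right _ hε0))).ne'
  have e2 : Ψ (lam + -ε) - Ψ lam ≠ 0 := (sub_neg.2 (hΨ.mono
    (show (0:ℝ) < lam + -ε by linarith) hlam (by linarith))).ne
  simp only [Function.comp, smul_eq_mul]
  rw [Real.log_mul (inv_ne_zero (by linarith)) e2, Real.log_mul (inv_ne_zero (by linarith)) e1,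
    Real.log_inv, Real.log_inv, Real.log_neg_eq_log, ← sub_eq_add_neg]
  ring

lemma norm_singularRemainder_div_sub_le {C : ℝ} {α β lam ζ : ℝ}
    (hΨ : RegularSymbol Ψ Ψ' Ψ'') (hζ : ζ ∈ Ioi (0:ℝ)) (hC : 0 ≤ C)
    (h : |singularRemainder Ψ' f α β lam ζ| ≤ C * (1 / (1 + Ψ ζ)) * |Ψ ζ - Ψ lam|) :
    ‖singularRemainder Ψ' f α β lam ζ / (Ψ ζ - Ψ lam)‖ ≤ C * (1 / (1 + Ψ ζ)) := by
  have hp := hΨ.pos ζ hζ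
  rw [norm_div]
  exact div_le_of_le_mul₀ (norm_nonneg _) (by positivity) h

lemma aestronglyMeasurable_singularRemainder (hΨ : RegularSymbol Ψ Ψ' Ψ'')
    (hf : BoundedC1 f f' B) (α β lam : ℝ) :
    AEStronglyMeasurable (singularRemainder Ψ' f α β lam) (volume.restrict (Ioi 0)) :=
  hf.aestronglyMeasurable.sub (((hΨ.continuousOn_deriv.aestronglyMeasurable
    measurableSet_Ioi).const_mul (f lam / Ψ' lam)).indicator measurableSet_Icc)

lemma integrableOn_singularRemainder_div_sub (hΨ : RegularSymbol Ψ Ψ' Ψ'')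
    (hf : BoundedC1 f f' B) {α β lam : ℝ} (hα : 0 < α) (h1 : α < lam) (h2 : lam < β) :
    IntegrableOn (fun ζ => singularRemainder Ψ' f α β lam ζ / (Ψ ζ - Ψ lam)) (Ioi 0) := by
  obtain ⟨C, hC, hrem⟩ := hΨ.exists_abs_singularRemainder_le hf hα h1 le_rfl h2
  refine hΨ.integrableOn_of_norm_le ?_ C fun ζ hζ =>
    hΨ.norm_singularRemainder_div_sub_le hζ hC (hrem lam ⟨le_rfl, le_rfl⟩ ζ hζ)
  have h1 : AEStronglyMeasurable Ψ (volume.restrict (Ioi 0)) :=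
    hΨ.continuousOn.aestronglyMeasurable measurableSet_Ioi
  exact ((hΨ.aestronglyMeasurable_singularRemainder hf α β lam).aemeasurable.div
    (h1.aemeasurable.sub_const _)).aestronglyMeasurable

lemma setIntegral_punctured_eq (hΨ : RegularSymbol Ψ Ψ' Ψ'') (hf : BoundedC1 f f' B)
    {α β lam ε : ℝ} (hα : 0 < α) (h1 : α < lam - ε) (h2 : lam + ε < β) (hε : 0 < ε) :
    ∫ ζ in Ioi (0:ℝ) \ Icc (lam - ε) (lam + ε), f ζ * (Ψ' lam / (Ψ lam - Ψ ζ)) =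
      -Ψ' lam * ((∫ ζ in Ioi (0:ℝ) \ Icc (lam - ε) (lam + ε),
          singularRemainder Ψ' f α β lam ζ / (Ψ ζ - Ψ lam)) +
        f lam / Ψ' lam * (Real.log (Ψ (lam - ε) - Ψ lam) - Real.log (Ψ (lam + ε) - Ψ lam) +
          (Real.log (Ψ β - Ψ lam) - Real.log (Ψ α - Ψ lam)))) := by
  have hlam : lam ∈ Ioi (0:ℝ) := show (0:ℝ) < lam by linarith
  have i1 := (hΨ.integrableOn_singularRemainder_div_sub hf hα (by linarith : α < lam)
    (by linarith : lam < β)).mono_set (sdiff_subset (t := Icc (lam - ε) (lam + ε)))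
  obtain ⟨ja, ea⟩ := hΨ.integral_deriv_div_sub hα h1.le hlam (fun h => by linarith [h.2])
  obtain ⟨jb, eb⟩ := hΨ.integral_deriv_div_sub (q := β) (by linarith : 0 < lam + ε)
    h2.le hlam (fun h => by linarith [h.1])
  have ja' := ja.mono_set Ico_subset_Icc_self
  have jb' := jb.mono_set Ioc_subset_Icc_self
  have hset : (Ioi (0:ℝ) \ Icc (lam - ε) (lam + ε)) ∩ Icc α β =
      Ico α (lam - ε) ∪ Ioc (lam + ε) β := by
    ext x
    simp only [mem_inter_iff, Set.mem_sdiff, mem_Ioi, mem_Icc, mem_union, mem_Ico, mem_Ioc, not_and_or,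
      not_le]
    constructor
    · rintro ⟨⟨-, h | h⟩, h3, h4⟩
      · exact Or.inl ⟨h3, h⟩
      · exact Or.inr ⟨h, h4⟩
    · rintro (⟨h3, h4⟩ | ⟨h3, h4⟩)
      · exact ⟨⟨by linarith, Or.inl h4⟩, h3, by linarith⟩
      · exact ⟨⟨by linarith, Or.inr h3⟩, by linarith, h4⟩
  have hdisj : Disjoint (Ico α (lam - ε)) (Ioc (lam + ε) β) :=
    disjoint_left.2 fun x hx hx' => by linarith [hx.2, hx'.1]
  have hms : MeasurableSet (Ioi (0:ℝ) \ Icc (lam - ε) (lam + ε)) :=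
    measurableSet_Ioi.diff measurableSet_Icc
  have j2 : IntegrableOn ((Icc α β).indicator fun ζ => Ψ' ζ / (Ψ ζ - Ψ lam))
      (Ioi (0:ℝ) \ Icc (lam - ε) (lam + ε)) := by
    rw [IntegrableOn, integrable_indicator_iff measurableSet_Icc, IntegrableOn,
      Measure.restrict_restrict measurableSet_Icc, inter_comm, hset]
    exact ja'.union jb'
  have e2 : ∫ ζ in Ioi (0:ℝ) \ Icc (lam - ε) (lam + ε),
      (Icc α β).indicator (fun ζ => Ψ' ζ / (Ψ ζ - Ψ lam)) ζ =
      Real.log (Ψ (lam - ε) - Ψ lam) - Real.log (Ψ (lam + ε) - Ψ lam) +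
          (Real.log (Ψ β - Ψ lam) - Real.log (Ψ α - Ψ lam)) := by
    rw [setIntegral_indicator measurableSet_Icc, hset,
      setIntegral_union hdisj measurableSet_Ioc ja' jb',
      ← integral_Icc_eq_integral_Ico, ← integral_Icc_eq_integral_Ioc, ea, eb]
    ring
  rw [← e2, ← integral_const_mul, ← integral_add i1 (j2.const_mul _), ← integral_const_mul]
  refine setIntegral_congr_fun hms fun ζ _ => ?_
  simp only [singularRemainder]
  rw [← neg_sub (Ψ ζ), div_neg]
  by_cases h : ζ ∈ Icc α β
  · simp only [indicator_of_mem h]; ring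
  · simp only [indicator_of_notMem h]; ring

lemma tendsto_setIntegral_punctured {g : ℝ → ℝ} (hg : IntegrableOn g (Ioi 0)) (lam : ℝ) :
    Tendsto (fun ε => ∫ ζ in Ioi (0:ℝ) \ Icc (lam - ε) (lam + ε), g ζ) (𝓝[>] 0)
      (𝓝 (∫ ζ in Ioi (0:ℝ), g ζ)) := by
  have e : ∀ ε, ∫ ζ in Ioi (0:ℝ) \ Icc (lam - ε) (lam + ε), g ζ =
      ∫ ζ in Ioi (0:ℝ), (Icc (lam - ε) (lam + ε))ᶜ.indicator g ζ := fun ε => by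
    rw [setIntegral_indicator measurableSet_Icc.compl, sdiff_eq]
  simp only [e]
  refine tendsto_integral_filter_of_dominated_convergence (fun ζ => ‖g ζ‖)
    (.of_forall fun ε => hg.1.indicator measurableSet_Icc.compl)
    (.of_forall fun ε => .of_forall fun ζ => norm_indicator_le_norm_self _ _) hg.norm ?_
  filter_upwards [compl_mem_ae_iff.2 (measure_singleton (μ := volume.restrict (Ioi 0)) lam)]
    with ζ hζ
  have hpos : 0 < |ζ - lam| := abs_pos.2 (sub_ne_zero.2 hζ)
  refine tendsto_const_nhds.congr' ?_
  filter_upwards [nhdsWithin_le_nhds (gt_mem_nhds hpos)] with ε hε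
  rw [indicator_of_mem]
  intro h
  have : |ζ - lam| ≤ ε := abs_le.2 ⟨by linarith [h.1], by linarith [h.2]⟩
  linarith

lemma tendsto_exp_add_mul_I (x : ℝ) :
    Tendsto (fun θ : ℝ => Complex.exp (x + θ * Complex.I)) (𝓝[>] 0) (𝓝 (Real.exp x)) := by
  have h : Continuous fun θ : ℝ => Complex.exp (x + θ * Complex.I) := by fun_prop
  have := h.tendsto 0
  simp only [Complex.ofReal_zero, zero_mul, add_zero] at this
  rw [Complex.ofReal_exp]
  exact this.mono_left nhdsWithin_le_nhds

lemma exists_boundary_value (hΨ : RegularSymbol Ψ Ψ' Ψ'') (hf : BoundedC1 f f' B) {lam : ℝ}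
    (hlam : lam ∈ Ioi (0:ℝ)) :
    ∃ k : ℝ, Tendsto (fun ε : ℝ => -(Real.pi)⁻¹ * ∫ ζ in Ioi (0:ℝ) \ Icc (lam - ε) (lam + ε),
        f ζ * (Ψ' lam / (Ψ lam - Ψ ζ))) (𝓝[>] 0) (𝓝 k) ∧
      Tendsto (fun θ : ℝ => resolventIntegral Ψ f
        (Complex.exp ((Real.log (Ψ lam) : ℝ) + θ * Complex.I))) (𝓝[>] 0)
        (𝓝 (((Real.pi / Ψ' lam : ℝ) : ℂ) * (k + f lam * Complex.I))) := by
  have hl : 0 < lam := hlam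
  obtain ⟨C, hC, hrem⟩ := hΨ.exists_abs_singularRemainder_le hf (half_pos hl) (half_lt_self hl)
    le_rfl (lt_add_one lam)
  have ir := hΨ.integrableOn_singularRemainder_div_sub hf (half_pos hl) (half_lt_self hl)
    (lt_add_one lam)
  have hα0 : lam / 2 ∈ Ioi (0:ℝ) := half_pos hl
  have hβ0 : lam + 1 ∈ Ioi (0:ℝ) := lt_trans hl (lt_add_one lam)
  have d1 := hΨ.mono hα0 hlam (half_lt_self hl)
  have d2 := hΨ.mono hlam hβ0 (lt_add_one lam)
  have hαβ : lam / 2 ≤ lam + 1 := by linarith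
  have hd := hΨ.deriv_pos lam hlam
  set α := lam / 2
  set β := lam + 1
  set R := ∫ ζ in Ioi (0:ℝ), singularRemainder Ψ' f α β lam ζ / (Ψ ζ - Ψ lam)
  set l := Real.log (Ψ β - Ψ lam) - Real.log (Ψ α - Ψ lam)
  refine ⟨-(Real.pi)⁻¹ * (-Ψ' lam * (R + f lam / Ψ' lam * (0 + l))), ?_, ?_⟩
  · have h1 : Tendsto (fun ε => -(Real.pi)⁻¹ * (-Ψ' lam *
        ((∫ ζ in Ioi (0:ℝ) \ Icc (lam - ε) (lam + ε),
          singularRemainder Ψ' f α β lam ζ / (Ψ ζ - Ψ lam)) +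
        f lam / Ψ' lam * (Real.log (Ψ (lam - ε) - Ψ lam) - Real.log (Ψ (lam + ε) - Ψ lam) + l))))
        (𝓝[>] 0) (𝓝 (-(Real.pi)⁻¹ * (-Ψ' lam * (R + f lam / Ψ' lam * (0 + l))))) :=
      (((tendsto_setIntegral_punctured ir lam).add
        (((hΨ.tendsto_log_sub_log hlam).add_const l).const_mul _)).const_mul _).const_mul _
    refine h1.congr' ?_
    have hs1 : ∀ᶠ ε in 𝓝[>] (0:ℝ), ε < lam / 2 := nhdsWithin_le_nhds (gt_mem_nhds (half_pos hl))
    have hs2 : ∀ᶠ ε in 𝓝[>] (0:ℝ), ε < 1 := nhdsWithin_le_nhds (gt_mem_nhds one_pos)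
    filter_upwards [self_mem_nhdsWithin, hs1, hs2] with ε hε h2 h3
    rw [hΨ.setIntegral_punctured_eq hf (β := β) hα0 (by simp only [α]; linarith)
      (by simp only [β]; linarith) hε]
  · set x := Real.log (Ψ lam)
    have hx : Real.exp x = Ψ lam := Real.exp_log (hΨ.pos lam hlam)
    have hexp := tendsto_exp_add_mul_I x
    rw [hx] at hexp
    have him : ∀ᶠ θ : ℝ in 𝓝[>] 0, 0 < θ ∧ θ < Real.pi := by
      filter_upwards [self_mem_nhdsWithin, nhdsWithin_le_nhds (gt_mem_nhds Real.pi_pos)]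
        with θ h1 h2 using ⟨h1, h2⟩
    have hw : ∀ θ : ℝ, ((x : ℂ) + θ * Complex.I).im = θ := fun θ => by simp
    have hwr : ∀ θ : ℝ, ((x : ℂ) + θ * Complex.I).re = x := fun θ => by simp
    have t1 : Tendsto (fun θ : ℝ => ∫ ζ in Ioi (0:ℝ), (singularRemainder Ψ' f α β lam ζ : ℂ) /
        ((Ψ ζ : ℂ) - Complex.exp (x + θ * Complex.I))) (𝓝[>] 0) (𝓝 R) := by
      have : (R : ℂ) = ∫ ζ in Ioi (0:ℝ), (singularRemainder Ψ' f α β lam ζ : ℂ) /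
        ((Ψ ζ : ℂ) - (Ψ lam : ℂ)) := by
        simp only [R]; rw [← integral_complex_ofReal]; simp
      rw [this]
      refine tendsto_integral_filter_of_dominated_convergence (fun ζ => C * (1 / (1 + Ψ ζ)))
        (.of_forall fun θ => hΨ.aestronglyMeasurable_div_sub
          (Complex.measurable_ofReal.comp_aemeasurable
          (hΨ.aestronglyMeasurable_singularRemainder hf α β lam).aemeasurable).aestronglyMeasurable
          _) ?_ (hΨ.integrableOn.const_mul C) ?_
      · filter_upwards [him] with θ hθ
        refine (ae_restrict_iff' measurableSet_Ioi).2 (.of_forall fun ζ hζ => ?_)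
        exact norm_singularRemainder_div_le hΨ hζ (by rw [hwr, hx]) hC (by rw [hw]; exact hθ.1)
          (by rw [hw]; linarith [hθ.2, Real.pi_pos]) (hrem lam ⟨le_rfl, le_rfl⟩ ζ hζ)
      · refine (ae_restrict_iff' measurableSet_Ioi).2 (.of_forall fun ζ hζ => ?_)
        by_cases h : Ψ ζ = Ψ lam
        · have := hrem lam ⟨le_rfl, le_rfl⟩ ζ hζ
          rw [h, sub_self, abs_zero, mul_zero, abs_nonpos_iff] at this
          simp only [this, Complex.ofReal_zero, zero_div]
          exact tendsto_const_nhds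
        · refine tendsto_const_nhds.div (tendsto_const_nhds.sub hexp) ?_
          rw [sub_ne_zero]; exact_mod_cast h
    have t2 : Tendsto (fun θ : ℝ => Complex.log (Complex.exp (x + θ * Complex.I) - Ψ α)) (𝓝[>] 0)
        (𝓝 (Real.log (Ψ α - Ψ lam))) := by
      have h1 := (hexp.sub_const (Ψ α : ℂ)).clog (Complex.mem_slitPlane_iff.2 (Or.inl (by
        simp only [Complex.sub_re, Complex.ofReal_re]; linarith)))
      rwa [← Complex.ofReal_sub, ← Complex.ofReal_log (by linarith), ← Real.log_neg_eq_log,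
        neg_sub] at h1
    have t3 : Tendsto (fun θ : ℝ => Complex.log (Complex.exp (x + θ * Complex.I) - Ψ β)) (𝓝[>] 0)
        (𝓝 (Real.log (Ψ β - Ψ lam) + Real.pi * Complex.I)) := by
      have h1 := Complex.tendsto_log_nhdsWithin_im_nonneg_of_re_neg_of_im_zero
        (z := (Ψ lam : ℂ) - Ψ β) (by simp only [Complex.sub_re, Complex.ofReal_re]; linarith)
        (by simp)
      rw [← Complex.ofReal_sub, Complex.norm_real, Real.norm_eq_abs, Real.log_abs,
        ← Real.log_neg_eq_log, neg_sub] at h1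
      refine h1.comp (tendsto_nhdsWithin_iff.2 ⟨?_, ?_⟩)
      · rw [Complex.ofReal_sub]; exact hexp.sub_const _
      · filter_upwards [him] with θ hθ
        have := im_exp_pos (w := x + θ * Complex.I) (by rw [hw]; exact hθ.1)
          (by rw [hw]; exact hθ.2)
        simpa using this.le
    have t4 := t1.add ((t3.sub t2).const_mul ((f lam / Ψ' lam : ℝ) : ℂ))
    have hval : (R : ℂ) + ((f lam / Ψ' lam : ℝ) : ℂ) *
        (Real.log (Ψ β - Ψ lam) + Real.pi * Complex.I - Real.log (Ψ α - Ψ lam)) =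
        ((Real.pi / Ψ' lam : ℝ) : ℂ) *
          (((-(Real.pi)⁻¹ * (-Ψ' lam * (R + f lam / Ψ' lam * (0 + l))) : ℝ) : ℂ) +
            f lam * Complex.I) := by
      have hd' : (Ψ' lam : ℂ) ≠ 0 := by exact_mod_cast hd.ne'
      have hpi : (Real.pi : ℂ) ≠ 0 := by exact_mod_cast Real.pi_ne_zero
      simp only [l]
      push_cast
      field_simp
      ring
    rw [hval] at t4
    refine t4.congr' ?_
    filter_upwards [him] with θ hθ
    exact (hΨ.resolventIntegral_eq hf hα0 hαβ (by rw [hw]; exact hθ.1)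
      (by rw [hw]; exact hθ.2)).2.symm

end RegularSymbol

/-- Holomorphic functions on the strip `0 < im w < 2 * π` with boundary values `Γ` on the real
axis having nonnegative imaginary part, together with the growth bounds needed to shift the
contour from the real axis to the line `im w = π`. -/
structure StripFunction (G : ℂ → ℂ) (Γ : ℝ → ℂ) (c : ℝ) : Prop where
  differentiableAt : ∀ w : ℂ, 0 < w.im → w.im < 2 * Real.pi → DifferentiableAt ℂ G w
  norm_mul_sin_le : ∀ w : ℂ, 0 < w.im → w.im < 2 * Real.pi → ‖G w‖ * Real.sin (w.im / 2) ≤ c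
  exists_norm_le : ∀ x₀ x₁ : ℝ, x₀ ≤ x₁ →
    ∃ C, ∀ w : ℂ, w.re ∈ Icc x₀ x₁ → 0 < w.im → w.im ≤ 1 → ‖G w‖ ≤ C
  im_eq_zero : ∀ x : ℝ, (G (x + Real.pi * Complex.I)).im = 0
  tendsto_boundary : ∀ x : ℝ,
    Tendsto (fun θ : ℝ => G (x + θ * Complex.I)) (𝓝[>] 0) (𝓝 (Γ x))
  boundary_nonneg : ∀ x : ℝ, 0 ≤ (Γ x).im
  tendsto_atBot : ∀ θ : ℝ, 0 < θ → θ < 2 * Real.pi →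
    Tendsto (fun x : ℝ => G (x + θ * Complex.I)) atBot (𝓝 0)
  tendsto_atTop : ∀ θ : ℝ, 0 < θ → θ < 2 * Real.pi →
    Tendsto (fun x : ℝ => G (x + θ * Complex.I)) atTop (𝓝 (-(c : ℂ)))

/-- An entire weight vanishing at both real endpoints `a` and `b`. -/
noncomputable def edgeWeight (a b : ℝ) (w : ℂ) : ℂ :=
  (1 - Complex.exp (w - b)) * (1 - Complex.exp (a - w))

lemma differentiable_edgeWeight (a b : ℝ) : Differentiable ℂ (edgeWeight a b) := by
  unfold edgeWeight; fun_prop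

lemma edgeWeight_ofReal (a b x : ℝ) :
    edgeWeight a b x = (((1 - Real.exp (x - b)) * (1 - Real.exp (a - x)) : ℝ) : ℂ) := by
  simp [edgeWeight]

lemma im_edgeWeight_add_pi (a b x : ℝ) :
    (edgeWeight a b (x + Real.pi * Complex.I)).im = 0 := by
  have h1 : Complex.exp (x + Real.pi * Complex.I - b) = ((-Real.exp (x - b) : ℝ) : ℂ) := by
    rw [add_sub_right_comm, Complex.exp_add, Complex.exp_pi_mul_I]; simp
  have h2 : Complex.exp (a - (x + Real.pi * Complex.I)) = ((-Real.exp (a - x) : ℝ) : ℂ) := by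
    rw [← sub_sub, sub_eq_add_neg (_ - _), Complex.exp_add, Complex.exp_neg,
      Complex.exp_pi_mul_I]; simp
  rw [edgeWeight, h1, h2, ← Complex.ofReal_one, ← Complex.ofReal_sub, ← Complex.ofReal_sub,
    ← Complex.ofReal_mul, Complex.ofReal_im]

lemma norm_one_sub_exp_le {w : ℂ} (h : w.re ≤ 0) : ‖1 - Complex.exp w‖ ≤ 2 := by
  refine (norm_sub_le _ _).trans ?_
  rw [norm_one, Complex.norm_exp]
  linarith [Real.exp_le_one_iff.2 h]

lemma norm_edgeWeight_le {a b : ℝ} {w : ℂ} (h : w.re ∈ Icc a b) : ‖edgeWeight a b w‖ ≤ 4 := by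
  rw [edgeWeight, norm_mul]
  calc _ ≤ (2 : ℝ) * 2 := mul_le_mul (norm_one_sub_exp_le (by simpa using h.2))
        (norm_one_sub_exp_le (by simpa using h.1)) (norm_nonneg _) zero_le_two
    _ = 4 := by norm_num

lemma norm_one_sub_exp_mul_I {y : ℝ} (h0 : 0 ≤ y) (h1 : y ≤ 2 * Real.pi) :
    ‖1 - Complex.exp (y * Complex.I)‖ = 2 * Real.sin (y / 2) := by
  rw [norm_sub_rev, mul_comm, Complex.norm_exp_I_mul_ofReal_sub_one, Real.norm_of_nonneg]
  exact mul_nonneg zero_le_two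
    (Real.sin_nonneg_of_nonneg_of_le_pi (by linarith) (by linarith))

lemma norm_one_sub_exp_neg_mul_I {y : ℝ} (h0 : 0 ≤ y) (h1 : y ≤ 2 * Real.pi) :
    ‖1 - Complex.exp (-(y * Complex.I))‖ = 2 * Real.sin (y / 2) := by
  rw [← norm_one_sub_exp_mul_I h0 h1, ← Complex.norm_conj]
  congr 1
  rw [map_sub, map_one, ← Complex.exp_conj]
  simp

lemma norm_edgeWeight_left_le {a b y : ℝ} (hab : a ≤ b) (h0 : 0 ≤ y) (h1 : y ≤ 2 * Real.pi) :
    ‖edgeWeight a b (a + y * Complex.I)‖ ≤ 4 * Real.sin (y / 2) := by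
  rw [edgeWeight, norm_mul, sub_add_cancel_left, norm_one_sub_exp_neg_mul_I h0 h1]
  have : 0 ≤ Real.sin (y / 2) :=
    Real.sin_nonneg_of_nonneg_of_le_pi (by linarith) (by linarith)
  have h2 := norm_one_sub_exp_le (w := a + y * Complex.I - b) (by simpa using hab)
  nlinarith

lemma norm_edgeWeight_right_le {a b y : ℝ} (hab : a ≤ b) (h0 : 0 ≤ y) (h1 : y ≤ 2 * Real.pi) :
    ‖edgeWeight a b (b + y * Complex.I)‖ ≤ 4 * Real.sin (y / 2) := by
  rw [edgeWeight, norm_mul, add_sub_cancel_left, norm_one_sub_exp_mul_I h0 h1]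
  have : 0 ≤ Real.sin (y / 2) :=
    Real.sin_nonneg_of_nonneg_of_le_pi (by linarith) (by linarith)
  have h2 := norm_one_sub_exp_le (w := a - (b + y * Complex.I)) (by simpa using hab)
  nlinarith

namespace StripFunction

variable {G : ℂ → ℂ} {Γ : ℝ → ℂ} {c : ℝ}

lemma continuous_horizontal (h : StripFunction G Γ c) {θ : ℝ} (h0 : 0 < θ)
    (h1 : θ < 2 * Real.pi) : Continuous fun x : ℝ => G (x + θ * Complex.I) :=
  continuous_iff_continuousAt.2 fun x =>
    ContinuousAt.comp' (g := G) (h.differentiableAt _ (by simpa) (by simpa)).continuousAt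
      (by fun_prop)

lemma continuousOn_vertical (h : StripFunction G Γ c) (x : ℝ) :
    ContinuousOn (fun θ : ℝ => G (x + θ * Complex.I)) (Ioo 0 (2 * Real.pi)) :=
  fun θ hθ => (ContinuousAt.comp' (g := G)
    (h.differentiableAt _ (by simpa using hθ.1) (by simpa using hθ.2)).continuousAt
      (by fun_prop)).continuousWithinAt

lemma uIoc_zero_pi_subset : uIoc 0 Real.pi ⊆ Ioo 0 (2 * Real.pi) := by
  rw [uIoc_of_le Real.pi_pos.le]
  exact fun y hy => ⟨hy.1, by linarith [hy.2, Real.pi_pos]⟩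

lemma aestronglyMeasurable_vertical (h : StripFunction G Γ c) (a b x : ℝ) :
    AEStronglyMeasurable (fun y : ℝ =>
      (G (x + y * Complex.I) * edgeWeight a b (x + y * Complex.I)).re)
      (volume.restrict (uIoc 0 Real.pi)) := by
  have hW : Continuous fun y : ℝ => edgeWeight a b (x + y * Complex.I) :=
    (differentiable_edgeWeight a b).continuous.comp (by fun_prop)
  exact (Complex.continuous_re.comp_continuousOn
    (((h.continuousOn_vertical x).mono uIoc_zero_pi_subset).mul
      hW.continuousOn)).aestronglyMeasurable measurableSet_uIoc

lemma abs_re_mul_le (h : StripFunction G Γ c) {x y : ℝ} {W : ℂ} (hy : y ∈ uIoc 0 Real.pi)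
    (hW : ‖W‖ ≤ 4 * Real.sin (y / 2)) :
    ‖(G (x + y * Complex.I) * W).re‖ ≤ 4 * c := by
  have hy' := uIoc_zero_pi_subset hy
  refine (Complex.abs_re_le_norm _).trans ?_
  rw [norm_mul]
  have := h.norm_mul_sin_le (x + y * Complex.I) (by simpa using hy'.1) (by simpa using hy'.2)
  simp only [Complex.add_im, Complex.ofReal_im, Complex.mul_im, Complex.ofReal_re, Complex.I_im,
    mul_one, Complex.I_re, mul_zero, add_zero, zero_add] at this
  nlinarith [norm_nonneg (G (x + y * Complex.I))]

lemma intervalIntegrable_vertical (h : StripFunction G Γ c) {a b x : ℝ}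
    (hW : ∀ y ∈ uIoc 0 Real.pi,
      ‖edgeWeight a b (x + y * Complex.I)‖ ≤ 4 * Real.sin (y / 2)) :
    IntervalIntegrable (fun y : ℝ =>
      (G (x + y * Complex.I) * edgeWeight a b (x + y * Complex.I)).re) volume 0 Real.pi := by
  rw [intervalIntegrable_iff]
  refine Integrable.mono' (integrableOn_const (C := 4 * c) (by simp [uIoc]))
    (h.aestronglyMeasurable_vertical a b x) ?_
  exact (ae_restrict_iff' measurableSet_uIoc).2
    (.of_forall fun y hy => h.abs_re_mul_le hy (hW y hy))

lemma norm_left_le {a b : ℝ} (hab : a ≤ b) : ∀ y ∈ uIoc 0 Real.pi,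
    ‖edgeWeight a b (a + y * Complex.I)‖ ≤ 4 * Real.sin (y / 2) := fun _ hy =>
  norm_edgeWeight_left_le hab (uIoc_zero_pi_subset hy).1.le (uIoc_zero_pi_subset hy).2.le

lemma norm_right_le {a b : ℝ} (hab : a ≤ b) : ∀ y ∈ uIoc 0 Real.pi,
    ‖edgeWeight a b (b + y * Complex.I)‖ ≤ 4 * Real.sin (y / 2) := fun _ hy =>
  norm_edgeWeight_right_le hab (uIoc_zero_pi_subset hy).1.le (uIoc_zero_pi_subset hy).2.le

lemma integral_im_bottom_eq (h : StripFunction G Γ c) {a b θ : ℝ} (h0 : 0 < θ)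
    (h1 : θ < Real.pi) :
    ∫ x in a..b, (G (x + θ * Complex.I) * edgeWeight a b (x + θ * Complex.I)).im =
      (∫ y in θ..Real.pi, (G (a + y * Complex.I) * edgeWeight a b (a + y * Complex.I)).re) -
      ∫ y in θ..Real.pi, (G (b + y * Complex.I) * edgeWeight a b (b + y * Complex.I)).re := by
  have hpi := Real.pi_pos
  have hd : ∀ w : ℂ, 0 < w.im → w.im < 2 * Real.pi →
      DifferentiableAt ℂ (fun w => G w * edgeWeight a b w) w := fun w w0 w1 =>
    (h.differentiableAt w w0 w1).mul (differentiable_edgeWeight a b w)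
  have hW : ∀ u : ℝ → ℂ, Continuous u → Continuous fun y => edgeWeight a b (u y) := fun u hu =>
    (differentiable_edgeWeight a b).continuous.comp hu
  have key := Complex.integral_boundary_rect_eq_zero_of_differentiableOn
    (fun w => G w * edgeWeight a b w) (a + θ * Complex.I) (b + Real.pi * Complex.I) (by
      intro w hw
      rw [Complex.mem_reProdIm] at hw
      have := hw.2
      simp only [Complex.add_im, Complex.ofReal_im, Complex.mul_im, Complex.ofReal_re,
        Complex.I_im, mul_one, Complex.I_re, mul_zero, add_zero, zero_add,
        uIcc_of_le h1.le] at this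
      exact (hd w (h0.trans_le this.1) (by linarith [this.2])).differentiableWithinAt)
  simp only [Complex.add_im, Complex.ofReal_im, Complex.mul_im, Complex.ofReal_re,
        Complex.I_im, mul_one, Complex.I_re, mul_zero, add_zero, zero_add, Complex.add_re,
        Complex.mul_re, sub_self] at key
  have hbot : ∀ t : ℝ, 0 < t → t < 2 * Real.pi → IntervalIntegrable (fun x : ℝ =>
      G (x + t * Complex.I) * edgeWeight a b (x + t * Complex.I)) volume a b := fun t t0 t1 =>
    ((h.continuous_horizontal t0 t1).mul (hW _ (by fun_prop))).intervalIntegrable _ _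
  have hside : ∀ x : ℝ, IntervalIntegrable (fun y : ℝ =>
      G (x + y * Complex.I) * edgeWeight a b (x + y * Complex.I)) volume θ Real.pi := fun x => by
    refine ContinuousOn.intervalIntegrable (((h.continuousOn_vertical x).mono ?_).mul
      (hW _ (by fun_prop)).continuousOn)
    rw [uIcc_of_le h1.le]
    exact fun y hy => ⟨h0.trans_le hy.1, by linarith [hy.2]⟩
  have him : ∀ {u : ℝ → ℂ} {p q : ℝ}, IntervalIntegrable u volume p q →
      (∫ x in p..q, u x).im = ∫ x in p..q, (u x).im := fun hu =>
    (Complex.imCLM.intervalIntegral_comp_comm hu).symm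
  have hre : ∀ {u : ℝ → ℂ} {p q : ℝ}, IntervalIntegrable u volume p q →
      (∫ x in p..q, u x).re = ∫ x in p..q, (u x).re := fun hu =>
    (Complex.reCLM.intervalIntegral_comp_comm hu).symm
  have key2 := congrArg Complex.im key
  have htop : ∀ x : ℝ, (G (x + Real.pi * Complex.I) *
      edgeWeight a b (x + Real.pi * Complex.I)).im = 0 := fun x => by
    rw [Complex.mul_im, h.im_eq_zero, im_edgeWeight_add_pi, mul_zero, zero_mul, add_zero]
  simp only [Complex.sub_im, Complex.add_im, smul_eq_mul, Complex.I_mul_im, Complex.zero_im]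
    at key2
  rw [him (hbot θ h0 (by linarith)), him (hbot Real.pi hpi (by linarith)), hre (hside a),
    hre (hside b)] at key2
  simp only [htop, intervalIntegral.integral_zero] at key2
  linarith

lemma integral_boundary_eq (h : StripFunction G Γ c) {a b : ℝ} (hab : a ≤ b) :
    ∫ x in a..b, (Γ x).im * ((1 - Real.exp (x - b)) * (1 - Real.exp (a - x))) =
      (∫ y in 0..Real.pi, (G (a + y * Complex.I) * edgeWeight a b (a + y * Complex.I)).re) -
      ∫ y in 0..Real.pi, (G (b + y * Complex.I) * edgeWeight a b (b + y * Complex.I)).re := by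
  have hsmall : ∀ᶠ θ in 𝓝[>] (0:ℝ), 0 < θ ∧ θ ≤ 1 := by
    filter_upwards [self_mem_nhdsWithin, nhdsWithin_le_nhds (gt_mem_nhds one_pos)]
      with θ h1 h2 using ⟨h1, h2.le⟩
  have hWc : Continuous (edgeWeight a b) := (differentiable_edgeWeight a b).continuous
  obtain ⟨C, hC⟩ := h.exists_norm_le a b hab
  have hleft : Tendsto (fun θ : ℝ =>
      ∫ x in a..b, (G (x + θ * Complex.I) * edgeWeight a b (x + θ * Complex.I)).im) (𝓝[>] 0)
      (𝓝 (∫ x in a..b, (Γ x).im * ((1 - Real.exp (x - b)) * (1 - Real.exp (a - x))))) := by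
    refine intervalIntegral.tendsto_integral_filter_of_dominated_convergence (fun _ => C * 4)
      ?_ ?_ intervalIntegrable_const (.of_forall fun x _ => ?_)
    · filter_upwards [hsmall] with θ hθ
      exact (Complex.continuous_im.comp ((h.continuous_horizontal hθ.1
        (by linarith [hθ.2, Real.pi_gt_three])).mul (hWc.comp (by fun_prop)))).aestronglyMeasurable
    · filter_upwards [hsmall] with θ hθ
      refine .of_forall fun x hx => ?_
      rw [uIoc_of_le hab] at hx
      have hx' : ((x : ℂ) + θ * Complex.I).re ∈ Icc a b := by simpa using ⟨hx.1.le, hx.2⟩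
      refine (Complex.abs_im_le_norm _).trans ?_
      rw [norm_mul]
      have hG := hC _ hx' (by simpa using hθ.1) (by simpa using hθ.2)
      exact mul_le_mul hG (norm_edgeWeight_le hx') (norm_nonneg _) ((norm_nonneg _).trans hG)
    · have hW : Tendsto (fun θ : ℝ => edgeWeight a b (x + θ * Complex.I)) (𝓝[>] 0)
          (𝓝 (edgeWeight a b x)) := by
        have : Continuous fun θ : ℝ => edgeWeight a b (x + θ * Complex.I) :=
          hWc.comp (by fun_prop)
        have := this.tendsto 0
        simp only [Complex.ofReal_zero, zero_mul, add_zero] at this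
        exact this.mono_left nhdsWithin_le_nhds
      have := (Complex.continuous_im.tendsto _).comp ((h.tendsto_boundary x).mul hW)
      rwa [edgeWeight_ofReal, Complex.im_mul_ofReal] at this
  have hside : ∀ x : ℝ, (∀ y ∈ uIoc 0 Real.pi,
      ‖edgeWeight a b (x + y * Complex.I)‖ ≤ 4 * Real.sin (y / 2)) →
      Tendsto (fun θ : ℝ => ∫ y in θ..Real.pi,
        (G (x + y * Complex.I) * edgeWeight a b (x + y * Complex.I)).re) (𝓝[>] 0)
      (𝓝 (∫ y in 0..Real.pi,
        (G (x + y * Complex.I) * edgeWeight a b (x + y * Complex.I)).re)) := fun x hx => by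
    have hi := h.intervalIntegrable_vertical hx
    rw [intervalIntegrable_iff_integrableOn_Icc_of_le Real.pi_pos.le,
      ← uIcc_of_le Real.pi_pos.le] at hi
    have h2 := intervalIntegral.continuousOn_primitive_interval_left hi 0 left_mem_uIcc
    refine h2.tendsto.mono_left (nhdsWithin_le_iff.2 ?_)
    rw [uIcc_of_le Real.pi_pos.le]
    exact mem_of_superset (Ioo_mem_nhdsGT Real.pi_pos) Ioo_subset_Icc_self
  refine tendsto_nhds_unique hleft (((hside a (norm_left_le hab)).sub
    (hside b (norm_right_le hab))).congr' ?_)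
  filter_upwards [hsmall] with θ hθ
  exact (h.integral_im_bottom_eq hθ.1 (by linarith [hθ.2, Real.pi_gt_three])).symm

lemma tendsto_integral_left (h : StripFunction G Γ c) :
    Tendsto (fun n : ℕ => ∫ y in 0..Real.pi, (G ((-n : ℝ) + y * Complex.I) *
      edgeWeight (-n) n ((-n : ℝ) + y * Complex.I)).re) atTop (𝓝 0) := by
  have hn : ∀ n : ℕ, (-n : ℝ) ≤ n := fun n => by linarith [n.cast_nonneg (α := ℝ)]
  have := intervalIntegral.tendsto_integral_filter_of_dominated_convergence
    (μ := volume) (a := 0) (b := Real.pi) (f := fun _ => (0:ℝ)) (l := atTop)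
    (F := fun (n : ℕ) (y : ℝ) => (G ((-n : ℝ) + y * Complex.I) *
      edgeWeight (-n) n ((-n : ℝ) + y * Complex.I)).re) (fun _ => 4 * c)
    (.of_forall fun n => h.aestronglyMeasurable_vertical _ _ _)
    (.of_forall fun n => .of_forall fun y hy => h.abs_re_mul_le hy (norm_left_le (hn n) y hy))
    intervalIntegrable_const (.of_forall fun y hy => ?_)
  · simpa using this
  have hy' := uIoc_zero_pi_subset hy
  have h1 := ((h.tendsto_atBot y hy'.1 hy'.2).comp
    (tendsto_neg_atTop_atBot.comp (tendsto_natCast_atTop_atTop (R := ℝ)))).norm.mul_const 4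
  simp only [Function.comp_def, norm_zero, zero_mul] at h1
  refine squeeze_zero_norm (fun n => (Complex.abs_re_le_norm _).trans ?_) h1
  rw [norm_mul]
  exact mul_le_mul_of_nonneg_left (norm_edgeWeight_le (by simp [hn n])) (norm_nonneg _)

lemma tendsto_integral_right (h : StripFunction G Γ c) :
    Tendsto (fun n : ℕ => ∫ y in 0..Real.pi, (G ((n : ℝ) + y * Complex.I) *
      edgeWeight (-n) n ((n : ℝ) + y * Complex.I)).re) atTop (𝓝 (-(Real.pi * c))) := by
  have hn : ∀ n : ℕ, (-n : ℝ) ≤ n := fun n => by linarith [n.cast_nonneg (α := ℝ)]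
  have := intervalIntegral.tendsto_integral_filter_of_dominated_convergence
    (μ := volume) (a := 0) (b := Real.pi) (f := fun y => -c * (1 - Real.cos y)) (l := atTop)
    (F := fun (n : ℕ) (y : ℝ) => (G ((n : ℝ) + y * Complex.I) *
      edgeWeight (-n) n ((n : ℝ) + y * Complex.I)).re) (fun _ => 4 * c)
    (.of_forall fun n => h.aestronglyMeasurable_vertical _ _ _)
    (.of_forall fun n => .of_forall fun y hy => h.abs_re_mul_le hy (norm_right_le (hn n) y hy))
    intervalIntegrable_const (.of_forall fun y hy => ?_)
  · have e : ∫ y in 0..Real.pi, -c * (1 - Real.cos y) = -(Real.pi * c) := by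
      rw [intervalIntegral.integral_const_mul, intervalIntegral.integral_sub
        intervalIntegrable_const (Real.continuous_cos.intervalIntegrable _ _), integral_cos]
      simp
      ring
    rwa [e] at this
  have hy' := uIoc_zero_pi_subset hy
  have h1 := (h.tendsto_atTop y hy'.1 hy'.2).comp (tendsto_natCast_atTop_atTop (R := ℝ))
  have h2 : Tendsto (fun n : ℕ => Complex.exp ((-n : ℝ) - ((n : ℝ) + y * Complex.I))) atTop
      (𝓝 0) := by
    rw [Complex.tendsto_exp_nhds_zero_iff]
    have : Tendsto (fun n : ℕ => (-2 : ℝ) * (n : ℝ)) atTop atBot :=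
      tendsto_natCast_atTop_atTop.const_mul_atTop_of_neg (by norm_num)
    refine this.congr fun n => ?_
    simp
    ring
  have h3 : Tendsto (fun n : ℕ => edgeWeight (-n) n ((n : ℝ) + y * Complex.I)) atTop
      (𝓝 ((1 - Complex.exp (y * Complex.I)) * (1 - 0))) := by
    simp only [edgeWeight, add_sub_cancel_left]
    exact (h2.const_sub 1).const_mul _
  have h4 := (Complex.continuous_re.tendsto _).comp (h1.mul h3)
  have e : (-(c : ℂ) * ((1 - Complex.exp (y * Complex.I)) * (1 - 0))).re =
      -c * (1 - Real.cos y) := by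
    rw [sub_zero, mul_one, ← Complex.ofReal_neg, Complex.re_ofReal_mul, Complex.sub_re,
      Complex.one_re, Complex.exp_ofReal_mul_I_re]
  rw [e] at h4
  exact h4

lemma measurable_boundary (h : StripFunction G Γ c) : Measurable fun x => (Γ x).im := by
  have hlim : Tendsto (fun n : ℕ => 1 / ((n : ℝ) + 1)) atTop (𝓝[>] 0) :=
    tendsto_nhdsWithin_iff.2 ⟨tendsto_one_div_add_atTop_nhds_zero_nat,
      .of_forall fun n => mem_Ioi.2 Nat.one_div_pos_of_nat⟩
  refine Complex.measurable_im.comp (measurable_of_tendsto_metrizable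
    (f := fun (n : ℕ) (x : ℝ) => G (x + ((1 / ((n : ℝ) + 1) : ℝ) : ℂ) * Complex.I))
    (fun n => (h.continuous_horizontal Nat.one_div_pos_of_nat ?_).measurable)
    (tendsto_pi_nhds.2 fun x => (h.tendsto_boundary x).comp hlim))
  have : 1 / ((n : ℝ) + 1) ≤ 1 := by
    rw [div_le_one (by positivity)]; linarith [n.cast_nonneg (α := ℝ)]
  linarith [Real.pi_gt_three]

lemma exists_abs_im_boundary_le (h : StripFunction G Γ c) {a b : ℝ} (hab : a ≤ b) :
    ∃ C, ∀ x ∈ Icc a b, |(Γ x).im| ≤ C := by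
  obtain ⟨C, hC⟩ := h.exists_norm_le a b hab
  refine ⟨C, fun x hx => (Complex.abs_im_le_norm _).trans ?_⟩
  refine le_of_tendsto (h.tendsto_boundary x).norm ?_
  filter_upwards [self_mem_nhdsWithin, nhdsWithin_le_nhds (gt_mem_nhds one_pos)] with θ h1 h2
  exact hC _ (by simpa using hx) (by simpa using h1) (by simpa using h2.le)

theorem integrable_boundary (h : StripFunction G Γ c) (hc : 0 ≤ c) :
    Integrable (fun x => (Γ x).im) ∧ ∫ x, (Γ x).im = Real.pi * c := by
  set w : ℕ → ℝ → ℝ := fun n x => max 0 (1 - Real.exp (x - n)) * max 0 (1 - Real.exp (-n - x))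
    with hw
  have hw0 : ∀ n x, 0 ≤ w n x := fun n x => mul_nonneg (le_max_left _ _) (le_max_left _ _)
  have hwc : ∀ n, Continuous (w n) := fun n => by simp only [hw]; fun_prop
  have hn : ∀ n : ℕ, (-n : ℝ) ≤ n := fun n => by linarith [n.cast_nonneg (α := ℝ)]
  have hwin : ∀ (n : ℕ), ∀ x ∈ Icc (-n : ℝ) n,
      w n x = (1 - Real.exp (x - n)) * (1 - Real.exp (-n - x)) := fun n x hx => by
    simp only [hw]
    rw [max_eq_right, max_eq_right]
    · linarith [Real.exp_le_one_iff.2 (by linarith [hx.1] : -(n : ℝ) - x ≤ 0)]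
    · linarith [Real.exp_le_one_iff.2 (by linarith [hx.2] : x - (n : ℝ) ≤ 0)]
  have hwout : ∀ (n : ℕ), ∀ x ∉ Icc (-n : ℝ) n, w n x = 0 := fun n x hx => by
    simp only [hw]
    rw [mem_Icc, not_and_or, not_le, not_le] at hx
    rcases hx with hx | hx
    · rw [max_eq_left (b := 1 - Real.exp (-n - x)), mul_zero]
      linarith [Real.one_le_exp (by linarith : 0 ≤ -(n : ℝ) - x)]
    · rw [max_eq_left, zero_mul]
      linarith [Real.one_le_exp (by linarith : 0 ≤ x - (n : ℝ))]
  have hmono : ∀ x, Monotone fun n => w n x := fun x m n hmn => by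
    have hmn' : (m : ℝ) ≤ n := by exact_mod_cast hmn
    simp only [hw]
    gcongr
  have hlim : ∀ x, Tendsto (fun n => w n x) atTop (𝓝 1) := fun x => by
    have h1 : Tendsto (fun n : ℕ => Real.exp (x - n)) atTop (𝓝 0) :=
      Real.tendsto_exp_atBot.comp (tendsto_atBot_add_const_left _ x
        (tendsto_neg_atTop_atBot.comp tendsto_natCast_atTop_atTop))
    have h2 : Tendsto (fun n : ℕ => Real.exp (-n - x)) atTop (𝓝 0) :=
      Real.tendsto_exp_atBot.comp (tendsto_atBot_add_const_right _ (-x)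
        (tendsto_neg_atTop_atBot.comp tendsto_natCast_atTop_atTop))
    have := ((tendsto_const_nhds (x := (0:ℝ))).max (h1.const_sub 1)).mul
      ((tendsto_const_nhds (x := (0:ℝ))).max (h2.const_sub 1))
    simpa using this
  have hmeas := h.measurable_boundary
  have hL1 : Tendsto (fun n => ∫⁻ x, ENNReal.ofReal ((Γ x).im * w n x)) atTop
      (𝓝 (∫⁻ x, ENNReal.ofReal (Γ x).im)) := by
    refine lintegral_tendsto_of_tendsto_of_monotone
      (fun n => (hmeas.mul (hwc n).measurable).ennreal_ofReal.aemeasurable)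
      (.of_forall fun x m n hmn => ENNReal.ofReal_le_ofReal
        (mul_le_mul_of_nonneg_left (hmono x hmn) (h.boundary_nonneg x)))
      (.of_forall fun x => ENNReal.tendsto_ofReal ?_)
    simpa using (hlim x).const_mul (Γ x).im
  have hval : ∀ n : ℕ, ∫⁻ x, ENNReal.ofReal ((Γ x).im * w n x) = ENNReal.ofReal
      ((∫ y in 0..Real.pi, (G ((-n : ℝ) + y * Complex.I) *
        edgeWeight (-n) n ((-n : ℝ) + y * Complex.I)).re) -
      ∫ y in 0..Real.pi, (G ((n : ℝ) + y * Complex.I) *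
        edgeWeight (-n) n ((n : ℝ) + y * Complex.I)).re) := fun n => by
    rw [← h.integral_boundary_eq (hn n), intervalIntegral.integral_of_le (hn n),
      ← integral_Icc_eq_integral_Ioc]
    have e1 : ∫ x in Icc (-n : ℝ) n, (Γ x).im *
        ((1 - Real.exp (x - n)) * (1 - Real.exp (-n - x))) =
        ∫ x in Icc (-n : ℝ) n, (Γ x).im * w n x :=
      setIntegral_congr_fun measurableSet_Icc fun x hx => by simp only [hwin n x hx]
    rw [e1, ofReal_integral_eq_lintegral_ofReal, ← lintegral_indicator measurableSet_Icc]
    · refine lintegral_congr fun x => ?_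
      by_cases hx : x ∈ Icc (-n : ℝ) n
      · rw [indicator_of_mem hx]
      · rw [indicator_of_notMem hx, hwout n x hx, mul_zero, ENNReal.ofReal_zero]
    · obtain ⟨C, hC⟩ := h.exists_abs_im_boundary_le (hn n)
      refine Integrable.mono' (integrableOn_const (C := C * 1) (by simp))
        (hmeas.mul (hwc n).measurable).aestronglyMeasurable
        ((ae_restrict_iff' measurableSet_Icc).2 (.of_forall fun x hx => ?_))
      rw [norm_mul, Real.norm_of_nonneg (hw0 n x)]
      exact mul_le_mul (hC x hx) ((hmono x).ge_of_tendsto (hlim x) n) (hw0 n x)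
        ((abs_nonneg _).trans (hC x hx))
    · exact .of_forall fun x => mul_nonneg (h.boundary_nonneg x) (hw0 n x)
  have hL2 : Tendsto (fun n => ∫⁻ x, ENNReal.ofReal ((Γ x).im * w n x)) atTop
      (𝓝 (ENNReal.ofReal (Real.pi * c))) := by
    simp only [hval]
    have := ENNReal.tendsto_ofReal (h.tendsto_integral_left.sub h.tendsto_integral_right)
    rwa [zero_sub, neg_neg] at this
  have heq := tendsto_nhds_unique hL1 hL2
  have hnn : 0 ≤ᵐ[volume] fun x => (Γ x).im := .of_forall h.boundary_nonneg
  refine ⟨⟨hmeas.aestronglyMeasurable, ?_⟩, ?_⟩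
  · rw [hasFiniteIntegral_iff_ofReal hnn, heq]
    exact ENNReal.ofReal_lt_top
  · rw [integral_eq_lintegral_of_nonneg_ae hnn hmeas.aestronglyMeasurable, heq,
      ENNReal.toReal_ofReal (mul_nonneg Real.pi_pos.le hc)]

end StripFunction

namespace RegularSymbol

variable {Ψ Ψ' Ψ'' f f' g g' : ℝ → ℝ} {B B' : ℝ}

lemma tendsto_resolventIntegral (hΨ : RegularSymbol Ψ Ψ' Ψ'') (hf : BoundedC1 f f' B)
    {lam k x : ℝ} (hlam : lam ∈ Ioi (0:ℝ)) (hx : Ψ lam = Real.exp x)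
    (hk : Tendsto (fun ε : ℝ => -(Real.pi)⁻¹ * ∫ ζ in Ioi (0:ℝ) \ Icc (lam - ε) (lam + ε),
        f ζ * (Ψ' lam / (Ψ lam - Ψ ζ))) (𝓝[>] 0) (𝓝 k)) :
    Tendsto (fun θ : ℝ => resolventIntegral Ψ f (Complex.exp (x + θ * Complex.I))) (𝓝[>] 0)
        (𝓝 (((Real.pi / Ψ' lam : ℝ) : ℂ) * (k + f lam * Complex.I))) := by
  obtain ⟨k', h1, h2⟩ := hΨ.exists_boundary_value hf hlam
  rw [hx, Real.log_exp] at h2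
  rw [hx] at hk h1
  rwa [tendsto_nhds_unique hk h1]

lemma resolventIntegral_add_mul (hΨ : RegularSymbol Ψ Ψ' Ψ'') (hf : BoundedC1 f f' B)
    (hg : BoundedC1 g g' B') (s : ℝ) {w : ℂ} (h0 : 0 < w.im) (h1 : w.im < 2 * Real.pi) :
    resolventIntegral Ψ (fun ζ => f ζ + s * g ζ) (Complex.exp w) =
      resolventIntegral Ψ f (Complex.exp w) + s * resolventIntegral Ψ g (Complex.exp w) := by
  simp only [resolventIntegral]
  rw [← integral_const_mul, ← integral_add (hΨ.integrableOn_div_sub_exp hf h0 h1)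
    ((hΨ.integrableOn_div_sub_exp hg h0 h1).const_mul _)]
  congr 1
  ext ζ
  push_cast
  ring

lemma _root_.BoundedC1.add_mul (hf : BoundedC1 f f' B) (hg : BoundedC1 g g' B') (s : ℝ) :
    BoundedC1 (fun ζ => f ζ + s * g ζ) (fun ζ => f' ζ + s * g' ζ) (B + |s| * B') where
  hasDerivAt ζ hζ := (hf.hasDerivAt ζ hζ).add ((hg.hasDerivAt ζ hζ).const_mul s)
  continuousOn_deriv := hf.continuousOn_deriv.add (hg.continuousOn_deriv.const_mul s)
  abs_le ζ hζ := (abs_add_le _ _).trans (add_le_add (hf.abs_le ζ hζ) (by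
    rw [abs_mul]; exact mul_le_mul_of_nonneg_left (hg.abs_le ζ hζ) (abs_nonneg s)))

lemma tendsto_principalValue_add_mul (hΨ : RegularSymbol Ψ Ψ' Ψ'') (hf : BoundedC1 f f' B)
    (hg : BoundedC1 g g' B') (s : ℝ) {lam k l : ℝ} (hlam : lam ∈ Ioi (0:ℝ))
    (hk : Tendsto (fun ε : ℝ => -(Real.pi)⁻¹ * ∫ ζ in Ioi (0:ℝ) \ Icc (lam - ε) (lam + ε),
        f ζ * (Ψ' lam / (Ψ lam - Ψ ζ))) (𝓝[>] 0) (𝓝 k))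
    (hl : Tendsto (fun ε : ℝ => -(Real.pi)⁻¹ * ∫ ζ in Ioi (0:ℝ) \ Icc (lam - ε) (lam + ε),
        g ζ * (Ψ' lam / (Ψ lam - Ψ ζ))) (𝓝[>] 0) (𝓝 l)) :
    Tendsto (fun ε : ℝ => -(Real.pi)⁻¹ * ∫ ζ in Ioi (0:ℝ) \ Icc (lam - ε) (lam + ε),
        (f ζ + s * g ζ) * (Ψ' lam / (Ψ lam - Ψ ζ))) (𝓝[>] 0) (𝓝 (k + s * l)) := by
  have hx := (Real.exp_log (hΨ.pos lam hlam)).symm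
  obtain ⟨m, h1, h2⟩ := hΨ.exists_boundary_value (hf.add_mul hg s) hlam
  have h3 := (hΨ.tendsto_resolventIntegral hf hlam hx hk).add
    ((hΨ.tendsto_resolventIntegral hg hlam hx hl).const_mul (s : ℂ))
  have h4 := tendsto_nhds_unique h2 (h3.congr' ?_)
  · have h5 := congrArg Complex.re h4
    have h6 : (Real.pi / Ψ' lam) * m = (Real.pi / Ψ' lam) * (k + s * l) := by
      simp at h5
      linear_combination h5
    rwa [← mul_left_cancel₀ (div_pos Real.pi_pos (hΨ.deriv_pos lam hlam)).ne' h6]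
  · filter_upwards [self_mem_nhdsWithin, nhdsWithin_le_nhds (gt_mem_nhds Real.pi_pos)]
      with θ h5 h6
    exact (hΨ.resolventIntegral_add_mul hf hg s (by simpa using h5)
      (by simp; linarith [Real.pi_pos])).symm

lemma im_schur_boundary (f K k k₂ t : ℝ) :
    ((t : ℂ) * (k₂ + (f ^ 2 : ℝ) * Complex.I) -
      ((t : ℂ) * (k + f * Complex.I)) ^ 2 / ((t : ℂ) * (K + (1 : ℝ) * Complex.I))).im =
      t * ((K * f - k) ^ 2 / (1 + K ^ 2)) := by
  have hK : 1 + K ^ 2 ≠ 0 := by positivity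
  rcases eq_or_ne t 0 with rfl | ht
  · simp
  have ht' : (t : ℂ) ≠ 0 := by exact_mod_cast ht
  have h1 : (K : ℂ) + (1 : ℝ) * Complex.I ≠ 0 := fun h => by
    simpa using congrArg Complex.im h
  have h2 : ((t : ℂ) * (k + f * Complex.I)) ^ 2 / ((t : ℂ) * (K + (1 : ℝ) * Complex.I)) =
      ((t / (1 + K ^ 2) : ℝ) : ℂ) * ((k + f * Complex.I) ^ 2 * (K - Complex.I)) := by
    have h3 : ((1 + K ^ 2 : ℝ) : ℂ) = (K + (1 : ℝ) * Complex.I) * (K - Complex.I) := by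
      push_cast
      linear_combination Complex.I_sq
    have h4 : ((1 + K ^ 2 : ℝ) : ℂ) ≠ 0 := by exact_mod_cast hK
    rw [Complex.ofReal_div, div_mul_eq_mul_div, div_eq_div_iff (mul_ne_zero ht' h1) h4, h3]
    ring
  rw [h2, Complex.sub_im, Complex.im_ofReal_mul, Complex.im_ofReal_mul]
  have h5 : ((k + f * Complex.I) ^ 2 * (K - Complex.I) : ℂ).im =
      2 * k * f * K - (k ^ 2 - f ^ 2) := by
    simp [sq]
    ring
  rw [h5, Complex.add_im, Complex.ofReal_im, Complex.im_ofReal_mul, Complex.I_im]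
  field_simp
  ring

lemma resolventIntegral_neg (Ψ f : ℝ → ℝ) (r : ℝ) :
    resolventIntegral Ψ f ((-r : ℝ) : ℂ) =
      ((∫ ζ in Ioi (0:ℝ), f ζ / (Ψ ζ - -r) : ℝ) : ℂ) := by
  rw [resolventIntegral, ← integral_complex_ofReal]
  simp

lemma stripFunction (hΨ : RegularSymbol Ψ Ψ' Ψ'') (hf : BoundedC1 f f' B)
    (hfi : IntegrableOn f (Ioi 0)) (hf2 : IntegrableOn (fun ζ => f ζ ^ 2) (Ioi 0))
    {Γ : ℝ → ℂ} (hlim : ∀ x : ℝ, Tendsto (fun θ : ℝ => Complex.exp (x + θ * Complex.I) *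
      schurComplement Ψ f (Complex.exp (x + θ * Complex.I))) (𝓝[>] 0) (𝓝 (Γ x)))
    (hnn : ∀ x, 0 ≤ (Γ x).im) :
    StripFunction (fun w => Complex.exp w * schurComplement Ψ f (Complex.exp w)) Γ
      (∫ ζ in Ioi (0:ℝ), f ζ ^ 2) where
  differentiableAt w h0 h1 := Complex.differentiableAt_exp.mul
    (DifferentiableAt.comp w (hΨ.differentiableAt_schurComplement hf h0 h1)
      Complex.differentiableAt_exp)
  norm_mul_sin_le w h0 h1 := hΨ.norm_exp_mul_schurComplement_mul_le hf hf2 h0 h1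
  exists_norm_le x₀ x₁ h := by
    obtain ⟨C, hC⟩ := hΨ.exists_norm_schurComplement_le hf h
    refine ⟨Real.exp x₁ * C, fun w hw h0 h1 => ?_⟩
    rw [norm_mul, Complex.norm_exp]
    exact mul_le_mul (Real.exp_le_exp.2 hw.2) (hC w hw h0 h1) (norm_nonneg _)
      (Real.exp_pos _).le
  im_eq_zero x := by
    have h : Complex.exp (x + Real.pi * Complex.I) = ((-Real.exp x : ℝ) : ℂ) := by
      rw [Complex.exp_add, Complex.exp_pi_mul_I]; simp
    simp only [h, schurComplement, resolventIntegral_neg]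
    rw [← Complex.ofReal_pow, ← Complex.ofReal_div, ← Complex.ofReal_sub, ← Complex.ofReal_mul,
      Complex.ofReal_im]
  tendsto_boundary := hlim
  boundary_nonneg := hnn
  tendsto_atBot θ h0 h1 := hΨ.tendsto_exp_mul_schurComplement_atBot hf hf2 h0 h1
  tendsto_atTop θ h0 h1 := hΨ.tendsto_exp_mul_schurComplement_atTop hf hfi hf2 h0 h1

theorem integral_sq_boundary (hΨ : RegularSymbol Ψ Ψ' Ψ'') (hf : BoundedC1 f f' B)
    (hfi : IntegrableOn f (Ioi 0)) (hf2 : IntegrableOn (fun ζ => f ζ ^ 2) (Ioi 0))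
    {K k : ℝ → ℝ}
    (hK : ∀ lam ∈ Ioi (0:ℝ), Tendsto (fun ε : ℝ => -(Real.pi)⁻¹ *
      ∫ ζ in Ioi (0:ℝ) \ Icc (lam - ε) (lam + ε), 1 * (Ψ' lam / (Ψ lam - Ψ ζ)))
        (𝓝[>] 0) (𝓝 (K lam)))
    (hk : ∀ lam ∈ Ioi (0:ℝ), Tendsto (fun ε : ℝ => -(Real.pi)⁻¹ *
      ∫ ζ in Ioi (0:ℝ) \ Icc (lam - ε) (lam + ε), f ζ * (Ψ' lam / (Ψ lam - Ψ ζ)))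
        (𝓝[>] 0) (𝓝 (k lam))) :
    IntegrableOn (fun lam => (K lam * f lam - k lam) ^ 2 / (1 + K lam ^ 2)) (Ioi 0) ∧
    ∫ lam in Ioi (0:ℝ), (K lam * f lam - k lam) ^ 2 / (1 + K lam ^ 2) =
      ∫ ζ in Ioi (0:ℝ), f ζ ^ 2 := by
  choose φ hφ0 hφ using fun x => hΨ.exists_apply_eq (Real.exp_pos x)
  choose! k₂ hk₂ _ using fun lam hlam => hΨ.exists_boundary_value hf.sq (lam := lam) hlam
  set J := fun lam => (K lam * f lam - k lam) ^ 2 / (1 + K lam ^ 2) with hJ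
  have hJ0 : ∀ lam, 0 ≤ J lam := fun lam => by simp only [hJ]; positivity
  set Γ : ℝ → ℂ := fun x => (Real.exp x : ℂ) *
    (((Real.pi / Ψ' (φ x) : ℝ) : ℂ) * (k₂ (φ x) + (f (φ x) ^ 2 : ℝ) * Complex.I) -
      (((Real.pi / Ψ' (φ x) : ℝ) : ℂ) * (k (φ x) + f (φ x) * Complex.I)) ^ 2 /
      (((Real.pi / Ψ' (φ x) : ℝ) : ℂ) * (K (φ x) + (1 : ℝ) * Complex.I))) with hΓ
  have him : ∀ x, (Γ x).im = Real.exp x * (Real.pi / Ψ' (φ x) * J (φ x)) := fun x => by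
    simp only [hΓ, Complex.im_ofReal_mul, im_schur_boundary, hJ]
  have hlim : ∀ x : ℝ, Tendsto (fun θ : ℝ => Complex.exp (x + θ * Complex.I) *
      schurComplement Ψ f (Complex.exp (x + θ * Complex.I))) (𝓝[>] 0) (𝓝 (Γ x)) := fun x => by
    have hd := hΨ.deriv_pos _ (hφ0 x)
    refine (tendsto_exp_add_mul_I x).mul
      ((hΨ.tendsto_resolventIntegral hf.sq (hφ0 x) (hφ x) (hk₂ _ (hφ0 x))).sub
      (((hΨ.tendsto_resolventIntegral hf (hφ0 x) (hφ x) (hk _ (hφ0 x))).pow 2).div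
      (hΨ.tendsto_resolventIntegral BoundedC1.one (hφ0 x) (hφ x) (hK _ (hφ0 x))) ?_))
    refine mul_ne_zero (by exact_mod_cast (div_pos Real.pi_pos hd).ne') fun h => ?_
    simpa using congrArg Complex.im h
  have hnn : ∀ x, 0 ≤ (Γ x).im := fun x => by
    have hd := hΨ.deriv_pos _ (hφ0 x)
    have := hJ0 (φ x)
    rw [him]
    positivity
  obtain ⟨hint, hval⟩ := (hΨ.stripFunction hf hfi hf2 hlim hnn).integrable_boundary
    (integral_nonneg fun ζ => sq_nonneg _)
  have himage : (fun lam => Real.log (Ψ lam)) '' Ioi 0 = univ :=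
    eq_univ_of_forall fun x => ⟨φ x, hφ0 x, by simp only [hφ, Real.log_exp]⟩
  have hinj : InjOn (fun lam => Real.log (Ψ lam)) (Ioi 0) := fun a ha b hb hab =>
    hΨ.mono.injOn ha hb (Real.log_injOn_pos (hΨ.pos a ha) (hΨ.pos b hb) hab)
  have hder : ∀ lam ∈ Ioi (0:ℝ), HasDerivWithinAt (fun lam => Real.log (Ψ lam))
      (Ψ' lam / Ψ lam) (Ioi 0) lam := fun lam hlam =>
    ((hΨ.hasDerivAt lam hlam).log (hΨ.pos lam hlam).ne').hasDerivWithinAt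
  have hcongr : ∀ lam ∈ Ioi (0:ℝ),
      |Ψ' lam / Ψ lam| • (Γ (Real.log (Ψ lam))).im = Real.pi * J lam := fun lam hlam => by
    have hp := hΨ.pos lam hlam
    have hd := hΨ.deriv_pos lam hlam
    have : φ (Real.log (Ψ lam)) = lam :=
      hΨ.mono.injOn (hφ0 _) hlam (by rw [hφ, Real.exp_log hp])
    rw [him, this, Real.exp_log hp, abs_of_pos (div_pos hd hp), smul_eq_mul]
    field_simp
  have hI := (integrableOn_image_iff_integrableOn_abs_deriv_smul measurableSet_Ioi hder hinj
    (fun x => (Γ x).im)).1 hint.integrableOn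
  have hE := integral_image_eq_integral_abs_deriv_smul measurableSet_Ioi hder hinj
    (fun x => (Γ x).im)
  rw [himage, setIntegral_univ, hval, setIntegral_congr_fun measurableSet_Ioi hcongr,
    integral_const_mul] at hE
  have hI2 := hI.congr_fun hcongr measurableSet_Ioi
  refine ⟨?_, (mul_left_cancel₀ Real.pi_ne_zero hE).symm⟩
  exact IntegrableOn.congr_fun (hI2.const_mul Real.pi⁻¹)
    (fun lam _ => inv_mul_cancel_left₀ Real.pi_ne_zero _) measurableSet_Ioi

end RegularSymbol

section Lorentzian

variable {ξ ξ₁ ξ₂ : ℝ}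

lemma hasDerivAt_lorentzian (hξ : 0 < ξ) (ζ : ℝ) :
    HasDerivAt (fun ζ => ξ ^ 2 / (ξ ^ 2 + ζ ^ 2)) (-(2 * ξ ^ 2 * ζ) / (ξ ^ 2 + ζ ^ 2) ^ 2) ζ := by
  have h0 : ξ ^ 2 + ζ ^ 2 ≠ 0 := by positivity
  have h := (hasDerivAt_const ζ (ξ ^ 2)).div (((hasDerivAt_id ζ).pow 2).const_add (ξ ^ 2)) h0
  refine h.congr_deriv ?_
  simp
  ring

lemma boundedC1_lorentzian (hξ : 0 < ξ) :
    BoundedC1 (fun ζ => ξ ^ 2 / (ξ ^ 2 + ζ ^ 2))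
      (fun ζ => -(2 * ξ ^ 2 * ζ) / (ξ ^ 2 + ζ ^ 2) ^ 2) 1 where
  hasDerivAt ζ _ := hasDerivAt_lorentzian hξ ζ
  continuousOn_deriv := Continuous.continuousOn <|
    Continuous.div (by fun_prop) (by fun_prop) fun ζ => by positivity
  abs_le ζ _ := by
    rw [abs_of_nonneg (by positivity)]
    exact div_le_one_of_le₀ (by nlinarith [sq_nonneg ζ]) (by positivity)

lemma integrable_lorentzian (hξ : 0 < ξ) : Integrable (fun ζ : ℝ => ξ ^ 2 / (ξ ^ 2 + ζ ^ 2)) := by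
  refine (integrable_inv_one_add_sq.comp_div hξ.ne').congr (ae_of_all _ fun ζ => ?_)
  have h0 : ξ ^ 2 + ζ ^ 2 ≠ 0 := by positivity
  simp only
  field_simp

lemma integral_lorentzian (hξ : 0 < ξ) :
    ∫ ζ in Ioi (0:ℝ), ξ ^ 2 / (ξ ^ 2 + ζ ^ 2) = Real.pi / 2 * ξ := by
  have h := integral_comp_mul_left_Ioi (fun x : ℝ => (1 + x ^ 2)⁻¹) 0 (inv_pos.2 hξ)
  rw [mul_zero, integral_Ioi_inv_one_add_sq, Real.arctan_zero, inv_inv, smul_eq_mul] at h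
  have h2 : ∀ ζ : ℝ, (1 + (ξ⁻¹ * ζ) ^ 2)⁻¹ = ξ ^ 2 / (ξ ^ 2 + ζ ^ 2) := fun ζ => by
    have h0 : ξ ^ 2 + ζ ^ 2 ≠ 0 := by positivity
    field_simp
  simp only [h2] at h
  rw [h]
  ring

lemma integrable_lorentzian_mul (h₁ : 0 < ξ₁) (h₂ : 0 < ξ₂) :
    Integrable (fun ζ : ℝ => ξ₁ ^ 2 / (ξ₁ ^ 2 + ζ ^ 2) * (ξ₂ ^ 2 / (ξ₂ ^ 2 + ζ ^ 2))) := by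
  refine (integrable_lorentzian h₁).mul_bdd (c := 1)
    (integrable_lorentzian h₂).aestronglyMeasurable (ae_of_all _ fun ζ => ?_)
  rw [Real.norm_of_nonneg (by positivity)]
  exact div_le_one_of_le₀ (by nlinarith [sq_nonneg ζ]) (by positivity)

lemma tendsto_mul_lorentzian (hξ : 0 < ξ) :
    Tendsto (fun ζ : ℝ => ζ * (ξ ^ 2 / (ξ ^ 2 + ζ ^ 2))) atTop (𝓝 0) := by
  have h : Tendsto (fun ζ : ℝ => ξ ^ 2 / ζ) atTop (𝓝 0) := tendsto_id.const_div_atTop _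
  refine squeeze_zero' ?_ ?_ h
  · filter_upwards [eventually_ge_atTop 0] with ζ hζ
    positivity
  · filter_upwards [eventually_gt_atTop 0] with ζ hζ
    rw [mul_div_assoc', div_le_div_iff₀ (by positivity) hζ]
    nlinarith [pow_pos hξ 4]

lemma integral_lorentzian_sq (hξ : 0 < ξ) :
    ∫ ζ in Ioi (0:ℝ), ξ ^ 2 / (ξ ^ 2 + ζ ^ 2) * (ξ ^ 2 / (ξ ^ 2 + ζ ^ 2)) =
      Real.pi / 4 * ξ := by
  have hI := (integrable_lorentzian hξ).integrableOn (s := Ioi 0)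
  have hII := (integrable_lorentzian_mul hξ hξ).integrableOn (s := Ioi 0)
  have h := integral_Ioi_of_hasDerivAt_of_tendsto' (a := 0)
    (f := fun ζ : ℝ => ζ * (ξ ^ 2 / (ξ ^ 2 + ζ ^ 2)))
    (f' := fun ζ => 2 * (ξ ^ 2 / (ξ ^ 2 + ζ ^ 2) * (ξ ^ 2 / (ξ ^ 2 + ζ ^ 2))) -
      ξ ^ 2 / (ξ ^ 2 + ζ ^ 2)) (fun ζ _ => ?_) (by exact (hII.const_mul 2).sub hI)
    (tendsto_mul_lorentzian hξ)
  · rw [integral_sub (hII.const_mul 2) hI, integral_const_mul, integral_lorentzian hξ] at h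
    linarith
  · have h0 : ξ ^ 2 + ζ ^ 2 ≠ 0 := by positivity
    refine ((hasDerivAt_id ζ).mul (hasDerivAt_lorentzian hξ ζ)).congr_deriv ?_
    simp only [id]
    field_simp
    ring

lemma integral_lorentzian_mul (h₁ : 0 < ξ₁) (h₂ : 0 < ξ₂) :
    ∫ ζ in Ioi (0:ℝ), ξ₁ ^ 2 / (ξ₁ ^ 2 + ζ ^ 2) * (ξ₂ ^ 2 / (ξ₂ ^ 2 + ζ ^ 2)) =
      Real.pi / 2 * (ξ₁ * ξ₂ / (ξ₁ + ξ₂)) := by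
  rcases eq_or_ne ξ₁ ξ₂ with rfl | hne
  · rw [integral_lorentzian_sq h₁]
    field_simp
    norm_num
  have hs : ξ₁ + ξ₂ ≠ 0 := by positivity
  have hd : ξ₂ - ξ₁ ≠ 0 := sub_ne_zero.2 hne.symm
  have hq : ξ₂ ^ 2 - ξ₁ ^ 2 ≠ 0 := by
    rw [sq_sub_sq]
    exact mul_ne_zero (by positivity) hd
  have h : ∀ ζ : ℝ, ξ₁ ^ 2 / (ξ₁ ^ 2 + ζ ^ 2) * (ξ₂ ^ 2 / (ξ₂ ^ 2 + ζ ^ 2)) =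
      ξ₂ ^ 2 / (ξ₂ ^ 2 - ξ₁ ^ 2) * (ξ₁ ^ 2 / (ξ₁ ^ 2 + ζ ^ 2)) -
        ξ₁ ^ 2 / (ξ₂ ^ 2 - ξ₁ ^ 2) * (ξ₂ ^ 2 / (ξ₂ ^ 2 + ζ ^ 2)) := fun ζ => by
    have h3 : ξ₁ ^ 2 + ζ ^ 2 ≠ 0 := by positivity
    have h4 : ξ₂ ^ 2 + ζ ^ 2 ≠ 0 := by positivity
    field_simp
    ring
  simp only [h]
  rw [integral_sub ((integrable_lorentzian h₁).integrableOn.const_mul _)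
    ((integrable_lorentzian h₂).integrableOn.const_mul _), integral_const_mul,
    integral_const_mul, integral_lorentzian h₁, integral_lorentzian h₂]
  rw [sq_sub_sq, add_comm ξ₂ ξ₁]
  field_simp

end Lorentzian

namespace RegularSymbol

variable {Ψ Ψ' Ψ'' f f' g g' : ℝ → ℝ} {B B' : ℝ}

theorem integral_mul_boundary (hΨ : RegularSymbol Ψ Ψ' Ψ'') (hf : BoundedC1 f f' B)
    (hg : BoundedC1 g g' B') (hfi : IntegrableOn f (Ioi 0)) (hgi : IntegrableOn g (Ioi 0))
    (hff : IntegrableOn (fun ζ => f ζ * f ζ) (Ioi 0))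
    (hfg : IntegrableOn (fun ζ => f ζ * g ζ) (Ioi 0))
    (hgg : IntegrableOn (fun ζ => g ζ * g ζ) (Ioi 0)) {K k l : ℝ → ℝ}
    (hK : ∀ lam ∈ Ioi (0:ℝ), Tendsto (fun ε : ℝ => -(Real.pi)⁻¹ *
      ∫ ζ in Ioi (0:ℝ) \ Icc (lam - ε) (lam + ε), Ψ' lam / (Ψ lam - Ψ ζ))
        (𝓝[>] 0) (𝓝 (K lam)))
    (hk : ∀ lam ∈ Ioi (0:ℝ), Tendsto (fun ε : ℝ => -(Real.pi)⁻¹ *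
      ∫ ζ in Ioi (0:ℝ) \ Icc (lam - ε) (lam + ε), f ζ * (Ψ' lam / (Ψ lam - Ψ ζ)))
        (𝓝[>] 0) (𝓝 (k lam)))
    (hl : ∀ lam ∈ Ioi (0:ℝ), Tendsto (fun ε : ℝ => -(Real.pi)⁻¹ *
      ∫ ζ in Ioi (0:ℝ) \ Icc (lam - ε) (lam + ε), g ζ * (Ψ' lam / (Ψ lam - Ψ ζ)))
        (𝓝[>] 0) (𝓝 (l lam))) :
    IntegrableOn (fun lam => (K lam * f lam - k lam) * (K lam * g lam - l lam) /
      (1 + K lam ^ 2)) (Ioi 0) ∧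
    ∫ lam in Ioi (0:ℝ), (K lam * f lam - k lam) * (K lam * g lam - l lam) / (1 + K lam ^ 2) =
      ∫ ζ in Ioi (0:ℝ), f ζ * g ζ := by
  have hsq : ∀ s : ℝ, IntegrableOn (fun ζ => (f ζ + s * g ζ) ^ 2) (Ioi 0) := fun s => by
    refine IntegrableOn.congr_fun (((hff.add (hfg.const_mul (2 * s))).add
      (hgg.const_mul (s ^ 2)))) (fun ζ _ => ?_) measurableSet_Ioi
    simp only [Pi.add_apply]
    ring
  have key : ∀ s : ℝ, _ := fun s => hΨ.integral_sq_boundary (hf.add_mul hg s)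
    (hfi.add (hgi.const_mul s)) (hsq s) (by simpa only [one_mul] using hK)
    fun lam hlam => hΨ.tendsto_principalValue_add_mul hf hg s hlam (hk lam hlam) (hl lam hlam)
  obtain ⟨i₁, e₁⟩ := key 1
  obtain ⟨i₂, e₂⟩ := key (-1)
  have hpol : ∀ lam, (K lam * f lam - k lam) * (K lam * g lam - l lam) / (1 + K lam ^ 2) =
      4⁻¹ * ((K lam * (f lam + 1 * g lam) - (k lam + 1 * l lam)) ^ 2 / (1 + K lam ^ 2) -
        (K lam * (f lam + -1 * g lam) - (k lam + -1 * l lam)) ^ 2 / (1 + K lam ^ 2)) :=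
    fun lam => by ring
  have hpol' : ∀ ζ, f ζ * g ζ = 4⁻¹ * ((f ζ + 1 * g ζ) ^ 2 - (f ζ + -1 * g ζ) ^ 2) :=
    fun ζ => by ring
  simp only [hpol, hpol']
  refine ⟨(i₁.sub i₂).const_mul _, ?_⟩
  rw [integral_const_mul, integral_const_mul, integral_sub i₁ i₂,
    integral_sub (hsq 1) (hsq (-1)), e₁, e₂]

end RegularSymbol

theorem Phi_at_time_zero (Ψ Ψ' Ψ'' : ℝ → ℝ)
    (hmono : StrictMonoOn Ψ (Ioi 0))
    (hnonneg : ∀ ζ ∈ Ioi (0:ℝ), 0 ≤ Ψ ζ)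
    (hΨd1 : ∀ ζ ∈ Ioi (0:ℝ), HasDerivAt Ψ (Ψ' ζ) ζ)
    (hΨd2 : ∀ ζ ∈ Ioi (0:ℝ), HasDerivAt Ψ' (Ψ'' ζ) ζ)
    (hΨ''cont : ContinuousOn Ψ'' (Ioi 0))
    (hΨ'pos : ∀ ζ ∈ Ioi (0:ℝ), 0 < Ψ' ζ)
    (hint : IntegrableOn (fun ζ => 1 / (1 + Ψ ζ)) (Ioi 0))
    (hΨ0 : Tendsto Ψ (𝓝[>] 0) (𝓝 0))
    (hΨtop : Tendsto Ψ atTop atTop)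
    (K : ℝ → ℝ) (Kx : ℝ → ℝ → ℝ)
    (hK : ∀ lam ∈ Ioi (0:ℝ), Tendsto (fun ε : ℝ =>
        -(Real.pi)⁻¹ * ∫ ζ in Ioi (0:ℝ) \ Icc (lam - ε) (lam + ε),
          Ψ' lam / (Ψ lam - Ψ ζ))
      (𝓝[>] 0) (𝓝 (K lam)))
    (hKx : ∀ lam ∈ Ioi (0:ℝ), ∀ ξ ∈ Ioi (0:ℝ), Tendsto (fun ε : ℝ =>
        -(Real.pi)⁻¹ * ∫ ζ in Ioi (0:ℝ) \ Icc (lam - ε) (lam + ε),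
          (ξ^2 / (ξ^2 + ζ^2)) * (Ψ' lam / (Ψ lam - Ψ ζ)))
      (𝓝[>] 0) (𝓝 (Kx lam ξ)))
    (ξ₁ ξ₂ : ℝ) (hξ₁ : 0 < ξ₁) (hξ₂ : 0 < ξ₂) :
    IntegrableOn (fun lam =>
        (K lam * (ξ₁^2 / (ξ₁^2 + lam^2)) - Kx lam ξ₁) *
          (K lam * (ξ₂^2 / (ξ₂^2 + lam^2)) - Kx lam ξ₂) / (1 + (K lam)^2))
      (Ioi 0) ∧
    (∫ lam in Ioi (0:ℝ),
        (K lam * (ξ₁^2 / (ξ₁^2 + lam^2)) - Kx lam ξ₁) *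
          (K lam * (ξ₂^2 / (ξ₂^2 + lam^2)) - Kx lam ξ₂) / (1 + (K lam)^2))
      = (Real.pi / 2) * (ξ₁ * ξ₂ / (ξ₁ + ξ₂)) := by
  have hpos : ∀ ζ ∈ Ioi (0:ℝ), 0 < Ψ ζ := fun ζ hζ =>
    (hnonneg _ (mem_Ioi.2 (half_pos hζ))).trans_lt (hmono (mem_Ioi.2 (half_pos hζ)) hζ (half_lt_self hζ))
  have hΨ : RegularSymbol Ψ Ψ' Ψ'' :=
    ⟨hmono, hpos, hΨd1, hΨd2, hΨ''cont, hΨ'pos, hint, hΨ0, hΨtop⟩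
  rw [← integral_lorentzian_mul hξ₁ hξ₂]
  exact hΨ.integral_mul_boundary (boundedC1_lorentzian hξ₁) (boundedC1_lorentzian hξ₂)
    (integrable_lorentzian hξ₁).integrableOn (integrable_lorentzian hξ₂).integrableOn
    (integrable_lorentzian_mul hξ₁ hξ₁).integrableOn
    (integrable_lorentzian_mul hξ₁ hξ₂).integrableOn
    (integrable_lorentzian_mul hξ₂ hξ₂).integrableOn hK
    (fun lam hlam => hKx lam hlam ξ₁ hξ₁) (fun lam hlam => hKx lam hlam ξ₂ hξ₂)
end

section
/- Assume Ψ : (0,∞) → [0,∞) is strictly increasing, twice continuously differentiable with Ψ'(ζ) > 0 for all ζ > 0, and ∫₀^∞ 1/(1+Ψ(ζ)) dζ < ∞. Fix λ > 0 and let ϑ_λ = arctan K_λ, G_λ(x) = (cos ϑ_λ / π) ∫₀^∞ (2λ/(λ²−u²) − Ψ'(λ)/(Ψ(λ)−Ψ(u))) cos(ux) du and F_λ(x) = sin(λ|x| + ϑ_λ) − G_λ(x) for x ∈ ℝ. Then for every ξ > 0, the function x ↦ F_λ(x)·e^{−ξ|x|} is Lebesgue integrable on ℝ and ∫_ℝ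 F_λ(x) e^{−ξ|x|} dx = (2/ξ) · (K_λ L_λ(ξ) − K_λ(ξ)) / √(1 + K_λ²). -/
open MeasureTheory Filter Topology Set

theorem integrable_exp_neg_mul_abs {ξ : ℝ} (hξ : 0 < ξ) :
    Integrable (fun x : ℝ => Real.exp (-(ξ * |x|))) := by
  apply Integrable.of_integral_ne_zero
  rw [integral_comp_abs (f := fun x => Real.exp (-(ξ * x)))]
  have := integral_exp_mul_Ioi (a := -ξ) (by linarith) 0
  simp only [neg_mul] at this
  rw [this]
  simp [hξ.ne']

theorem integrable_bounded_mul_exp_neg_mul_abs {ξ : ℝ} (hξ : 0 < ξ) {f : ℝ → ℝ}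
    (hf : Continuous f) (hb : ∀ x, ‖f x‖ ≤ 1) :
    Integrable (fun x : ℝ => f x * Real.exp (-(ξ * |x|))) :=
  (integrable_exp_neg_mul_abs hξ).bdd_mul hf.aestronglyMeasurable (ae_of_all _ hb)

theorem integral_sin_mul_exp_neg_mul_abs {ξ : ℝ} (hξ : 0 < ξ) (a b : ℝ) :
    ∫ x : ℝ, Real.sin (a * |x| + b) * Real.exp (-(ξ * |x|))
      = 2 * ((ξ * Real.sin b + a * Real.cos b) / (ξ ^ 2 + a ^ 2)) := by
  rw [integral_comp_abs (f := fun x => Real.sin (a * x + b) * Real.exp (-(ξ * x)))]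
  congr 1
  have hne : ξ ^ 2 + a ^ 2 ≠ 0 := by positivity
  have hderiv : ∀ x ∈ Ici (0 : ℝ), HasDerivAt
      (fun x => -(ξ * Real.sin (a * x + b) + a * Real.cos (a * x + b)) / (ξ ^ 2 + a ^ 2)
        * Real.exp (-(ξ * x)))
      (Real.sin (a * x + b) * Real.exp (-(ξ * x))) x := by
    intro x _
    have hl : HasDerivAt (fun x : ℝ => a * x + b) a x := by
      simpa using ((hasDerivAt_id x).const_mul a).add_const b
    have he : HasDerivAt (fun x : ℝ => -(ξ * x)) (-ξ) x := by
      simpa only [neg_mul, mul_one] using (hasDerivAt_id' x).const_mul (-ξ)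
    have h := ((((hl.sin.const_mul ξ).add (hl.cos.const_mul a)).neg.div_const
      (ξ ^ 2 + a ^ 2)).mul he.exp)
    refine h.congr_deriv ?_
    simp only [Pi.add_apply, Pi.neg_apply]
    field_simp
    ring
  have hint : IntegrableOn (fun x => Real.sin (a * x + b) * Real.exp (-(ξ * x))) (Ioi 0) := by
    refine ((integrable_bounded_mul_exp_neg_mul_abs hξ (f := fun x => Real.sin (a * x + b))
      (by fun_prop) (fun x => Real.abs_sin_le_one _)).integrableOn (s := Ioi 0)).congr_fun
      (fun x hx => ?_) measurableSet_Ioi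
    simp only [abs_of_pos (mem_Ioi.1 hx)]
  have hlim : Tendsto (fun x => -(ξ * Real.sin (a * x + b) + a * Real.cos (a * x + b))
      / (ξ ^ 2 + a ^ 2) * Real.exp (-(ξ * x))) atTop (𝓝 0) := by
    refine Tendsto.zero_mul_isBoundedUnder_le ?_ ?_ |>.congr (fun x => mul_comm _ _)
    · exact Real.tendsto_exp_neg_atTop_nhds_zero.comp (tendsto_id.const_mul_atTop hξ)
    · refine isBoundedUnder_of ⟨(|ξ| + |a|) / (ξ ^ 2 + a ^ 2), fun x => ?_⟩
      simp only [Function.comp, Real.norm_eq_abs, abs_div, abs_neg]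
      rw [abs_of_pos (a := ξ ^ 2 + a ^ 2) (by positivity)]
      gcongr
      refine (abs_add_le _ _).trans (add_le_add ?_ ?_)
      · rw [abs_mul]
        exact mul_le_of_le_one_right (abs_nonneg _) (Real.abs_sin_le_one _)
      · rw [abs_mul]
        exact mul_le_of_le_one_right (abs_nonneg _) (Real.abs_cos_le_one _)
  rw [integral_Ioi_of_hasDerivAt_of_tendsto' hderiv hint hlim]
  simp
  ring

theorem integral_cos_mul_exp_neg_mul_abs {ξ : ℝ} (hξ : 0 < ξ) (a : ℝ) :
    ∫ x : ℝ, Real.cos (a * x) * Real.exp (-(ξ * |x|)) = 2 * (ξ / (ξ ^ 2 + a ^ 2)) := by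
  have h := integral_sin_mul_exp_neg_mul_abs hξ a (Real.pi / 2)
  simp only [Real.sin_add_pi_div_two, Real.sin_pi_div_two, Real.cos_pi_div_two, mul_one,
    mul_zero, add_zero] at h
  rw [← h]
  congr 1 with x
  rcases abs_cases x with ⟨hx, _⟩ | ⟨hx, _⟩ <;> simp [hx]

theorem integral_Ioi_inv_sq_add_sq {ξ : ℝ} (hξ : 0 < ξ) :
    ∫ x in Ioi (0 : ℝ), 1 / (ξ ^ 2 + x ^ 2) = Real.pi / (2 * ξ) := by
  have h := integral_comp_mul_left_Ioi (fun x => (1 + x ^ 2)⁻¹) 0 (inv_pos.2 hξ)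
  simp only [mul_zero, integral_Ioi_inv_one_add_sq, Real.arctan_zero, inv_inv, smul_eq_mul] at h
  have : ∀ x : ℝ, 1 / (ξ ^ 2 + x ^ 2) = (ξ ^ 2)⁻¹ * (1 + (ξ⁻¹ * x) ^ 2)⁻¹ := by
    intro x; field_simp
  simp_rw [this]
  rw [integral_const_mul, h]
  field_simp
  ring

theorem integrable_inv_sq_add_sq {ξ : ℝ} (hξ : 0 < ξ) :
    Integrable fun x : ℝ => 1 / (ξ ^ 2 + x ^ 2) := by
  have : ∀ x : ℝ, 1 / (ξ ^ 2 + x ^ 2) = (ξ ^ 2)⁻¹ * (1 + (ξ⁻¹ * x) ^ 2)⁻¹ := by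
    intro x; field_simp
  simp_rw [this]
  exact (integrable_inv_one_add_sq.comp_mul_left' (inv_ne_zero hξ.ne')).const_mul _

theorem tendsto_setIntegral_diff_Icc {f : ℝ → ℝ} {s : Set ℝ}  (hf : IntegrableOn f s) (c : ℝ) :
    Tendsto (fun ε : ℝ => ∫ x in s \ Icc (c - ε) (c + ε), f x) (𝓝[>] 0)
      (𝓝 (∫ x in s, f x)) := by
  have hrw : ∀ ε : ℝ, ∫ x in s \ Icc (c - ε) (c + ε), f x
      = ∫ x in s, (Icc (c - ε) (c + ε))ᶜ.indicator f x := by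
    intro ε
    rw [setIntegral_indicator measurableSet_Icc.compl, sdiff_eq]
  simp_rw [hrw]
  refine tendsto_integral_filter_of_dominated_convergence (fun x => ‖f x‖) ?_ ?_ hf.norm ?_
  · exact Eventually.of_forall fun ε =>
      hf.aestronglyMeasurable.indicator measurableSet_Icc.compl
  · exact Eventually.of_forall fun ε => ae_of_all _ fun x => norm_indicator_le_norm_self _ _
  · have hc : ∀ᵐ x ∂(volume.restrict s), x ≠ c := by
      exact ae_restrict_of_ae (Measure.ae_ne volume c)
    filter_upwards [hc] with x hx
    refine tendsto_const_nhds.congr' ?_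
    have hpos : 0 < |x - c| := abs_pos.2 (sub_ne_zero.2 hx)
    filter_upwards [Ioo_mem_nhdsGT hpos] with ε hε
    rw [indicator_of_mem]
    intro hmem
    have : |x - c| ≤ ε := abs_le.2 ⟨by linarith [hmem.1], by linarith [hmem.2]⟩
    linarith [hε.2]

theorem Ioi_diff_Icc_eq {c ε : ℝ} (hε : 0 < ε) (hc : ε < c) :
    Ioi (0 : ℝ) \ Icc (c - ε) (c + ε) = Ioo 0 (c - ε) ∪ Ioi (c + ε) := by
  ext x
  simp only [Set.mem_sdiff, mem_Ioi, mem_Icc, mem_union, mem_Ioo, not_and_or, not_le]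
  constructor
  · rintro ⟨h0, h | h⟩
    · exact Or.inl ⟨h0, h⟩
    · exact Or.inr h
  · rintro (⟨h0, h⟩ | h)
    · exact ⟨h0, Or.inl h⟩
    · exact ⟨by linarith, Or.inr h⟩

theorem hasDerivAt_log_add_sub_log_sub {c x : ℝ} (h₁ : c + x ≠ 0) (h₂ : c - x ≠ 0) :
    HasDerivAt (fun x => Real.log (c + x) - Real.log (c - x)) (2 * c / (c ^ 2 - x ^ 2)) x := by
  have ha : HasDerivAt (fun x : ℝ => c + x) 1 x := (hasDerivAt_id x).const_add c
  have hb : HasDerivAt (fun x : ℝ => c - x) (-1) x := (hasDerivAt_id x).const_sub c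
  refine ((ha.log h₁).sub (hb.log h₂)).congr_deriv ?_
  have : c ^ 2 - x ^ 2 ≠ 0 := by
    rw [sq_sub_sq]; exact mul_ne_zero h₁ h₂
  field_simp
  ring

theorem tendsto_log_add_sub_log_sub_atTop (c : ℝ) :
    Tendsto (fun x => Real.log (c + x) - Real.log (c - x)) atTop (𝓝 0) := by
  have h : Tendsto (fun x : ℝ => -1 + 2 * c * (c - x)⁻¹) atTop (𝓝 (-1)) := by
    have h1 : Tendsto (fun x : ℝ => c - x) atTop atBot :=
      tendsto_atBot_add_const_left _ c tendsto_neg_atTop_atBot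
    simpa using (h1.inv_tendsto_atBot.const_mul (2 * c)).const_add (-1)
  have h2 := ((Real.continuousAt_log (by norm_num : (-1 : ℝ) ≠ 0)).tendsto.comp h)
  simp only [Real.log_neg_eq_log, Real.log_one] at h2
  refine h2.congr' ?_
  filter_upwards [eventually_gt_atTop |c|] with x hx
  have h3 := abs_lt.1 hx
  have h4 : c + x ≠ 0 := by linarith
  have h5 : c - x ≠ 0 := by linarith [h3.2]
  rw [← Real.log_div h4 h5]
  simp only [Function.comp]
  congr 1
  field_simp
  ring

theorem integrableOn_Ioi_two_mul_div_sq_sub_sq {c a : ℝ} (hc : 0 < c) (ha : c < a) :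
    IntegrableOn (fun x => 2 * c / (c ^ 2 - x ^ 2)) (Ioi a) := by
  refine integrableOn_Ioi_deriv_of_nonpos' (fun x hx => hasDerivAt_log_add_sub_log_sub ?_ ?_) ?_
    (tendsto_log_add_sub_log_sub_atTop c)
  · have := mem_Ici.1 hx; linarith
  · have := mem_Ici.1 hx; linarith
  · intro x hx
    have := mem_Ioi.1 hx
    exact div_nonpos_of_nonneg_of_nonpos (by positivity) (by nlinarith)

theorem intervalIntegrable_two_mul_div_sq_sub_sq {c b : ℝ} (hc : 0 < c) (hb0 : 0 ≤ b)
    (hb : b < c) :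
    IntervalIntegrable (fun x => 2 * c / (c ^ 2 - x ^ 2)) volume 0 b := by
  refine ContinuousOn.intervalIntegrable (ContinuousOn.div (by fun_prop) (by fun_prop) ?_)
  intro x hx
  rw [uIcc_of_le hb0] at hx
  nlinarith [hx.1, hx.2]

theorem integrableOn_two_mul_div_sq_sub_sq {c ε : ℝ} (hε : 0 < ε) (hc : ε < c) :
    IntegrableOn (fun x => 2 * c / (c ^ 2 - x ^ 2)) (Ioi (0 : ℝ) \ Icc (c - ε) (c + ε)) := by
  rw [Ioi_diff_Icc_eq hε hc]
  refine IntegrableOn.union ?_ (integrableOn_Ioi_two_mul_div_sq_sub_sq (by linarith) (by linarith))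
  have h := intervalIntegrable_two_mul_div_sq_sub_sq (c := c) (b := c - ε) (by linarith)
    (by linarith) (by linarith)
  exact ((intervalIntegrable_iff_integrableOn_Ioc_of_le (by linarith)).1 h).mono_set
    Ioo_subset_Ioc_self

theorem tendsto_setIntegral_two_mul_div_sq_sub_sq {c : ℝ} (hc : 0 < c) :
    Tendsto (fun ε : ℝ => ∫ x in Ioi (0 : ℝ) \ Icc (c - ε) (c + ε), 2 * c / (c ^ 2 - x ^ 2))
      (𝓝[>] 0) (𝓝 0) := by
  have hlim : Tendsto (fun ε : ℝ => Real.log (2 * c - ε) - Real.log (2 * c + ε)) (𝓝[>] 0)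
      (𝓝 0) := by
    refine tendsto_nhdsWithin_of_tendsto_nhds ?_
    have : ContinuousAt (fun ε : ℝ => Real.log (2 * c - ε) - Real.log (2 * c + ε)) 0 :=
      ContinuousAt.sub (ContinuousAt.log (by fun_prop) (by simp [hc.ne']))
        (ContinuousAt.log (by fun_prop) (by simp [hc.ne']))
    simpa [ContinuousAt] using this
  refine hlim.congr' ?_
  filter_upwards [Ioo_mem_nhdsGT hc] with ε hε
  have h1 := hε.1
  have h2 := hε.2
  have hi := integrableOn_two_mul_div_sq_sub_sq h1 h2
  rw [Ioi_diff_Icc_eq h1 h2] at hi ⊢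
  rw [setIntegral_union _ measurableSet_Ioi (hi.mono_set subset_union_left)
    (hi.mono_set subset_union_right)]
  · rw [integral_Ioi_of_hasDerivAt_of_tendsto' (fun x hx => hasDerivAt_log_add_sub_log_sub ?_ ?_)
      (hi.mono_set subset_union_right) (tendsto_log_add_sub_log_sub_atTop c),
      ← integral_Ioc_eq_integral_Ioo, ← intervalIntegral.integral_of_le (by linarith),
      intervalIntegral.integral_eq_sub_of_hasDerivAt
        (fun x hx => hasDerivAt_log_add_sub_log_sub ?_ ?_)
        (intervalIntegrable_two_mul_div_sq_sub_sq hc (by linarith) (by linarith))]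
    · have e1 : c - (c - ε) = ε := by ring
      have e2 : c - (c + ε) = -ε := by ring
      have e3 : c + (c - ε) = 2 * c - ε := by ring
      have e4 : c + (c + ε) = 2 * c + ε := by ring
      rw [e1, e2, e3, e4, Real.log_neg_eq_log]
      simp
    · rw [uIcc_of_le (by linarith)] at hx; linarith [hx.1]
    · rw [uIcc_of_le (by linarith)] at hx; linarith [hx.2]
    · have := mem_Ici.1 hx; linarith
    · have := mem_Ici.1 hx; linarith
  · exact Set.disjoint_left.2 fun x hx hx' => by
      have := mem_Ioi.1 hx'; linarith [hx.2]

theorem tendsto_setIntegral_weight_mul_two_mul_div_sq_sub_sq {c ξ : ℝ} (hc : 0 < c) (hξ : 0 < ξ) :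
    Tendsto (fun ε : ℝ => ∫ x in Ioi (0 : ℝ) \ Icc (c - ε) (c + ε),
        (ξ ^ 2 / (ξ ^ 2 + x ^ 2)) * (2 * c / (c ^ 2 - x ^ 2)))
      (𝓝[>] 0) (𝓝 (Real.pi * ξ * c / (ξ ^ 2 + c ^ 2))) := by
  have h1 := (tendsto_setIntegral_two_mul_div_sq_sub_sq hc).const_mul (ξ ^ 2 / (ξ ^ 2 + c ^ 2))
  have h2 := (tendsto_setIntegral_diff_Icc
    ((integrable_inv_sq_add_sq hξ).integrableOn (s := Ioi 0)) c).const_mul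
      (2 * c * ξ ^ 2 / (ξ ^ 2 + c ^ 2))
  rw [integral_Ioi_inv_sq_add_sq hξ] at h2
  have h3 := h1.add h2
  have : ξ ^ 2 / (ξ ^ 2 + c ^ 2) * 0 + 2 * c * ξ ^ 2 / (ξ ^ 2 + c ^ 2) * (Real.pi / (2 * ξ))
      = Real.pi * ξ * c / (ξ ^ 2 + c ^ 2) := by field_simp; ring
  rw [this] at h3
  refine h3.congr' ?_
  filter_upwards [Ioo_mem_nhdsGT hc] with ε hε
  rw [← integral_const_mul, ← integral_const_mul, ← integral_add
    ((integrableOn_two_mul_div_sq_sub_sq hε.1 hε.2).const_mul _)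
    ((integrable_inv_sq_add_sq hξ).integrableOn.const_mul _)]
  refine setIntegral_congr_fun (measurableSet_Ioi.diff measurableSet_Icc) fun x hx => ?_
  have h0 : 0 < x := hx.1
  have hne : c ^ 2 - x ^ 2 ≠ 0 := by
    have : x ≠ c := fun h => hx.2 (by subst h; constructor <;> linarith [hε.1])
    rw [sq_sub_sq]
    exact mul_ne_zero (by positivity) (sub_ne_zero.2 this.symm)
  have h4 : ξ ^ 2 + x ^ 2 ≠ 0 := by positivity
  have h5 : ξ ^ 2 + c ^ 2 ≠ 0 := by positivity
  field_simp
  ring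

theorem exists_abs_sub_sub_deriv_mul_le {Ψ Ψ' Ψ'' : ℝ → ℝ}
    (hd1 : ∀ ζ ∈ Ioi (0:ℝ), HasDerivAt Ψ (Ψ' ζ) ζ)
    (hd2 : ∀ ζ ∈ Ioi (0:ℝ), HasDerivAt Ψ' (Ψ'' ζ) ζ)
    (hcont : ContinuousOn Ψ'' (Ioi 0)) {c : ℝ} (hc : 0 < c) :
    ∃ C : ℝ, 0 < C ∧ ∀ u ∈ Icc (c / 2) (3 * c / 2),
      |Ψ c - Ψ u - Ψ' c * (c - u)| ≤ C * (c - u) ^ 2 := by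
  have hsub : Icc (c / 2) (3 * c / 2) ⊆ Ioi 0 := fun x hx => by
    have := hx.1
    exact mem_Ioi.2 (by linarith)
  obtain ⟨C, hC⟩ := isCompact_Icc.exists_bound_of_continuousOn (hcont.mono hsub)
  have hcmem : c ∈ Icc (c / 2) (3 * c / 2) := ⟨by linarith, by linarith⟩
  have hC0 : 0 ≤ C := (norm_nonneg _).trans (hC c hcmem)
  refine ⟨C + 1, by linarith, fun u hu => ?_⟩
  have hsub' : uIcc c u ⊆ Icc (c / 2) (3 * c / 2) := uIcc_subset_Icc hcmem hu
  have hlip : ∀ v ∈ uIcc c u, ‖Ψ' v - Ψ' c‖ ≤ C * |c - u| := fun v hv => by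
    have h := (convex_Icc (c / 2) (3 * c / 2)).norm_image_sub_le_of_norm_hasDerivWithin_le
      (fun x hx => (hd2 x (hsub hx)).hasDerivWithinAt) hC hcmem (hsub' hv)
    refine h.trans (mul_le_mul_of_nonneg_left ?_ hC0)
    rw [Real.norm_eq_abs, abs_sub_comm c u]
    exact abs_sub_left_of_mem_uIcc hv
  have hderiv : ∀ v ∈ uIcc c u,
      HasDerivWithinAt (fun v => Ψ v - Ψ' c * v) (Ψ' v - Ψ' c) (uIcc c u) v := fun v hv => by
    have h := (hd1 v (hsub (hsub' hv))).sub ((hasDerivAt_id' v).const_mul (Ψ' c))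
    rw [mul_one] at h
    exact h.hasDerivWithinAt
  have h := (convex_uIcc c u).norm_image_sub_le_of_norm_hasDerivWithin_le hderiv hlip
    right_mem_uIcc left_mem_uIcc
  have e : Ψ c - Ψ' c * c - (Ψ u - Ψ' c * u) = Ψ c - Ψ u - Ψ' c * (c - u) := by ring
  rw [e, Real.norm_eq_abs, Real.norm_eq_abs, mul_assoc, ← abs_mul, ← sq, abs_sq] at h
  nlinarith [sq_nonneg (c - u)]

theorem exists_norm_two_mul_div_sub_le {Ψ Ψ' Ψ'' : ℝ → ℝ}
    (hd1 : ∀ ζ ∈ Ioi (0:ℝ), HasDerivAt Ψ (Ψ' ζ) ζ)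
    (hd2 : ∀ ζ ∈ Ioi (0:ℝ), HasDerivAt Ψ' (Ψ'' ζ) ζ)
    (hcont : ContinuousOn Ψ'' (Ioi 0)) {c : ℝ} (hc : 0 < c) (hpos : 0 < Ψ' c) :
    ∃ δ M : ℝ, 0 < δ ∧ δ < c ∧ ∀ u ∈ Icc (c - δ) (c + δ),
      ‖2 * c / (c ^ 2 - u ^ 2) - Ψ' c / (Ψ c - Ψ u)‖ ≤ M := by
  obtain ⟨C, hC, hT⟩ := exists_abs_sub_sub_deriv_mul_le hd1 hd2 hcont hc
  set p := Ψ' c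
  refine ⟨min (c / 2) (p / (2 * C)), 1 / c + 2 * C / p, by positivity,
    (min_le_left _ _).trans_lt (by linarith), fun u hu => ?_⟩
  have hδ1 := min_le_left (c / 2) (p / (2 * C))
  have hδ2 := min_le_right (c / 2) (p / (2 * C))
  have hu0 : c / 2 ≤ u := by linarith [hu.1]
  have hT' := hT u ⟨hu0, by linarith [hu.2]⟩
  rcases eq_or_ne u c with rfl | hne
  · simp
    positivity
  have hd : c - u ≠ 0 := sub_ne_zero.2 hne.symm
  have hdist : |c - u| ≤ p / (2 * C) :=
    (abs_le.2 ⟨by linarith [hu.2], by linarith [hu.1]⟩).trans hδ2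
  have hdpos : 0 < |c - u| := abs_pos.2 hd
  have hCd : C * (c - u) ^ 2 ≤ p / 2 * |c - u| := by
    rw [← sq_abs, sq, ← mul_assoc]
    refine mul_le_mul_of_nonneg_right ?_ hdpos.le
    rw [le_div_iff₀ (by positivity)] at hdist
    linarith
  have hlow : p / 2 * |c - u| ≤ |Ψ c - Ψ u| := by
    have h1 := abs_sub_abs_le_abs_sub (p * (c - u)) (Ψ c - Ψ u)
    rw [abs_sub_comm (p * (c - u)), abs_mul, abs_of_pos hpos] at h1
    linarith
  have hΨ : Ψ c - Ψ u ≠ 0 := abs_pos.1 (lt_of_lt_of_le (by positivity) hlow)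
  have hsum : c + u ≠ 0 := by linarith
  have e : 2 * c / (c ^ 2 - u ^ 2) - p / (Ψ c - Ψ u)
      = 1 / (c + u) + (Ψ c - Ψ u - p * (c - u)) / ((c - u) * (Ψ c - Ψ u)) := by
    rw [sq_sub_sq]
    field_simp
    ring
  rw [e]
  refine (norm_add_le _ _).trans (add_le_add ?_ ?_)
  · rw [Real.norm_eq_abs, abs_of_pos (by apply div_pos <;> linarith)]
    exact one_div_le_one_div_of_le hc (by linarith)
  · rw [Real.norm_eq_abs, abs_div, abs_mul]
    calc _ ≤ C * (c - u) ^ 2 / (|c - u| * (p / 2 * |c - u|)) := by gcongr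
      _ = 2 * C / p := by
        rw [← sq_abs]
        field_simp

theorem integrableOn_div_sub {Ψ : ℝ → ℝ}
    (hmono : StrictMonoOn Ψ (Ioi 0)) (hnonneg : ∀ ζ ∈ Ioi (0:ℝ), 0 ≤ Ψ ζ)
    (hint : IntegrableOn (fun ζ => 1 / (1 + Ψ ζ)) (Ioi 0))
    (hmeas : AEMeasurable Ψ (volume.restrict (Ioi 0))) (a : ℝ)
    {c δ : ℝ} (hδ : 0 < δ) (hδc : δ < c) :
    IntegrableOn (fun u => a / (Ψ c - Ψ u)) (Ioi 0 \ Icc (c - δ) (c + δ)) := by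
  have hc : c ∈ Ioi (0 : ℝ) := mem_Ioi.2 (by linarith)
  have hl : c - δ ∈ Ioi (0 : ℝ) := mem_Ioi.2 (by linarith)
  have hr : c + δ ∈ Ioi (0 : ℝ) := mem_Ioi.2 (by linarith)
  have hml : Ψ (c - δ) < Ψ c := hmono hl hc (by linarith)
  have hmr : Ψ c < Ψ (c + δ) := hmono hc hr (by linarith)
  have h0 := hnonneg _ hl
  set A := (1 + Ψ c) / (Ψ c - Ψ (c - δ))
  set B := (1 + Ψ (c + δ)) / (Ψ (c + δ) - Ψ c)
  have hA : 0 ≤ A := div_nonneg (by linarith) (by linarith)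
  have hB : 0 ≤ B := div_nonneg (by linarith) (by linarith)
  have hmeas' := hmeas.mono_set (sdiff_subset (s := Ioi (0 : ℝ)) (t := Icc (c - δ) (c + δ)))
  refine ((hint.mono_set sdiff_subset).const_mul (|a| * (A + B))).mono'
    (aemeasurable_const.div (aemeasurable_const.sub hmeas')).aestronglyMeasurable ?_
  filter_upwards [ae_restrict_mem (measurableSet_Ioi.diff measurableSet_Icc)] with u hu
  have hu0 : u ∈ Ioi (0 : ℝ) := hu.1
  have hΨu := hnonneg u hu0
  have hkey : 1 + Ψ u ≤ (A + B) * |Ψ c - Ψ u| := by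
    rcases lt_or_ge u (c - δ) with h | h
    · have h1 : Ψ u < Ψ (c - δ) := hmono hu0 hl h
      rw [abs_of_pos (by linarith)]
      have h2 : 1 + Ψ u ≤ A * (Ψ c - Ψ u) := by
        have : A * (Ψ c - Ψ (c - δ)) = 1 + Ψ c := div_mul_cancel₀ _ (by linarith)
        nlinarith
      nlinarith
    · have h' : c + δ < u := by
        by_contra hcon
        exact hu.2 ⟨h, not_lt.1 hcon⟩
      have h1 : Ψ (c + δ) < Ψ u := hmono hr hu0 h'
      rw [abs_of_neg (by linarith)]
      have h2 : 1 + Ψ u ≤ B * -(Ψ c - Ψ u) := by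
        have h3 : B * (Ψ (c + δ) - Ψ c) = 1 + Ψ (c + δ) := div_mul_cancel₀ _ (by linarith)
        have h4 : 1 ≤ B := by
          rw [le_div_iff₀ (by linarith)]
          linarith
        nlinarith
      nlinarith
  have hd : 0 < |Ψ c - Ψ u| := by
    by_contra hcon
    have : |Ψ c - Ψ u| = 0 := le_antisymm (not_lt.1 hcon) (abs_nonneg _)
    rw [this] at hkey
    linarith
  rw [Real.norm_eq_abs, abs_div, div_le_iff₀ hd, mul_assoc]
  rw [mul_assoc]
  refine le_mul_of_one_le_right (abs_nonneg a) ?_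
  rw [← mul_assoc, mul_right_comm, mul_one_div, one_le_div (by linarith)]
  exact hkey

theorem integrableOn_two_mul_div_sub {Ψ Ψ' Ψ'' : ℝ → ℝ}
    (hmono : StrictMonoOn Ψ (Ioi 0)) (hnonneg : ∀ ζ ∈ Ioi (0:ℝ), 0 ≤ Ψ ζ)
    (hd1 : ∀ ζ ∈ Ioi (0:ℝ), HasDerivAt Ψ (Ψ' ζ) ζ)
    (hd2 : ∀ ζ ∈ Ioi (0:ℝ), HasDerivAt Ψ' (Ψ'' ζ) ζ)
    (hcont : ContinuousOn Ψ'' (Ioi 0))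
    (hint : IntegrableOn (fun ζ => 1 / (1 + Ψ ζ)) (Ioi 0))
    (hmeas : AEMeasurable Ψ (volume.restrict (Ioi 0)))
    {c : ℝ} (hc : 0 < c) (hpos : 0 < Ψ' c) :
    IntegrableOn (fun u => 2 * c / (c ^ 2 - u ^ 2) - Ψ' c / (Ψ c - Ψ u)) (Ioi 0) := by
  obtain ⟨δ, M, hδ, hδc, hM⟩ := exists_norm_two_mul_div_sub_le hd1 hd2 hcont hc hpos
  have hsub : Icc (c - δ) (c + δ) ⊆ Ioi 0 := fun x hx => by
    have := hx.1
    exact mem_Ioi.2 (by linarith)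
  rw [← sdiff_union_of_subset hsub]
  refine IntegrableOn.union ((integrableOn_two_mul_div_sq_sub_sq hδ hδc).sub
    (integrableOn_div_sub hmono hnonneg hint hmeas _ hδ hδc)) ?_
  refine IntegrableOn.of_bound (by simp) ?_ M ?_
  · have h1 : Measurable fun u : ℝ => 2 * c / (c ^ 2 - u ^ 2) := by fun_prop
    exact (h1.aemeasurable.sub
      (aemeasurable_const.div (aemeasurable_const.sub (hmeas.mono_set hsub)))).aestronglyMeasurable
  · filter_upwards [ae_restrict_mem measurableSet_Icc] with u hu using hM u hu

theorem integral_weight_mul_two_mul_div_sub {Ψ : ℝ → ℝ}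
    (hmono : StrictMonoOn Ψ (Ioi 0)) (hnonneg : ∀ ζ ∈ Ioi (0:ℝ), 0 ≤ Ψ ζ)
    (hint : IntegrableOn (fun ζ => 1 / (1 + Ψ ζ)) (Ioi 0))
    (hmeas : AEMeasurable Ψ (volume.restrict (Ioi 0)))
    {a c ξ K : ℝ} (hc : 0 < c) (hξ : 0 < ξ)
    (hD : IntegrableOn (fun u => 2 * c / (c ^ 2 - u ^ 2) - a / (Ψ c - Ψ u)) (Ioi 0))
    (hK : Tendsto (fun ε : ℝ =>
        -(Real.pi)⁻¹ * ∫ ζ in Ioi (0:ℝ) \ Icc (c - ε) (c + ε),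
          (ξ^2 / (ξ^2 + ζ^2)) * (a / (Ψ c - Ψ ζ))) (𝓝[>] 0) (𝓝 K)) :
    ∫ u in Ioi (0 : ℝ), (ξ ^ 2 / (ξ ^ 2 + u ^ 2)) *
        (2 * c / (c ^ 2 - u ^ 2) - a / (Ψ c - Ψ u))
      = Real.pi * ξ * c / (ξ ^ 2 + c ^ 2) + Real.pi * K := by
  have hwc : Continuous fun u : ℝ => ξ ^ 2 / (ξ ^ 2 + u ^ 2) :=
    continuous_const.div (by fun_prop) fun u => by positivity
  have hw1 : ∀ u : ℝ, ‖ξ ^ 2 / (ξ ^ 2 + u ^ 2)‖ ≤ 1 := fun u => by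
    rw [Real.norm_of_nonneg (by positivity), div_le_one (by positivity)]
    nlinarith [sq_nonneg u]
  have hbdd : ∀ {f : ℝ → ℝ} {s : Set ℝ}, IntegrableOn f s →
      IntegrableOn (fun u => (ξ ^ 2 / (ξ ^ 2 + u ^ 2)) * f u) s := fun hf =>
    Integrable.bdd_mul hf hwc.aestronglyMeasurable (ae_of_all _ hw1)
  refine tendsto_nhds_unique (tendsto_setIntegral_diff_Icc (hbdd hD) c) ?_
  have h := (tendsto_setIntegral_weight_mul_two_mul_div_sq_sub_sq hc hξ).add
    (hK.const_mul Real.pi)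
  refine h.congr' ?_
  filter_upwards [Ioo_mem_nhdsGT hc] with ε hε
  simp only [mul_sub]
  rw [integral_sub (hbdd (integrableOn_two_mul_div_sq_sub_sq hε.1 hε.2))
    (hbdd (integrableOn_div_sub hmono hnonneg hint hmeas a hε.1 hε.2)),
    neg_mul, mul_neg, mul_inv_cancel_left₀ Real.pi_ne_zero]
  exact (sub_eq_add_neg _ _).symm

theorem integrable_prod_mul_cos_mul_exp {D : ℝ → ℝ} (hD : IntegrableOn D (Ioi 0)) {ξ : ℝ}
    (hξ : 0 < ξ) :
    Integrable (Function.uncurry fun x u : ℝ =>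
        D u * Real.cos (u * x) * Real.exp (-(ξ * |x|)))
      (volume.prod (volume.restrict (Ioi 0))) := by
  have h := (integrable_exp_neg_mul_abs hξ).mul_prod (L := ℝ) hD
  have hc : Continuous fun z : ℝ × ℝ => Real.cos (z.2 * z.1) := by fun_prop
  refine (h.bdd_mul (c := 1) hc.aestronglyMeasurable
    (ae_of_all _ fun z => Real.abs_cos_le_one _)).congr (ae_of_all _ fun z => ?_)
  simp only [Function.uncurry]
  ring

theorem integrable_cosTransform_mul_exp {D : ℝ → ℝ} (hD : IntegrableOn D (Ioi 0)) {ξ : ℝ}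
    (hξ : 0 < ξ) :
    Integrable fun x : ℝ =>
      (∫ u in Ioi (0 : ℝ), D u * Real.cos (u * x)) * Real.exp (-(ξ * |x|)) := by
  refine (integrable_prod_mul_cos_mul_exp hD hξ).integral_prod_left.congr (ae_of_all _ fun x => ?_)
  simp only [Function.uncurry]
  rw [integral_mul_const]

theorem integral_cosTransform_mul_exp {D : ℝ → ℝ} (hD : IntegrableOn D (Ioi 0)) {ξ : ℝ}
    (hξ : 0 < ξ) :
    ∫ x : ℝ, (∫ u in Ioi (0 : ℝ), D u * Real.cos (u * x)) * Real.exp (-(ξ * |x|))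
      = 2 / ξ * ∫ u in Ioi (0 : ℝ), (ξ ^ 2 / (ξ ^ 2 + u ^ 2)) * D u := by
  simp_rw [← integral_mul_const]
  rw [integral_integral_swap (integrable_prod_mul_cos_mul_exp hD hξ)]
  simp_rw [mul_assoc, integral_const_mul, integral_cos_mul_exp_neg_mul_abs hξ]
  rw [← integral_const_mul]
  congr 1 with u
  field_simp

theorem laplace_transform_of_F_lambda (Ψ Ψ' Ψ'' : ℝ → ℝ)
    (hmono : StrictMonoOn Ψ (Ioi 0))
    (hnonneg : ∀ ζ ∈ Ioi (0:ℝ), 0 ≤ Ψ ζ)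
    (hΨd1 : ∀ ζ ∈ Ioi (0:ℝ), HasDerivAt Ψ (Ψ' ζ) ζ)
    (hΨd2 : ∀ ζ ∈ Ioi (0:ℝ), HasDerivAt Ψ' (Ψ'' ζ) ζ)
    (hΨ''cont : ContinuousOn Ψ'' (Ioi 0))
    (hΨ'pos : ∀ ζ ∈ Ioi (0:ℝ), 0 < Ψ' ζ)
    (hint : IntegrableOn (fun ζ => 1 / (1 + Ψ ζ)) (Ioi 0))
    (lam : ℝ) (hlam : 0 < lam)
    (Kl : ℝ) (Kx : ℝ → ℝ)
    (hKl : Tendsto (fun ε : ℝ =>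
        -(Real.pi)⁻¹ * ∫ ζ in Ioi (0:ℝ) \ Icc (lam - ε) (lam + ε),
          Ψ' lam / (Ψ lam - Ψ ζ))
      (𝓝[>] 0) (𝓝 Kl))
    (hKx : ∀ ξ ∈ Ioi (0:ℝ), Tendsto (fun ε : ℝ =>
        -(Real.pi)⁻¹ * ∫ ζ in Ioi (0:ℝ) \ Icc (lam - ε) (lam + ε),
          (ξ^2 / (ξ^2 + ζ^2)) * (Ψ' lam / (Ψ lam - Ψ ζ)))
      (𝓝[>] 0) (𝓝 (Kx ξ)))
    (G F : ℝ → ℝ)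
    (hG : ∀ x : ℝ, G x = (Real.cos (Real.arctan Kl) / Real.pi) *
        ∫ u in Ioi (0:ℝ),
          (2 * lam / (lam^2 - u^2) - Ψ' lam / (Ψ lam - Ψ u)) * Real.cos (u * x))
    (hF : ∀ x : ℝ, F x = Real.sin (lam * |x| + Real.arctan Kl) - G x) :
    ∀ ξ ∈ Ioi (0:ℝ),
      Integrable (fun x : ℝ => F x * Real.exp (-(ξ * |x|))) ∧
      (∫ x : ℝ, F x * Real.exp (-(ξ * |x|)))
        = (2 / ξ) * (Kl * (ξ^2 / (ξ^2 + lam^2)) - Kx ξ) / Real.sqrt (1 + Kl^2) := by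
  intro ξ hξ'
  have hξ : 0 < ξ := hξ'
  have hmeas : AEMeasurable Ψ (volume.restrict (Ioi 0)) :=
    ContinuousOn.aemeasurable (fun x hx => (hΨd1 x hx).continuousAt.continuousWithinAt)
      measurableSet_Ioi
  have hD := integrableOn_two_mul_div_sub hmono hnonneg hΨd1 hΨd2 hΨ''cont hint hmeas hlam
    (hΨ'pos lam hlam)
  have hsin : Integrable fun x : ℝ =>
      Real.sin (lam * |x| + Real.arctan Kl) * Real.exp (-(ξ * |x|)) :=
    integrable_bounded_mul_exp_neg_mul_abs hξ (by fun_prop) fun x => Real.abs_sin_le_one _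
  have hGi := (integrable_cosTransform_mul_exp hD hξ).const_mul
    (Real.cos (Real.arctan Kl) / Real.pi)
  have hFe : (fun x : ℝ => F x * Real.exp (-(ξ * |x|))) = fun x =>
      Real.sin (lam * |x| + Real.arctan Kl) * Real.exp (-(ξ * |x|)) -
      Real.cos (Real.arctan Kl) / Real.pi * ((∫ u in Ioi (0:ℝ),
          (2 * lam / (lam^2 - u^2) - Ψ' lam / (Ψ lam - Ψ u)) * Real.cos (u * x)) *
        Real.exp (-(ξ * |x|))) := by
    ext x
    rw [hF, hG]
    ring
  rw [hFe]
  refine ⟨hsin.sub hGi, ?_⟩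
  rw [integral_sub hsin hGi, integral_const_mul, integral_cosTransform_mul_exp hD hξ,
    integral_weight_mul_two_mul_div_sub hmono hnonneg hint hmeas hlam hξ hD (hKx ξ hξ'),
    integral_sin_mul_exp_neg_mul_abs hξ, Real.sin_arctan, Real.cos_arctan]
  have hs : Real.sqrt (1 + Kl ^ 2) ≠ 0 := (Real.sqrt_pos.2 (by positivity)).ne'
  have hne : ξ ^ 2 + lam ^ 2 ≠ 0 := by positivity
  field_simp
  ring
end
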